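/- Let N ≥ 1 and let χ be a primitive Dirichlet character of conductor N whose root number ε_χ = τ(χ)/(i^δ · N^{1/2}) is not equal to −1 (where δ = 0 if χ(−1) = 1 and δ = 1 if χ(−1) = −1). Then there exist infinitely many real (quadratic) primitive Dirichlet characters χ' such that L(1/2, χ·χ') ≠ 0; equivalently, there are infinitely many fundamental discriminants d such that the central value of the quadratically twisted L-series of χ by χ_d is nonzero. (This is the GL(1) instance of the non-vanishing principle of §3.4: whenever the root number is not −1 for all twists, the double Dirichlet series Z(1/2, w) has a pole at w = 1 with nonzero residue, which forces the non-vanishing of infinitely many quadratic twists of the L-series at 1/2.) -/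

import Mathlib

open DirichletCharacter

/-- The central value `L(1/2, χ·χ')` of the product Dirichlet character `χ·χ'` modulo `N*q`
(junk value `0` in the degenerate case `N*q = 0`). -/
noncomputable def twistedCentralValue {N q : ℕ} (χ : DirichletCharacter ℂ N)
    (χ' : DirichletCharacter ℂ q) : ℂ :=
  if h : N * q ≠ 0 then
    haveI : NeZero (N * q) := ⟨h⟩
    DirichletCharacter.LFunction
      ((changeLevel (dvd_mul_right N q) χ) * (changeLevel (dvd_mul_left q N) χ')) (1 / 2)
  else 0

section PartA
namespace QT

open MeasureTheory Set Filter Topology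

/-- The smooth cutoff function in the approximate functional equation. -/
noncomputable def V (x : ℝ) : ℝ := ∫ u in Ioi (x ^ 2), Real.exp (-Real.pi * u) * u ^ (-(1 / 4) : ℝ)

lemma V_integrable {b : ℝ} (hb : -1 < b) :
    IntegrableOn (fun u : ℝ => Real.exp (-Real.pi * u) * u ^ b) (Ioi 0) := by
  have h := integrableOn_rpow_mul_exp_neg_mul_rpow (s := b) (p := 1) (b := Real.pi) hb one_pos
    Real.pi_pos
  refine h.congr_fun (fun u hu => ?_) measurableSet_Ioi
  simp [mul_comm]

lemma V_integrable' (x : ℝ) :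
    IntegrableOn (fun u : ℝ => Real.exp (-Real.pi * u) * u ^ (-(1 / 4) : ℝ)) (Ioi (x ^ 2)) :=
  (V_integrable (by norm_num)).mono_set (Ioi_subset_Ioi (sq_nonneg x))

lemma V_nonneg (x : ℝ) : 0 ≤ V x := by
  refine setIntegral_nonneg measurableSet_Ioi fun u hu => ?_
  have : 0 ≤ u := (sq_nonneg x).trans (le_of_lt hu)
  positivity

lemma V_anti {x y : ℝ} (hx : 0 ≤ x) (hxy : x ≤ y) : V y ≤ V x := by
  refine setIntegral_mono_set (V_integrable' x) ?_ ?_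
  · refine (ae_restrict_iff' measurableSet_Ioi).2 (Eventually.of_forall fun u hu => ?_)
    have : 0 ≤ u := (sq_nonneg x).trans (le_of_lt hu)
    simp only [Pi.zero_apply]
    positivity
  · exact (Ioi_subset_Ioi (by gcongr)).eventuallyLE

lemma V_le_zero {x : ℝ} (hx : 0 ≤ x) : V x ≤ V 0 := V_anti le_rfl hx

lemma V_pos (x : ℝ) : 0 < V x := by
  refine (setIntegral_pos_iff_support_of_nonneg_ae ?_ (V_integrable' x)).2 ?_
  · refine (ae_restrict_iff' measurableSet_Ioi).2 (Eventually.of_forall fun u hu => ?_)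
    have : 0 ≤ u := (sq_nonneg x).trans (le_of_lt hu)
    simp only [Pi.zero_apply]
    positivity
  · have : Ioi (x ^ 2) ⊆ (Function.support fun u : ℝ => Real.exp (-Real.pi * u) * u ^ (-(1 / 4) : ℝ))
        ∩ Ioi (x ^ 2) := by
      intro u hu
      have : 0 < u := (sq_nonneg x).trans_lt hu
      refine ⟨?_, hu⟩
      simp only [Function.mem_support]
      positivity
    refine lt_of_lt_of_le ?_ (measure_mono this)
    simp

lemma V_decay {A : ℝ} (hA : 0 ≤ A) : ∃ C : ℝ, 0 < C ∧ ∀ x : ℝ, 0 < x → V x ≤ C * x ^ (-A) := by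
  set K := ∫ u in Ioi (0 : ℝ), Real.exp (-Real.pi * u) * u ^ (A / 2 - 1 / 4) with hK
  have hK0 : 0 ≤ K := by
    refine setIntegral_nonneg measurableSet_Ioi fun u hu => ?_
    have : 0 ≤ u := le_of_lt hu
    positivity
  refine ⟨K + 1, by linarith, fun x hx => ?_⟩
  have hintg := V_integrable (b := A / 2 - 1 / 4) (by linarith)
  have h1 : x ^ A * V x ≤ K := by
    rw [V, ← integral_const_mul]
    refine (setIntegral_mono_on ((V_integrable' x).const_mul _)
      (hintg.mono_set (Ioi_subset_Ioi (sq_nonneg x))) measurableSet_Ioi fun u hu => ?_).trans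
      (setIntegral_mono_set hintg ?_ (Ioi_subset_Ioi (sq_nonneg x)).eventuallyLE)
    · have hu0 : 0 < u := (sq_nonneg x).trans_lt hu
      have h2 : x ^ A ≤ u ^ (A / 2) := by
        have : x ^ A = (x ^ 2) ^ (A / 2) := by
          rw [← Real.rpow_natCast, ← Real.rpow_mul hx.le]; congr 1; push_cast; ring
        rw [this]
        exact Real.rpow_le_rpow (sq_nonneg x) (le_of_lt hu) (by linarith)
      rw [sub_eq_add_neg, Real.rpow_add hu0]
      have : 0 ≤ Real.exp (-Real.pi * u) * u ^ (-(1 / 4) : ℝ) := by positivity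
      nlinarith
    · refine (ae_restrict_iff' measurableSet_Ioi).2 (Eventually.of_forall fun u hu => ?_)
      have : (0 : ℝ) ≤ u := le_of_lt hu
      simp only [Pi.zero_apply]
      positivity
  rw [Real.rpow_neg hx.le, ← div_eq_mul_inv, le_div_iff₀ (by positivity)]
  linarith

lemma V_tendsto : Tendsto V (𝓝[≥] 0) (𝓝 (V 0)) := by
  have h1 : ∀ x : ℝ, V x = V 0 -
      ∫ u in (0 : ℝ)..(x ^ 2), Real.exp (-Real.pi * u) * u ^ (-(1 / 4) : ℝ) := by
    intro x
    have := intervalIntegral.integral_interval_add_Ioi (a := 0) (b := x ^ 2)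
      (f := fun u : ℝ => Real.exp (-Real.pi * u) * u ^ (-(1 / 4) : ℝ)) (μ := volume)
      (V_integrable (by norm_num)) (V_integrable' x)
    simp only [V, ne_eq, OfNat.ofNat_ne_zero, not_false_eq_true, zero_pow]
    linarith
  have hc : ContinuousWithinAt (fun y : ℝ => ∫ u in (0 : ℝ)..y,
      Real.exp (-Real.pi * u) * u ^ (-(1 / 4) : ℝ)) (Icc 0 1) 0 := by
    refine intervalIntegral.continuousWithinAt_primitive (by simp) ?_
    have := (V_integrable (b := -(1/4)) (by norm_num)).mono_set (Ioc_subset_Ioi_self : Ioc (0:ℝ) 1 ⊆ Ioi 0)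
    simpa [intervalIntegrable_iff] using this
  have hsq : Tendsto (fun x : ℝ => x ^ 2) (𝓝[≥] 0) (𝓝[Icc 0 1] 0) := by
    refine tendsto_nhdsWithin_iff.2 ⟨?_, ?_⟩
    · have : Tendsto (fun x : ℝ => x ^ 2) (𝓝 0) (𝓝 (0 ^ 2)) := (continuous_pow 2).tendsto 0
      simpa using this.mono_left nhdsWithin_le_nhds
    · have : ∀ᶠ x : ℝ in 𝓝[≥] 0, x < 1 :=
        nhdsWithin_le_nhds (gt_mem_nhds (by norm_num))
      filter_upwards [this, self_mem_nhdsWithin] with x hx hx0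
      have : (0:ℝ) ≤ x := hx0
      exact ⟨by positivity, by nlinarith⟩
  have h2 := (tendsto_const_nhds (x := V 0)).sub (Tendsto.comp hc hsq)
  simp only [intervalIntegral.integral_same, sub_zero] at h2
  refine h2.congr fun x => ?_
  rw [h1 x]; rfl

end QT
end PartA

section PartB
namespace QT
open MeasureTheory Set Filter Topology

/-- weights in the approximate functional equation -/
noncomputable def W (Y : ℝ) (m : ℕ) : ℝ := (m : ℝ) ^ (-(1 / 2) : ℝ) * V (m / Y)

lemma W_zero (Y : ℝ) : W Y 0 = 0 := by
  simp [W, Real.zero_rpow]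

lemma W_nonneg (Y : ℝ) (m : ℕ) : 0 ≤ W Y m := mul_nonneg (by positivity) (V_nonneg _)

lemma W_le {A : ℝ} (hA : 0 ≤ A) : ∃ C : ℝ, 0 < C ∧ ∀ Y : ℝ, 0 < Y → ∀ m : ℕ,
    W Y m ≤ C * Y ^ A * (m : ℝ) ^ (-(1 / 2) - A : ℝ) := by
  obtain ⟨C, hC, h⟩ := V_decay hA
  refine ⟨C, hC, fun Y hY m => ?_⟩
  rcases Nat.eq_zero_or_pos m with rfl | hm
  · rw [W_zero]; positivity
  · have hm' : (0 : ℝ) < m := by exact_mod_cast hm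
    have := h (m / Y) (by positivity)
    rw [W]
    calc (m : ℝ) ^ (-(1 / 2) : ℝ) * V (m / Y) ≤ (m : ℝ) ^ (-(1 / 2) : ℝ) * (C * (m / Y) ^ (-A)) := by
          gcongr
      _ = _ := by
          rw [Real.div_rpow hm'.le hY.le, Real.rpow_sub hm', Real.rpow_neg hm'.le A,
            Real.rpow_neg hY.le A]
          field_simp

lemma W_summable {Y : ℝ} (hY : 0 < Y) : Summable (W Y) := by
  obtain ⟨C, hC, h⟩ := W_le (A := 1) zero_le_one
  refine Summable.of_nonneg_of_le (W_nonneg Y) (h Y hY) ?_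
  exact (Real.summable_nat_rpow.2 (by norm_num)).mul_left _

lemma W_summable' {Y : ℝ} (hY : 0 < Y) {c : ℕ → ℂ} {K : ℝ} (hc : ∀ m, ‖c m‖ ≤ K) :
    Summable (fun m => c m * (W Y m : ℂ)) := by
  refine Summable.of_norm_bounded ((W_summable hY).mul_left K) fun m => ?_
  rw [norm_mul, Complex.norm_real, Real.norm_of_nonneg (W_nonneg _ _)]
  exact mul_le_mul_of_nonneg_right (hc m) (W_nonneg _ _)

lemma term_integrable {b : ℝ} (hb : 0 < b) {t₀ : ℝ} (ht : 0 < t₀) :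
    IntegrableOn (fun t : ℝ => Real.exp (-Real.pi * (b * t)) * t ^ (-(1 / 4) : ℝ)) (Ioi t₀) := by
  have h := integrableOn_rpow_mul_exp_neg_mul_rpow (s := -(1/4)) (p := 1) (b := Real.pi * b)
    (by norm_num) one_pos (by positivity)
  refine (h.mono_set (Ioi_subset_Ioi ht.le)).congr_fun (fun u hu => ?_) measurableSet_Ioi
  simp [mul_comm, mul_assoc, mul_left_comm]

lemma term_integral {a t₀ : ℝ} (ha : 0 < a) (ht : 0 < t₀) (m : ℕ) :
    ∫ t in Ioi t₀, (m : ℝ) * (Real.exp (-Real.pi * (m ^ 2 / a ^ 2 * t)) * t ^ (-(1 / 4) : ℝ)) =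
      a ^ (3 / 2 : ℝ) * W (a / √t₀) m := by
  rcases Nat.eq_zero_or_pos m with rfl | hm
  · simp [W_zero]
  have hm' : (0 : ℝ) < m := by exact_mod_cast hm
  set b : ℝ := m ^ 2 / a ^ 2 with hb
  have hb0 : 0 < b := by positivity
  have h := integral_comp_mul_left_Ioi (fun u : ℝ => Real.exp (-Real.pi * u) * u ^ (-(1 / 4) : ℝ))
    t₀ hb0
  have hV : ∫ u in Ioi (b * t₀), Real.exp (-Real.pi * u) * u ^ (-(1 / 4) : ℝ) = V (m / (a / √t₀)) := by
    rw [V]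
    congr 3
    rw [hb, div_div_eq_mul_div, div_pow, mul_pow, Real.sq_sqrt ht.le]; ring
  rw [hV, smul_eq_mul] at h
  have h2 : ∫ t in Ioi t₀, Real.exp (-Real.pi * (b * t)) * (b * t) ^ (-(1 / 4) : ℝ) =
      b ^ (-(1 / 4) : ℝ) * ∫ t in Ioi t₀, Real.exp (-Real.pi * (b * t)) * t ^ (-(1 / 4) : ℝ) := by
    rw [← integral_const_mul]
    refine setIntegral_congr_fun measurableSet_Ioi fun t htt => ?_
    have : 0 < t := ht.trans htt
    beta_reduce
    rw [Real.mul_rpow hb0.le this.le]; ring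
  rw [h2] at h
  rw [integral_const_mul, W]
  have hbp : 0 < b ^ (-(1 / 4) : ℝ) := by positivity
  have h3 : (m : ℝ) * b⁻¹ = a ^ (3 / 2 : ℝ) * (m : ℝ) ^ (-(1 / 2) : ℝ) * b ^ (-(1 / 4) : ℝ) := by
    have e1 : b ^ (-(1 / 4) : ℝ) = (m : ℝ) ^ (-(1 / 2) : ℝ) * a ^ (1 / 2 : ℝ) := by
      rw [hb, Real.div_rpow (by positivity) (by positivity), ← Real.rpow_natCast (m : ℝ),
        ← Real.rpow_natCast a, ← Real.rpow_mul hm'.le, ← Real.rpow_mul ha.le, div_eq_mul_inv,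
        ← Real.rpow_neg ha.le]
      norm_num
    have e2 : (m : ℝ) ^ (-(1 / 2) : ℝ) * (m : ℝ) ^ (-(1 / 2) : ℝ) = (m : ℝ)⁻¹ := by
      rw [← Real.rpow_add hm', ← Real.rpow_neg_one]; norm_num
    have e3 : a ^ (3 / 2 : ℝ) * a ^ (1 / 2 : ℝ) = a ^ 2 := by
      rw [← Real.rpow_add ha, ← Real.rpow_natCast]; norm_num
    rw [e1]
    calc (m : ℝ) * b⁻¹ = (m : ℝ)⁻¹ * a ^ 2 := by rw [hb]; field_simp
      _ = _ := by rw [← e2, ← e3]; ring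
  have h4 : (m : ℝ) * (b ^ (-(1 / 4) : ℝ) * ∫ t in Ioi t₀, Real.exp (-Real.pi * (b * t)) * t ^ (-(1 / 4) : ℝ))
     = (a ^ (3 / 2 : ℝ) * (m : ℝ) ^ (-(1 / 2) : ℝ) * b ^ (-(1 / 4) : ℝ)) * V (m / (a / √t₀)) := by
    rw [h, ← h3]; ring
  refine mul_left_cancel₀ hbp.ne' ?_
  linarith

/-- term-by-term integration of a theta series -/
lemma theta_integral {a t₀ : ℝ} (ha : 0 < a) (ht : 0 < t₀) {c : ℕ → ℂ} {K : ℝ}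
    (hc : ∀ m, ‖c m‖ ≤ K) :
    ∫ t in Ioi t₀, (∑' m : ℕ, c m * ((m : ℝ) * Real.exp (-Real.pi * (m ^ 2 / a ^ 2 * t)) : ℝ)) *
      ((t ^ (-(1 / 4) : ℝ) : ℝ) : ℂ) =
      (a ^ (3 / 2 : ℝ) : ℝ) * ∑' m, c m * (W (a / √t₀) m : ℂ) := by
  have ha' : 0 < a / √t₀ := by positivity
  set F : ℕ → ℝ → ℂ := fun m t => c m * (((m : ℝ) *
    (Real.exp (-Real.pi * (m ^ 2 / a ^ 2 * t)) * t ^ (-(1 / 4) : ℝ)) : ℝ) : ℂ) with hF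
  have hreal : ∀ m : ℕ, IntegrableOn (fun t : ℝ => (m : ℝ) *
    (Real.exp (-Real.pi * (m ^ 2 / a ^ 2 * t)) * t ^ (-(1 / 4) : ℝ))) (Ioi t₀) := by
    intro m
    rcases Nat.eq_zero_or_pos m with rfl | hm
    · simp
    · exact (term_integrable (by positivity) ht).const_mul _
  have hintg : ∀ m, Integrable (F m) (volume.restrict (Ioi t₀)) := fun m =>
    ((hreal m).ofReal).const_mul (c m)
  have hnorm : ∀ m, ∫ t in Ioi t₀, ‖F m t‖ = ‖c m‖ * (a ^ (3 / 2 : ℝ) * W (a / √t₀) m) := by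
    intro m
    rw [← term_integral ha ht m, ← integral_const_mul]
    refine setIntegral_congr_fun measurableSet_Ioi fun t htt => ?_
    have : 0 < t := ht.trans htt
    simp only [hF, norm_mul, Complex.norm_real]
    congr 1
    rw [← norm_mul, ← norm_mul]
    exact Real.norm_of_nonneg (by positivity)
  have hval : ∀ m, ∫ t in Ioi t₀, F m t = c m * ((a ^ (3 / 2 : ℝ) * W (a / √t₀) m : ℝ) : ℂ) := by
    intro m
    rw [← term_integral ha ht m]
    simp only [hF]
    rw [integral_const_mul]
    congr 1
    exact integral_ofReal
  have h := hasSum_integral_of_summable_integral_norm hintg (by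
    simp_rw [hnorm]
    refine Summable.of_nonneg_of_le (fun m => ?_) (fun m => ?_)
      (((W_summable ha').mul_left (a ^ (3 / 2 : ℝ))).mul_left K)
    · have := W_nonneg (a / √t₀) m
      positivity
    · have := W_nonneg (a / √t₀) m
      exact mul_le_mul_of_nonneg_right (hc m) (by positivity))
  have h2 := h.tsum_eq
  simp_rw [hval] at h2
  rw [← tsum_mul_left]
  have h3 : ∀ t, (∑' m : ℕ, c m * ((m : ℝ) * Real.exp (-Real.pi * (m ^ 2 / a ^ 2 * t)) : ℝ)) *
      ((t ^ (-(1 / 4) : ℝ) : ℝ) : ℂ) = ∑' m, F m t := by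
    intro t
    rw [← tsum_mul_right]
    refine tsum_congr fun m => ?_
    simp only [hF]; push_cast; ring
  simp_rw [h3]
  rw [← h2]
  refine tsum_congr fun m => ?_
  push_cast; ring

end QT
end PartB

section PartC
namespace QT
open MeasureTheory Set Filter Topology HurwitzZeta

lemma hasSum_int_residues {q : ℕ} [NeZero q] {g : ℤ → ℂ} {a : ZMod q → ℂ}
    (h : ∀ j : ZMod q, HasSum (fun n : ℤ => g (n * q + j.val)) (a j)) : HasSum g (∑ j, a j) := by
  have hq : (q : ℤ) ≠ 0 := by exact_mod_cast NeZero.ne q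
  have h1 : ∀ j : ZMod q, HasSum (fun n : ℤ => if (n : ZMod q) = j then g n else 0) (a j) := by
    intro j
    have hinj : Function.Injective (fun n : ℤ => n * (q : ℤ) + (j.val : ℤ)) := by
      intro x y hxy
      have := hxy
      simp only [add_left_inj, mul_eq_mul_right_iff, hq, or_false] at this
      exact this
    refine (hinj.hasSum_iff ?_).1 ?_
    · intro x hx
      rw [if_neg]
      intro hxj
      apply hx
      have : ((x - (j.val : ℤ) : ℤ) : ZMod q) = 0 := by simp [hxj]
      obtain ⟨k, hk⟩ := (ZMod.intCast_zmod_eq_zero_iff_dvd _ _).1 this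
      exact ⟨k, by simp only []; linarith⟩
    · refine (h j).congr_fun fun n => ?_
      simp
  have h2 := hasSum_sum (s := Finset.univ) fun j _ => h1 j
  refine h2.congr_fun fun n => ?_
  simp

/-- the theta function attached to `Φ` -/
noncomputable def Fk {q : ℕ} [NeZero q] (Φ : ZMod q → ℂ) (t : ℝ) : ℂ :=
  ∑ j : ZMod q, Φ j * (oddKernel (ZMod.toAddCircle j) t : ℂ)

lemma hasSum_two_mul {g : ℤ → ℂ} {a : ℂ} (h : HasSum g a) (h0 : g 0 = 0)
    (hev : ∀ n, g (-n) = g n) : a = 2 * ∑' m : ℕ, g m := by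
  have h1 := h.nat_add_neg
  rw [h0, add_zero] at h1
  rw [← h1.tsum_eq, ← tsum_mul_left]
  refine tsum_congr fun m => ?_
  rw [hev]; ring

lemma Fk_large {q : ℕ} [NeZero q] {Φ : ZMod q → ℂ} (hΦ : Φ.Odd) {t : ℝ} (ht : 0 < t) :
    Fk Φ t = (2 / q : ℂ) * ∑' m : ℕ, Φ m *
      (((m : ℝ) * Real.exp (-Real.pi * ((m : ℝ) ^ 2 / (q : ℝ) ^ 2 * t)) : ℝ) : ℂ) := by
  have hq : (q : ℝ) ≠ 0 := by exact_mod_cast NeZero.ne q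
  set g : ℤ → ℂ := fun n => Φ n * (((n / q : ℝ) * Real.exp (-Real.pi * (n / q : ℝ) ^ 2 * t) : ℝ) : ℂ)
    with hg
  have h : HasSum g (Fk Φ t) := by
    refine hasSum_int_residues fun j => ?_
    have h1 := hasSum_int_oddKernel (j.val / q : ℝ) ht
    rw [ZMod.toAddCircle_apply]
    have h2 := ((Complex.hasSum_ofReal).2 h1).mul_left (Φ j)
    refine h2.congr_fun fun n => ?_
    have e : (((n * q + j.val : ℤ) : ℝ) / q) = n + j.val / q := by
      push_cast; field_simp
    simp only [hg]
    rw [e]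
    simp
  rw [hasSum_two_mul h (by simp [hg]) (fun n => ?_), ← tsum_mul_left, ← tsum_mul_left]
  · refine tsum_congr fun m => ?_
    simp only [hg]
    have : -Real.pi * (((m : ℤ) : ℝ) / q) ^ 2 * t = -Real.pi * ((m : ℝ) ^ 2 / (q : ℝ) ^ 2 * t) := by
      push_cast; ring
    rw [this]
    push_cast; ring
  · simp only [hg]
    have := hΦ (n : ZMod q)
    push_cast
    rw [this]
    ring_nf

lemma Fk_small {q : ℕ} [NeZero q] {Φ Φ' : ZMod q → ℂ} (hΦ' : Φ'.Odd) {w : ℂ}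
    (hFT : ∀ h : ZMod q, ∑ j, Φ j * ZMod.stdAddChar (j * h) = w * Φ' h) {t : ℝ} (ht : 0 < t) :
    Fk Φ (1 / t) = (-2 * Complex.I * w) * ((t ^ (3 / 2 : ℝ) : ℝ) : ℂ) * ∑' m : ℕ, Φ' m *
      (((m : ℝ) * Real.exp (-Real.pi * ((m : ℝ) ^ 2 / (1 : ℝ) ^ 2 * t)) : ℝ) : ℂ) := by
  set g : ℤ → ℂ := fun n => (-Complex.I * w) * (Φ' n * ((n * Real.exp (-Real.pi * n ^ 2 * t) : ℝ) : ℂ))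
    with hg
  have h : HasSum g (∑ j : ZMod q, Φ j * (sinKernel (ZMod.toAddCircle j) t : ℂ)) := by
    have h1 : ∀ j ∈ Finset.univ, HasSum (fun n : ℤ => Φ j * (-Complex.I * n * Complex.exp
        (2 * Real.pi * Complex.I * (j.val / q : ℝ) * n) * Real.exp (-Real.pi * n ^ 2 * t)))
        (Φ j * (sinKernel (ZMod.toAddCircle j) t : ℂ)) := by
      intro j _
      rw [ZMod.toAddCircle_apply]
      exact (hasSum_int_sinKernel (j.val / q : ℝ) ht).mul_left _
    refine (hasSum_sum h1).congr_fun fun n => ?_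
    simp only [hg]
    have h2 := hFT (n : ZMod q)
    have h3 : ∀ j : ZMod q, ZMod.stdAddChar (j * (n : ZMod q)) = Complex.exp
        (2 * Real.pi * Complex.I * (j.val / q : ℝ) * n) := by
      intro j
      have : j * (n : ZMod q) = ((j.val * n : ℤ) : ZMod q) := by simp
      rw [this, ZMod.stdAddChar_coe]
      congr 1; push_cast; ring
    simp_rw [h3] at h2
    have h4 : ∑ j : ZMod q, Φ j * (-Complex.I * n * Complex.exp
        (2 * Real.pi * Complex.I * (j.val / q : ℝ) * n) * Real.exp (-Real.pi * n ^ 2 * t)) =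
        (-Complex.I * n * Real.exp (-Real.pi * n ^ 2 * t)) * ∑ j : ZMod q, Φ j * Complex.exp
        (2 * Real.pi * Complex.I * (j.val / q : ℝ) * n) := by
      rw [Finset.mul_sum]
      refine Finset.sum_congr rfl fun j _ => ?_
      ring
    rw [h4, h2]
    push_cast; ring
  have hs : Fk Φ (1 / t) = ((t ^ (3 / 2 : ℝ) : ℝ) : ℂ) *
      ∑ j : ZMod q, Φ j * (sinKernel (ZMod.toAddCircle j) t : ℂ) := by
    rw [Fk, Finset.mul_sum]
    refine Finset.sum_congr rfl fun j _ => ?_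
    rw [oddKernel_functional_equation]
    have : 1 / (1 / t) ^ (3 / 2 : ℝ) = t ^ (3 / 2 : ℝ) := by
      rw [one_div, one_div, Real.inv_rpow ht.le, inv_inv]
    rw [this, one_div_one_div]
    push_cast; ring
  rw [hs, hasSum_two_mul h (by simp [hg]) (fun n => ?_)]
  · simp only [hg]
    rw [tsum_mul_left]
    have : ∀ m : ℕ, -Real.pi * ((m : ℝ) ^ 2 / (1 : ℝ) ^ 2 * t) = -Real.pi * ((m : ℤ) : ℝ) ^ 2 * t := by
      intro m; push_cast; ring
    simp_rw [this]
    push_cast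
    ring
  · simp only [hg]
    have := hΦ' (n : ZMod q)
    push_cast
    rw [this, neg_sq]
    ring


lemma Fk_mellin {q : ℕ} [NeZero q] {Φ : ZMod q → ℂ} (hΦ : Φ.Odd) (hL : ZMod.LFunction Φ (1 / 2) = 0) :
    IntegrableOn (fun t : ℝ => Fk Φ t * ((t ^ (-(1 / 4) : ℝ) : ℝ) : ℂ)) (Ioi 0) ∧
    ∫ t in Ioi (0 : ℝ), Fk Φ t * ((t ^ (-(1 / 4) : ℝ) : ℝ) : ℂ) = 0 := by
  have hm : ∀ j : ZMod q, HasMellin (hurwitzOddFEPair (ZMod.toAddCircle j)).f ((1 / 2 + 1) / 2)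
      (2 * completedHurwitzZetaOdd (ZMod.toAddCircle j) (1 / 2)) := by
    intro j
    have := (isStrong_hurwitzOddFEPair (ZMod.toAddCircle j)).hasMellin ((1 / 2 + 1) / 2)
    have e : ∀ z : ℂ, 2 * (z / 2) = z := fun z => by ring
    rw [completedHurwitzZetaOdd, e]
    exact this
  have hpow : ∀ t ∈ Ioi (0 : ℝ), (t : ℂ) ^ (((1 / 2 + 1) / 2 : ℂ) - 1) = ((t ^ (-(1 / 4) : ℝ) : ℝ) : ℂ) := by
    intro t ht
    rw [Complex.ofReal_cpow (le_of_lt ht)]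
    congr 1; push_cast; norm_num
  have hintg : ∀ j : ZMod q, IntegrableOn (fun t : ℝ => Φ j * (oddKernel (ZMod.toAddCircle j) t : ℂ) *
      ((t ^ (-(1 / 4) : ℝ) : ℝ) : ℂ)) (Ioi 0) := by
    intro j
    have h1 := (hm j).1
    rw [MellinConvergent] at h1
    have h2 : IntegrableOn (fun t : ℝ => Φ j * ((t : ℂ) ^ (((1 / 2 + 1) / 2 : ℂ) - 1) •
      (hurwitzOddFEPair (ZMod.toAddCircle j)).f t)) (Ioi 0) := h1.const_mul _
    refine h2.congr_fun (fun t ht => ?_) measurableSet_Ioi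
    simp only [hpow t ht, hurwitzOddFEPair, Function.comp, smul_eq_mul]
    ring
  have hval : ∀ j : ZMod q, ∫ t in Ioi (0 : ℝ), Φ j * (oddKernel (ZMod.toAddCircle j) t : ℂ) *
      ((t ^ (-(1 / 4) : ℝ) : ℝ) : ℂ) = Φ j * (2 * completedHurwitzZetaOdd (ZMod.toAddCircle j) (1 / 2)) := by
    intro j
    rw [← (hm j).2, mellin, ← integral_const_mul]
    refine setIntegral_congr_fun measurableSet_Ioi fun t ht => ?_
    simp only [hpow t ht, hurwitzOddFEPair, Function.comp, smul_eq_mul]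
    ring
  have hF : ∀ t : ℝ, Fk Φ t * ((t ^ (-(1 / 4) : ℝ) : ℝ) : ℂ) =
      ∑ j : ZMod q, Φ j * (oddKernel (ZMod.toAddCircle j) t : ℂ) * ((t ^ (-(1 / 4) : ℝ) : ℝ) : ℂ) := by
    intro t
    rw [Fk, Finset.sum_mul]
  simp_rw [hF]
  refine ⟨integrable_finsetSum _ fun j _ => hintg j, ?_⟩
  rw [integral_finsetSum _ fun j _ => hintg j]
  simp_rw [hval]
  rw [ZMod.LFunction_def_odd hΦ] at hL
  have hq : (q : ℂ) ≠ 0 := by exact_mod_cast NeZero.ne q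
  have h1 := (mul_eq_zero.1 hL).resolve_left (by simp [Complex.cpow_eq_zero_iff, hq])
  have hG : Complex.Gammaℝ (1 / 2 + 1) ≠ 0 := Complex.Gammaℝ_ne_zero_of_re_pos (by norm_num)
  simp only [hurwitzZetaOdd] at h1
  calc ∑ j : ZMod q, Φ j * (2 * completedHurwitzZetaOdd (ZMod.toAddCircle j) (1 / 2))
      = 2 * Complex.Gammaℝ (1 / 2 + 1) * ∑ j : ZMod q, Φ j *
        (completedHurwitzZetaOdd (ZMod.toAddCircle j) (1 / 2) / Complex.Gammaℝ (1 / 2 + 1)) := by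
        generalize Complex.Gammaℝ (1 / 2 + 1) = G at hG
        rw [Finset.mul_sum]
        refine Finset.sum_congr rfl fun j _ => ?_
        field_simp
    _ = 0 := by rw [h1, mul_zero]

/-- Approximate functional equation at a vanishing central value, for odd periodic functions. -/
theorem afe {q : ℕ} [NeZero q] {Φ Φ' : ZMod q → ℂ} (hΦ : Φ.Odd) (hΦ' : Φ'.Odd) {w : ℂ}
    (hFT : ∀ h : ZMod q, ∑ j, Φ j * ZMod.stdAddChar (j * h) = w * Φ' h)
    (hL : ZMod.LFunction Φ (1 / 2) = 0) {Y : ℝ} (hY : 0 < Y) :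
    (√(q : ℝ) : ℂ) * ∑' m : ℕ, Φ m * (W Y m : ℂ) =
      Complex.I * w * ∑' m : ℕ, Φ' m * (W (q / Y) m : ℂ) := by
  have hq : (0 : ℝ) < q := by exact_mod_cast Nat.pos_of_ne_zero (NeZero.ne q)
  obtain ⟨hintg, hzero⟩ := Fk_mellin hΦ hL
  set t₀ : ℝ := (q / Y) ^ 2 with ht₀
  have ht : 0 < t₀ := by positivity
  have hsq : √t₀ = q / Y := Real.sqrt_sq (by positivity)
  have hK : ∃ K, ∀ j : ZMod q, ‖Φ j‖ ≤ K := by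
    refine ⟨∑ j, ‖Φ j‖, fun j => Finset.single_le_sum (f := fun j => ‖Φ j‖) (fun _ _ => norm_nonneg _) (Finset.mem_univ j)⟩
  have hK' : ∃ K, ∀ j : ZMod q, ‖Φ' j‖ ≤ K := by
    refine ⟨∑ j, ‖Φ' j‖, fun j => Finset.single_le_sum (f := fun j => ‖Φ' j‖) (fun _ _ => norm_nonneg _) (Finset.mem_univ j)⟩
  obtain ⟨K, hK⟩ := hK
  obtain ⟨K', hK'⟩ := hK'
  have hA : ∫ t in Ioi t₀, Fk Φ t * ((t ^ (-(1 / 4) : ℝ) : ℝ) : ℂ) =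
      2 * (√(q : ℝ) : ℂ) * ∑' m : ℕ, Φ m * (W Y m : ℂ) := by
    have h1 := theta_integral hq ht (c := fun m => Φ m) (fun m => hK m)
    have e : (q : ℝ) / √t₀ = Y := by rw [hsq]; field_simp
    rw [e] at h1
    have h2 : ∫ t in Ioi t₀, Fk Φ t * ((t ^ (-(1 / 4) : ℝ) : ℝ) : ℂ) = (2 / q : ℂ) *
      ∫ t in Ioi t₀, (∑' m : ℕ, Φ m * ((m : ℝ) * Real.exp (-Real.pi * (m ^ 2 / (q : ℝ) ^ 2 * t)) : ℝ)) *
      ((t ^ (-(1 / 4) : ℝ) : ℝ) : ℂ) := by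
      rw [← integral_const_mul]
      refine setIntegral_congr_fun measurableSet_Ioi fun t htt => ?_
      rw [Fk_large hΦ (ht.trans htt)]
      ring
    rw [h2, h1, ← mul_assoc]
    congr 1
    have e2 : (q : ℝ) ^ (3 / 2 : ℝ) = q * √(q : ℝ) := by
      rw [Real.sqrt_eq_rpow]
      nth_rewrite 2 [← Real.rpow_one (q : ℝ)]
      rw [← Real.rpow_add hq]; norm_num
    rw [e2]
    have : (q : ℂ) ≠ 0 := by exact_mod_cast hq.ne'
    push_cast
    field_simp
  have hB : ∫ t in Ioc 0 t₀, Fk Φ t * ((t ^ (-(1 / 4) : ℝ) : ℝ) : ℂ) =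
      (-2 * Complex.I * w) * ∑' m : ℕ, Φ' m * (W (q / Y) m : ℂ) := by
    have h1 := theta_integral one_pos (t₀ := 1 / t₀) (by positivity) (c := fun m => Φ' m) (fun m => hK' m)
    have e : (1 : ℝ) / √(1 / t₀) = q / Y := by
      rw [one_div t₀, Real.sqrt_inv, hsq]; simp
    rw [e, Real.one_rpow, Complex.ofReal_one, one_mul] at h1
    rw [← h1, ← integral_const_mul]
    have h2 := integral_comp_rpow_Ioi ((Iic t₀).indicator
      (fun t => Fk Φ t * ((t ^ (-(1 / 4) : ℝ) : ℝ) : ℂ))) (p := -1) (by norm_num)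
    rw [setIntegral_indicator measurableSet_Iic, Ioi_inter_Iic] at h2
    rw [← h2, ← integral_Ici_eq_integral_Ioi (x := 1 / t₀)]
    have h3 : Ioi (0 : ℝ) ∩ Ici (1 / t₀) = Ici (1 / t₀) := by
      refine inter_eq_self_of_subset_right fun x hx => ?_
      exact lt_of_lt_of_le (show (0:ℝ) < 1 / t₀ by positivity) hx
    rw [← h3, ← setIntegral_indicator measurableSet_Ici]
    refine setIntegral_congr_fun measurableSet_Ioi fun t htt => ?_
    have htt : 0 < t := htt
    have hiff : t ^ (-1 : ℝ) ∈ Iic t₀ ↔ t ∈ Ici (1 / t₀) := by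
      rw [mem_Iic, mem_Ici, Real.rpow_neg_one, one_div, inv_le_comm₀ htt ht]
    by_cases hmem : t ∈ Ici (1 / t₀)
    · simp only [indicator_of_mem (hiff.2 hmem), indicator_of_mem hmem]
      have h4 := Fk_small hΦ' hFT htt
      rw [Real.rpow_neg_one, ← one_div, h4, one_div, Real.inv_rpow htt.le, ← Real.rpow_neg htt.le]
      have h5 : t ^ (-1 - 1 : ℝ) * t ^ (3 / 2 : ℝ) * t ^ (- -(1 / 4) : ℝ) = t ^ (-(1 / 4) : ℝ) := by
        rw [← Real.rpow_add htt, ← Real.rpow_add htt]; norm_num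
      rw [← h5]
      simp only [abs_neg, abs_one, one_mul, Complex.real_smul]
      push_cast
      ring
    · simp only [indicator_of_notMem (fun h => hmem (hiff.1 h)), indicator_of_notMem hmem, smul_zero]
  have hsplit := setIntegral_union (μ := volume) (f := fun t => Fk Φ t * ((t ^ (-(1 / 4) : ℝ) : ℝ) : ℂ)) (s := Ioc 0 t₀) (t := Ioi t₀)
    (Ioc_disjoint_Ioi le_rfl) measurableSet_Ioi
    (hintg.mono_set (fun x hx => hx.1)) (hintg.mono_set (fun x hx => ht.trans hx))
  rw [Ioc_union_Ioi_eq_Ioi ht.le, hzero, hA, hB] at hsplit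
  linear_combination (-1 / 2 : ℂ) * hsplit

end QT
end PartC

section PartD
namespace QT
open Set Filter Topology HurwitzZeta

lemma theta_tendsto {l : Filter ℝ} {τ : ℝ → ℂ} (h : Tendsto (fun e => (τ e).im) l atTop) :
    Tendsto (fun e => jacobiTheta (τ e)) l (𝓝 1) := by
  have h1 := isBigO_at_im_infty_jacobiTheta_sub_one
  have h2 : Tendsto (fun τ : ℂ => Real.exp (-Real.pi * τ.im)) (comap Complex.im atTop) (𝓝 0) := by
    have : Tendsto (fun x : ℝ => Real.exp (-Real.pi * x)) atTop (𝓝 0) := by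
      refine Real.tendsto_exp_atBot.comp ?_
      exact tendsto_id.const_mul_atTop_of_neg (by linarith [Real.pi_pos])
    exact this.comp tendsto_comap
  have h3 := h1.trans_tendsto h2
  have h4 : Tendsto (fun e => jacobiTheta (τ e) - 1) l (𝓝 0) :=
    h3.comp (tendsto_comap_iff.2 h)
  simpa using h4.add_const 1

lemma theta_fe (τ : ℂ) : jacobiTheta τ = 1 / (-Complex.I * τ) ^ (1 / 2 : ℂ) * jacobiTheta (-1 / τ) := by
  rw [jacobiTheta_eq_jacobiTheta₂, jacobiTheta₂_functional_equation, jacobiTheta_eq_jacobiTheta₂]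
  simp

lemma cpow_scale {e : ℝ} (he : 0 < e) {z : ℂ} (hz : z ≠ 0) :
    ((e : ℂ) * z) ^ (1 / 2 : ℂ) = (√e : ℂ) * z ^ (1 / 2 : ℂ) := by
  have he' : (e : ℂ) ≠ 0 := by exact_mod_cast he.ne'
  rw [Complex.cpow_def_of_ne_zero (mul_ne_zero he' hz), Complex.log_ofReal_mul he hz, add_mul,
    Complex.exp_add, ← Complex.cpow_def_of_ne_zero hz, Real.sqrt_eq_rpow, Complex.ofReal_cpow he.le,
    Complex.cpow_def_of_ne_zero he', Complex.ofReal_log he.le]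
  norm_num

lemma theta_hasSum {τ : ℂ} (h : 0 < τ.im) :
    HasSum (fun n : ℤ => Complex.exp (Real.pi * Complex.I * (n : ℂ) ^ 2 * τ)) (jacobiTheta τ) := by
  have := hasSum_jacobiTheta₂_term 0 h
  rw [← jacobiTheta_eq_jacobiTheta₂] at this
  refine this.congr_fun fun n => ?_
  simp [jacobiTheta₂_term]

lemma theta_half {p : ℕ} {w : ℂ} (hw : 0 < w.im) :
    jacobiTheta (-p / 2 + w) = (-Complex.I) ^ p * jacobiTheta w +
      (1 - (-Complex.I) ^ p) * jacobiTheta (4 * w) := by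
  have h4 : 0 < (4 * w).im := by simpa using hw
  have h1 := theta_hasSum hw
  have h2 : HasSum (fun n : ℤ => if Even n then Complex.exp (Real.pi * Complex.I * (n : ℂ) ^ 2 * w) else 0)
      (jacobiTheta (4 * w)) := by
    have hinj : Function.Injective (fun n : ℤ => 2 * n) := fun x y h => by
      have : 2 * x = 2 * y := h
      omega
    refine (hinj.hasSum_iff ?_).1 ?_
    · intro x hx
      rw [if_neg]
      rintro ⟨k, hk⟩
      exact hx ⟨k, by show 2 * k = x; omega⟩
    · refine (theta_hasSum h4).congr_fun fun n => ?_
      simp only [Function.comp, even_two_mul, if_true]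
      congr 1; push_cast; ring
  have h3 := (h1.mul_left ((-Complex.I) ^ p)).add (h2.mul_left (1 - (-Complex.I) ^ p))
  have h5 : 0 < (-p / 2 + w : ℂ).im := by
    have : ((-p / 2 : ℂ)).im = 0 := by
      have : (-p / 2 : ℂ) = ((-p / 2 : ℝ) : ℂ) := by push_cast; ring
      rw [this]; exact Complex.ofReal_im _
    rw [Complex.add_im, this]; simpa using hw
  refine (theta_hasSum h5).unique (h3.congr_fun fun n => ?_)
  have e1 : Complex.exp (Real.pi * Complex.I * (n : ℂ) ^ 2 * (-p / 2 + w)) =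
      Complex.exp (-(Real.pi / 2 * Complex.I)) ^ ((p : ℤ) * n ^ 2) *
        Complex.exp (Real.pi * Complex.I * (n : ℂ) ^ 2 * w) := by
    rw [← Complex.exp_int_mul, ← Complex.exp_add]
    congr 1; push_cast; ring
  have e2 : Complex.exp (-(Real.pi / 2 * Complex.I)) = -Complex.I := by
    rw [Complex.exp_neg, Complex.exp_pi_div_two_mul_I, Complex.inv_I]
  have i4 : (-Complex.I) ^ (4 : ℤ) = 1 := by
    have : (-Complex.I) ^ (4 : ℕ) = 1 := by rw [neg_pow, Complex.I_pow_four]; norm_num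
    exact_mod_cast this
  have hI : (-Complex.I) ≠ 0 := by simp
  rw [e1, e2]
  rcases Int.even_or_odd n with hn | hn
  · rw [if_pos hn]
    obtain ⟨k, hk⟩ := hn
    have : (-Complex.I) ^ ((p : ℤ) * n ^ 2) = 1 := by
      have : (p : ℤ) * n ^ 2 = 4 * (p * k ^ 2) := by rw [hk]; ring
      rw [this, zpow_mul, i4, one_zpow]
    rw [this]; ring
  · rw [if_neg (Int.not_even_iff_odd.2 hn)]
    obtain ⟨k, hk⟩ := hn
    have : (-Complex.I) ^ ((p : ℤ) * n ^ 2) = (-Complex.I) ^ p := by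
      have : (p : ℤ) * n ^ 2 = 4 * (p * (k ^ 2 + k)) + p := by rw [hk]; ring
      rw [this, zpow_add₀ hI, zpow_mul, i4, one_zpow, one_mul, zpow_natCast]
    rw [this]; ring

lemma theta_lim_left {p : ℕ} [NeZero p] :
    Tendsto (fun e : ℝ => (√e : ℂ) * jacobiTheta (2 / p + Complex.I * e)) (𝓝[>] 0)
      (𝓝 ((∑ r : ZMod p, ZMod.stdAddChar (r ^ 2)) / p)) := by
  have hp : (0 : ℝ) < p := by exact_mod_cast Nat.pos_of_ne_zero (NeZero.ne p)
  have hp' : (p : ℂ) ≠ 0 := by exact_mod_cast hp.ne'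
  have hcos : ∀ r : ZMod p, Tendsto (fun e : ℝ => cosKernel (ZMod.toAddCircle r) (1 / (e * p ^ 2)))
      (𝓝[>] 0) (𝓝 1) := by
    intro r
    obtain ⟨c, hc, hO⟩ := isBigO_atTop_cosKernel_sub (ZMod.toAddCircle r)
    have h2 : Tendsto (fun x : ℝ => Real.exp (-c * x)) atTop (𝓝 0) := by
      refine Real.tendsto_exp_atBot.comp ?_
      exact tendsto_id.const_mul_atTop_of_neg (by linarith)
    have h3 := hO.trans_tendsto h2
    have h4 : Tendsto (fun e : ℝ => 1 / (e * (p : ℝ) ^ 2)) (𝓝[>] 0) atTop := by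
      have : (fun e : ℝ => 1 / (e * (p : ℝ) ^ 2)) = fun e : ℝ => (1 / (p : ℝ) ^ 2) * e⁻¹ := by
        ext e; field_simp
      rw [this]
      exact tendsto_inv_nhdsGT_zero.const_mul_atTop (by positivity)
    simpa using (h3.comp h4).add_const 1
  have key : ∀ e : ℝ, 0 < e → (√e : ℂ) * jacobiTheta (2 / p + Complex.I * e) =
      ∑ r : ZMod p, ZMod.stdAddChar (r ^ 2) / p *
        (cosKernel (ZMod.toAddCircle r) (1 / (e * p ^ 2)) : ℂ) := by
    intro e he
    have him : 0 < (2 / p + Complex.I * e : ℂ).im := by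
      have : (2 / p : ℂ) = ((2 / p : ℝ) : ℂ) := by push_cast; ring
      rw [this]; simpa using he
    have h1 : HasSum (fun n : ℤ => Complex.exp (Real.pi * Complex.I * (n : ℂ) ^ 2 * (2 / p + Complex.I * e)))
        (∑ r : ZMod p, ZMod.stdAddChar (r ^ 2) * (evenKernel (ZMod.toAddCircle r) (e * p ^ 2) : ℂ)) := by
      refine hasSum_int_residues fun r => ?_
      rw [ZMod.toAddCircle_apply]
      have h2 := ((Complex.hasSum_ofReal).2 (hasSum_int_evenKernel (r.val / p : ℝ)
        (t := e * p ^ 2) (by positivity))).mul_left (ZMod.stdAddChar (r ^ 2))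
      refine h2.congr_fun fun n => ?_
      have h3 : ZMod.stdAddChar (r ^ 2) = ZMod.stdAddChar (((n * p + r.val) ^ 2 : ℤ) : ZMod p) := by
        congr 1; simp
      rw [h3, ZMod.stdAddChar_coe, Complex.ofReal_exp, ← Complex.exp_add]
      congr 1
      have : ((n * p + r.val : ℤ) : ℂ) = p * (n + r.val / p) := by
        push_cast; field_simp
      push_cast at this ⊢
      rw [this]
      field_simp
      linear_combination ((p:ℂ) * (n * p + r.val)^2 * e) * Complex.I_sq
    rw [(theta_hasSum him).unique h1, Finset.mul_sum]
    refine Finset.sum_congr rfl fun r _ => ?_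
    rw [evenKernel_functional_equation, ← Real.sqrt_eq_rpow, Real.sqrt_mul he.le, Real.sqrt_sq hp.le]
    have : (√e : ℂ) ≠ 0 := by exact_mod_cast (Real.sqrt_pos.2 he).ne'
    push_cast
    field_simp
  have hlim : Tendsto (fun e : ℝ => ∑ r : ZMod p, ZMod.stdAddChar (r ^ 2) / p *
        (cosKernel (ZMod.toAddCircle r) (1 / (e * p ^ 2)) : ℂ)) (𝓝[>] 0)
      (𝓝 (∑ r : ZMod p, ZMod.stdAddChar (r ^ 2) / (p : ℂ) * ((1 : ℝ) : ℂ))) := by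
    refine tendsto_finsetSum _ fun r _ => ?_
    exact ((Complex.continuous_ofReal.tendsto _).comp (hcos r)).const_mul _
  have e0 : (∑ r : ZMod p, ZMod.stdAddChar (r ^ 2) / (p : ℂ) * ((1 : ℝ) : ℂ)) =
    (∑ r : ZMod p, ZMod.stdAddChar (r ^ 2)) / p := by
    simp [Finset.sum_div]
  rw [e0] at hlim
  refine hlim.congr' ?_
  filter_upwards [self_mem_nhdsWithin] with e he
  exact (key e he).symm


lemma theta_lim_right {p : ℕ} [NeZero p] :
    Tendsto (fun e : ℝ => (√e : ℂ) * jacobiTheta (2 / p + Complex.I * e)) (𝓝[>] 0)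
      (𝓝 (√(p : ℝ) / (1 - Complex.I) * ((-Complex.I) ^ p * (2 / p) + (1 - (-Complex.I) ^ p) * (1 / p)))) := by
  have hp : (0 : ℝ) < p := by exact_mod_cast Nat.pos_of_ne_zero (NeZero.ne p)
  have hp' : (p : ℂ) ≠ 0 := by exact_mod_cast hp.ne'
  set τ : ℝ → ℂ := fun e => 2 / p + Complex.I * e with hτ
  set z : ℝ → ℂ := fun e => p / (2 * τ e) with hz
  have hτc : Tendsto τ (𝓝[>] 0) (𝓝 (2 / p)) := by
    have : Continuous τ := by fun_prop
    have h := this.tendsto 0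
    simp only [hτ, Complex.ofReal_zero, mul_zero, add_zero] at h
    exact h.mono_left nhdsWithin_le_nhds
  have hτre : ∀ e, (τ e).re = 2 / p := by
    intro e
    have : (2 / p : ℂ) = ((2 / p : ℝ) : ℂ) := by push_cast; ring
    simp only [hτ, this]; simp
  have hτim : ∀ e, (τ e).im = e := by
    intro e
    have : (2 / p : ℂ) = ((2 / p : ℝ) : ℂ) := by push_cast; ring
    simp only [hτ, this]; simp
  have hτ0 : ∀ e, τ e ≠ 0 := by
    intro e h
    have := hτre e
    rw [h] at this
    have h2 : (0:ℝ) < 2 / p := by positivity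
    rw [← this] at h2
    simp at h2
  have hz0 : ∀ e, z e ≠ 0 := fun e => div_ne_zero hp' (mul_ne_zero two_ne_zero (hτ0 e))
  have hzc : Tendsto z (𝓝[>] 0) (𝓝 ((p / 2 : ℂ) ^ 2)) := by
    have : (p / 2 : ℂ) ^ 2 = p / (2 * (2 / p)) := by field_simp
    rw [this]
    exact tendsto_const_nhds.div (hτc.const_mul 2) (by simp [hp'])
  have key : ∀ e : ℝ, 0 < e → (√e : ℂ) * jacobiTheta (τ e) =
      1 / (-Complex.I * τ e) ^ (1 / 2 : ℂ) * ((-Complex.I) ^ p *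
        (1 / (z e) ^ (1 / 2 : ℂ) * jacobiTheta (-1 / (Complex.I * e * z e))) +
        (1 - (-Complex.I) ^ p) * (1 / (4 * z e) ^ (1 / 2 : ℂ) *
          jacobiTheta (-1 / (4 * (Complex.I * e * z e))))) := by
    intro e he
    have he' : (e : ℂ) ≠ 0 := by exact_mod_cast he.ne'
    have hs : (√e : ℂ) ≠ 0 := by exact_mod_cast (Real.sqrt_pos.2 he).ne'
    have hw : -1 / τ e = -p / 2 + Complex.I * e * z e := by
      simp only [hz]
      have h0 := hτ0 e
      have : Complex.I * e = τ e - 2 / p := by simp only [hτ]; ring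
      rw [this]
      field_simp
      ring
    have hwim : 0 < (Complex.I * e * z e).im := by
      have h1 : (Complex.I * e * z e).im = (-1 / τ e).im := by
        rw [hw]
        have : (-p / 2 : ℂ) = ((-p / 2 : ℝ) : ℂ) := by push_cast; ring
        rw [this, Complex.add_im, Complex.ofReal_im, zero_add]
      rw [h1, neg_div, Complex.neg_im, one_div, Complex.inv_im, hτim, neg_div, neg_neg]
      exact div_pos he (Complex.normSq_pos.2 (hτ0 e))
    rw [theta_fe (τ e), hw, theta_half hwim, theta_fe (Complex.I * e * z e),
      theta_fe (4 * (Complex.I * e * z e))]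
    have e1 : -Complex.I * (Complex.I * e * z e) = e * z e := by
      linear_combination (-(e : ℂ) * z e) * Complex.I_sq
    have e2 : -Complex.I * (4 * (Complex.I * e * z e)) = e * (4 * z e) := by
      linear_combination (-(e : ℂ) * 4 * z e) * Complex.I_sq
    rw [e1, e2, cpow_scale he (hz0 e), cpow_scale he (mul_ne_zero (by norm_num : (4:ℂ) ≠ 0) (hz0 e))]
    generalize (-Complex.I) ^ p = c
    generalize jacobiTheta (-1 / (Complex.I * e * z e)) = T1
    generalize jacobiTheta (-1 / (4 * (Complex.I * e * z e))) = T2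
    have a1 : (z e) ^ (1 / 2 : ℂ) ≠ 0 := by simp [Complex.cpow_eq_zero_iff, hz0 e]
    have a2 : (4 * z e) ^ (1 / 2 : ℂ) ≠ 0 := by simp [Complex.cpow_eq_zero_iff, hz0 e]
    have a3 : (-Complex.I * τ e) ^ (1 / 2 : ℂ) ≠ 0 := by simp [Complex.cpow_eq_zero_iff, hτ0 e]
    generalize (z e) ^ (1 / 2 : ℂ) = A1 at *
    generalize (4 * z e) ^ (1 / 2 : ℂ) = A2 at *
    generalize (-Complex.I * τ e) ^ (1 / 2 : ℂ) = A3 at *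
    field_simp
  have him : ∀ e : ℝ, 0 < e → (-1 / (Complex.I * e * z e)).im = 4 / (p ^ 2 * e) := by
    intro e he
    have he' : (e : ℂ) ≠ 0 := by exact_mod_cast he.ne'
    have : -1 / (Complex.I * e * z e) = Complex.I * ((2 / (p * e) : ℝ) : ℂ) * τ e := by
      simp only [hz]
      have h0 := hτ0 e
      push_cast
      field_simp
      linear_combination (-1 : ℂ) * Complex.I_sq
    rw [this, mul_assoc, Complex.I_mul_im, Complex.re_ofReal_mul, hτre]
    field_simp; norm_num
  have hat : Tendsto (fun e : ℝ => 4 / ((p : ℝ) ^ 2 * e)) (𝓝[>] 0) atTop := by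
    have : (fun e : ℝ => 4 / ((p : ℝ) ^ 2 * e)) = fun e : ℝ => (4 / (p : ℝ) ^ 2) * e⁻¹ := by
      ext e; field_simp
    rw [this]
    exact tendsto_inv_nhdsGT_zero.const_mul_atTop (by positivity)
  have t1 : Tendsto (fun e : ℝ => jacobiTheta (-1 / (Complex.I * e * z e))) (𝓝[>] 0) (𝓝 1) := by
    refine theta_tendsto (hat.congr' ?_)
    filter_upwards [self_mem_nhdsWithin] with e he
    exact (him e he).symm
  have t2 : Tendsto (fun e : ℝ => jacobiTheta (-1 / (4 * (Complex.I * e * z e)))) (𝓝[>] 0) (𝓝 1) := by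
    refine theta_tendsto ((hat.const_mul_atTop (show (0:ℝ) < 1 / 4 by norm_num)).congr' ?_)
    filter_upwards [self_mem_nhdsWithin] with e he
    rw [← him e he]
    have : -1 / (4 * (Complex.I * e * z e)) = ((1 / 4 : ℝ) : ℂ) * (-1 / (Complex.I * e * z e)) := by
      push_cast; ring
    rw [this, Complex.im_ofReal_mul]
  have half : (1 / 2 : ℂ) = 2⁻¹ := by norm_num
  have c1 : Tendsto (fun e => (z e) ^ (1 / 2 : ℂ)) (𝓝[>] 0) (𝓝 (p / 2)) := by
    have h := (continuousAt_cpow_const (b := (1 / 2 : ℂ)) (show (p / 2 : ℂ) ^ 2 ∈ Complex.slitPlane from Or.inl (by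
      have : (p / 2 : ℂ) ^ 2 = (((p / 2 : ℝ) ^ 2 : ℝ) : ℂ) := by push_cast; ring
      rw [this, Complex.ofReal_re]; positivity))).tendsto.comp hzc
    have h2 : ((p / 2 : ℂ) ^ 2) ^ (1 / 2 : ℂ) = p / 2 := by
      rw [half, Complex.sq_cpow_two_inv]
      have : (p / 2 : ℂ) = (((p / 2 : ℝ) : ℝ) : ℂ) := by push_cast; ring
      rw [this, Complex.ofReal_re]; positivity
    rwa [h2] at h
  have c2 : Tendsto (fun e => (4 * z e) ^ (1 / 2 : ℂ)) (𝓝[>] 0) (𝓝 p) := by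
    have h0 := hzc.const_mul 4
    have e4 : 4 * (p / 2 : ℂ) ^ 2 = (p : ℂ) ^ 2 := by ring
    rw [e4] at h0
    have h := (continuousAt_cpow_const (b := (1 / 2 : ℂ)) (show (p : ℂ) ^ 2 ∈ Complex.slitPlane from Or.inl (by
      have : (p : ℂ) ^ 2 = (((p : ℝ) ^ 2 : ℝ) : ℂ) := by push_cast; ring
      rw [this, Complex.ofReal_re]; positivity))).tendsto.comp h0
    have h2 : ((p : ℂ) ^ 2) ^ (1 / 2 : ℂ) = p := by
      rw [half, Complex.sq_cpow_two_inv]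
      rw [Complex.natCast_re]; positivity
    rwa [h2] at h
  have hsp : (√(p : ℝ) : ℂ) ^ 2 = p := by
    rw [← Complex.ofReal_pow, Real.sq_sqrt hp.le]; simp
  have hsp0 : (√(p : ℝ) : ℂ) ≠ 0 := by exact_mod_cast (Real.sqrt_pos.2 hp).ne'
  have c3 : Tendsto (fun e => (-Complex.I * τ e) ^ (1 / 2 : ℂ)) (𝓝[>] 0) (𝓝 ((1 - Complex.I) / √(p : ℝ))) := by
    have h0 := hτc.const_mul (-Complex.I)
    have h := (continuousAt_cpow_const (b := (1 / 2 : ℂ)) (show (-Complex.I * (2 / p) : ℂ) ∈ Complex.slitPlane from Or.inr (by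
      have : (-Complex.I * (2 / p) : ℂ) = ((2 / p : ℝ) : ℂ) * (-Complex.I) := by push_cast; ring
      rw [this, Complex.im_ofReal_mul]
      simp [NeZero.ne p]))).tendsto.comp h0
    have h2 : (-Complex.I * (2 / p)) ^ (1 / 2 : ℂ) = (1 - Complex.I) / √(p : ℝ) := by
      have e3 : (-Complex.I * (2 / p)) = ((1 - Complex.I) / (√(p : ℝ) : ℂ)) ^ 2 := by
        rw [div_pow, hsp]
        field_simp
        linear_combination -Complex.I_sq
      rw [e3, half, Complex.sq_cpow_two_inv]
      rw [Complex.div_ofReal_re]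
      simp
      exact Nat.pos_of_ne_zero (NeZero.ne p)
    rwa [h2] at h
  have hne : (1 - Complex.I) / (√(p : ℝ) : ℂ) ≠ 0 := by
    refine div_ne_zero (fun h => ?_) hsp0
    have := congrArg Complex.re h
    simp at this
  have hfin := ((tendsto_const_nhds (x := (1 : ℂ))).div c3 hne).mul
    ((((((tendsto_const_nhds (x := (1 : ℂ))).div c1 (by simp [hp'])).mul t1).const_mul ((-Complex.I) ^ p))).add
    ((((tendsto_const_nhds (x := (1 : ℂ))).div c2 hp').mul t2).const_mul (1 - (-Complex.I) ^ p)))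
  have hval : 1 / ((1 - Complex.I) / (√(p : ℝ) : ℂ)) * ((-Complex.I) ^ p * (1 / ((p : ℂ) / 2) * 1) +
      (1 - (-Complex.I) ^ p) * (1 / (p : ℂ) * 1)) = √(p : ℝ) / (1 - Complex.I) * ((-Complex.I) ^ p * (2 / p) +
      (1 - (-Complex.I) ^ p) * (1 / p)) := by
    simp
  rw [hval] at hfin
  refine hfin.congr' ?_
  filter_upwards [self_mem_nhdsWithin] with e he
  exact (key e he).symm

/-- The quadratic Gauss sum, with sign. -/
theorem quad_gauss {p : ℕ} [NeZero p] :
    ∑ r : ZMod p, (ZMod.stdAddChar (r ^ 2) : ℂ) = √(p : ℝ) / (1 - Complex.I) * (1 + (-Complex.I) ^ p) := by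
  have hp' : (p : ℂ) ≠ 0 := by exact_mod_cast NeZero.ne p
  have h := tendsto_nhds_unique (theta_lim_left (p := p)) (theta_lim_right (p := p))
  field_simp at h
  rw [h]
  ring

end QT
end PartD

section PartE
namespace QT
open Finset Complex

/-- Jacobi symbol as a complex number. -/
noncomputable def J (m : ℤ) (d : ℕ) : ℂ := ((jacobiSym m d : ℤ) : ℂ)

/-- Jacobi symbol as a function on `ZMod d`. -/
noncomputable def Jz (d : ℕ) (j : ZMod d) : ℂ := J (j.val : ℤ) d

lemma Jz_int (d : ℕ) [NeZero d] (n : ℤ) : Jz d (n : ZMod d) = J n d := by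
  unfold Jz J
  rw [ZMod.val_intCast, ← jacobiSym.mod_left]

lemma Jz_nat (d : ℕ) [NeZero d] (n : ℕ) : Jz d (n : ZMod d) = J n d := by
  have := Jz_int d (n : ℤ)
  rwa [Int.cast_natCast] at this

lemma Jz_mul (d : ℕ) [NeZero d] (x y : ZMod d) : Jz d (x * y) = Jz d x * Jz d y := by
  obtain ⟨x, rfl⟩ := ZMod.intCast_surjective x
  obtain ⟨y, rfl⟩ := ZMod.intCast_surjective y
  rw [← Int.cast_mul, Jz_int, Jz_int, Jz_int]
  unfold J
  rw [jacobiSym.mul_left]; push_cast; rfl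

lemma crt_sum {q₁ q₂ : ℕ} [NeZero q₁] [NeZero q₂] (hc : q₁.Coprime q₂) [NeZero (q₁ * q₂)]
    (F₁ : ZMod q₁ → ℂ) (F₂ : ZMod q₂ → ℂ) (h : ℤ) :
    ∑ j : ZMod (q₁ * q₂), F₁ j.cast * F₂ j.cast * ZMod.stdAddChar (j * (h : ZMod (q₁ * q₂))) =
      (∑ x : ZMod q₁, F₁ (q₂ * x) * ZMod.stdAddChar (x * (h : ZMod q₁))) *
      (∑ y : ZMod q₂, F₂ (q₁ * y) * ZMod.stdAddChar (y * (h : ZMod q₂))) := by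
  have hq1 : (q₁ : ℂ) ≠ 0 := by exact_mod_cast NeZero.ne q₁
  have hq2 : (q₂ : ℂ) ≠ 0 := by exact_mod_cast NeZero.ne q₂
  have u1 : IsUnit (q₂ : ZMod q₁) := (ZMod.isUnit_iff_coprime _ _).2 hc.symm
  have u2 : IsUnit (q₁ : ZMod q₂) := (ZMod.isUnit_iff_coprime _ _).2 hc
  rw [Finset.sum_mul_sum, ← Finset.sum_product']
  symm
  refine Fintype.sum_equiv (((Units.mulLeft u1.unit).prodCongr (Units.mulLeft u2.unit)).trans
    (ZMod.chineseRemainder hc).symm.toEquiv) _ _ ?_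
  rintro ⟨x, y⟩
  obtain ⟨x, rfl⟩ := ZMod.intCast_surjective x
  obtain ⟨y, rfl⟩ := ZMod.intCast_surjective y
  have hj : (((Units.mulLeft u1.unit).prodCongr (Units.mulLeft u2.unit)).trans
    (ZMod.chineseRemainder hc).symm.toEquiv) ((x : ZMod q₁), (y : ZMod q₂)) =
      ((q₂ * x + q₁ * y : ℤ) : ZMod (q₁ * q₂)) := by
    simp only [Equiv.trans_apply, Equiv.prodCongr_apply, Prod.map_apply, Units.mulLeft_apply,
      IsUnit.unit_spec]
    show (ZMod.chineseRemainder hc).symm _ = _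
    rw [RingEquiv.symm_apply_eq]
    rw [map_intCast]
    ext <;> simp
  rw [hj]
  have d1 : q₁ ∣ q₁ * q₂ := dvd_mul_right _ _
  have d2 : q₂ ∣ q₁ * q₂ := dvd_mul_left _ _
  rw [ZMod.cast_intCast d1, ZMod.cast_intCast d2]
  simp only [← Int.cast_mul]
  rw [ZMod.stdAddChar_coe, ZMod.stdAddChar_coe, ZMod.stdAddChar_coe]
  have e1 : ((q₂ * x + q₁ * y : ℤ) : ZMod q₁) = q₂ * x := by simp
  have e2 : ((q₂ * x + q₁ * y : ℤ) : ZMod q₂) = q₁ * y := by simp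
  rw [e1, e2]
  have : cexp (2 * Real.pi * I * (((q₂ * x + q₁ * y) * h : ℤ) : ℂ) / ((q₁ * q₂ : ℕ) : ℂ)) =
      cexp (2 * Real.pi * I * ((x * h : ℤ) : ℂ) / (q₁ : ℂ)) *
      cexp (2 * Real.pi * I * ((y * h : ℤ) : ℂ) / (q₂ : ℂ)) := by
    rw [← Complex.exp_add]
    congr 1
    push_cast
    field_simp
  rw [this]
  ring

/-- sign of the Gauss sum -/
noncomputable def gs (d : ℕ) : ℂ := if d % 4 = 1 then 1 else I

lemma gauss_prime {p : ℕ} [hp : Fact p.Prime] (h2 : p ≠ 2) (h : ZMod p) :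
    ∑ j : ZMod p, Jz p j * ZMod.stdAddChar (j * h) = Jz p h * (gs p * (√(p : ℝ) : ℂ)) := by
  set χ : MulChar (ZMod p) ℂ := (quadraticChar (ZMod p)).ringHomComp (Int.castRingHom ℂ) with hχ
  have hJ : ∀ j : ZMod p, Jz p j = χ j := by
    intro j
    unfold Jz J
    rw [← jacobiSym.legendreSym.to_jacobiSym]
    simp [legendreSym, hχ, MulChar.ringHomComp_apply]
  have hodd : ringChar (ZMod p) ≠ 2 := by rwa [ZMod.ringChar_zmod_n]
  have hχ1 : χ ≠ 1 := by
    rw [hχ]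
    exact (MulChar.ringHomComp_ne_one_iff (Int.cast_injective)).2 (quadraticChar_ne_one hodd)
  have hχ2 : χ⁻¹ = χ := by
    have : χ.IsQuadratic := (quadraticChar_isQuadratic _).comp _
    exact this.inv
  have hmain : ∑ j : ZMod p, χ j * ZMod.stdAddChar (j * h) = χ h * gaussSum χ ZMod.stdAddChar := by
    have hprim : IsPrimitive χ := by
      rcases (Nat.dvd_prime hp.out).1 (conductor_dvd_level χ) with h | h
      · exact absurd ((eq_one_iff_conductor_eq_one).2 h) hχ1
      · exact h
    have := gaussSum_mulShift_of_isPrimitive (R := ℂ) (ZMod.stdAddChar) hprim h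
    rw [hχ2] at this
    rw [← this]
    simp [gaussSum, AddChar.mulShift_apply, mul_comm]
  simp only [hJ]
  rw [hmain]
  congr 1
  have h1 : ∑ r : ZMod p, (ZMod.stdAddChar (r ^ 2) : ℂ) = gaussSum χ ZMod.stdAddChar := by
    have : ∀ a : ZMod p, ((Finset.univ.filter (fun x : ZMod p => x ^ 2 = a)).card : ℂ) = χ a + 1 := by
      intro a
      have := quadraticChar_card_sqrts hodd a
      have h3 : (Set.toFinset {x : ZMod p | x ^ 2 = a}) = Finset.univ.filter (fun x : ZMod p => x ^ 2 = a) := by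
        ext; simp
      rw [h3] at this
      have h4 := congrArg (Int.cast : ℤ → ℂ) this
      push_cast at h4
      rw [h4]; simp [hχ, MulChar.ringHomComp_apply]
    rw [← Finset.sum_fiberwise_of_maps_to (g := fun r : ZMod p => r ^ 2) (t := Finset.univ) (by simp)]
    have : ∀ a : ZMod p, ∑ r ∈ Finset.univ.filter (fun x : ZMod p => x ^ 2 = a), (ZMod.stdAddChar (r ^ 2) : ℂ) =
        (χ a + 1) * ZMod.stdAddChar a := by
      intro a
      rw [← this a, ← nsmul_eq_mul, ← Finset.sum_const]
      refine Finset.sum_congr rfl fun r hr => ?_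
      rw [(Finset.mem_filter.1 hr).2]
    simp only [this, add_mul, one_mul, Finset.sum_add_distrib]
    rw [AddChar.sum_eq_zero_of_ne_one (fun h => (ZMod.isPrimitive_stdAddChar p) one_ne_zero (by simpa using h)), add_zero]
    rfl
  rw [← h1, quad_gauss]
  have hI : (1 - I) ≠ 0 := fun h => by simpa using congrArg Complex.re h
  have hI4 : (-I) ^ 4 = 1 := by rw [neg_pow, I_pow_four]; norm_num
  have hpow : (-I) ^ p = (-I) ^ (p % 4) := by
    conv_lhs => rw [← Nat.div_add_mod p 4, pow_add, pow_mul, hI4, one_pow, one_mul]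
  have : p % 4 = 1 ∨ p % 4 = 3 := by
    have := hp.out.eq_two_or_odd; omega
  rw [hpow]
  unfold gs
  rcases this with h | h <;> rw [h]
  · simp; field_simp; ring
  · simp
    field_simp
    rw [I_pow_three]
    linear_combination (√(p : ℝ) : ℂ) * I_sq


lemma J_mul_right (m : ℤ) {a b : ℕ} (ha : a ≠ 0) (hb : b ≠ 0) : J m (a * b) = J m a * J m b := by
  unfold J
  have : NeZero a := ⟨ha⟩
  have : NeZero b := ⟨hb⟩
  rw [jacobiSym.mul_right]; push_cast; rfl

lemma J_mul_left (m n : ℤ) (b : ℕ) : J (m * n) b = J m b * J n b := by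
  unfold J; rw [jacobiSym.mul_left]; push_cast; rfl

lemma gs_mul {p d : ℕ} (hp : Odd p) (hd : Odd d) (hc : p.Coprime d) :
    J d p * J p d * (gs p * gs d) = gs (p * d) := by
  have hp' : p % 4 = 1 ∨ p % 4 = 3 := by have := Nat.odd_iff.1 hp; omega
  have hd' : d % 4 = 1 ∨ d % 4 = 3 := by have := Nat.odd_iff.1 hd; omega
  have hsq : J d p * J d p = 1 := by
    unfold J
    have := jacobiSym.sq_one (a := (d : ℤ)) (b := p) (by simpa using hc.symm)
    rw [← Int.cast_mul, ← sq, this]; simp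
  unfold gs
  rcases hp' with h1 | h1
  · have : J d p = J p d := by
      unfold J; rw [jacobiSym.quadratic_reciprocity_one_mod_four h1 hd]
    rw [← this, hsq]
    rcases hd' with h2 | h2 <;> simp [Nat.mul_mod, h1, h2]
  · rcases hd' with h2 | h2
    · have : J d p = J p d := by
        unfold J; rw [jacobiSym.quadratic_reciprocity_one_mod_four h2 hp]
      rw [← this, hsq]
      simp [Nat.mul_mod, h1, h2]
    · have : J p d = - J d p := by
        unfold J; rw [jacobiSym.quadratic_reciprocity_three_mod_four h1 h2]; push_cast; rfl
      rw [this, mul_neg, hsq]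
      simp [Nat.mul_mod, h1, h2]

theorem gauss_jac : ∀ d : ℕ, Squarefree d → Odd d → ∀ [NeZero d] (h : ZMod d),
    ∑ j : ZMod d, Jz d j * ZMod.stdAddChar (j * h) = Jz d h * (gs d * (√(d : ℝ) : ℂ)) := by
  intro d
  induction d using Nat.strong_induction_on with
  | _ d ih =>
  intro hsq hodd _ h
  obtain rfl | h1 := eq_or_ne d 1
  · have : h = 0 := Subsingleton.elim _ _
    subst this
    simp [Jz, J, gs]
  obtain ⟨p, hp, e, rfl⟩ := Nat.exists_prime_and_dvd h1
  have he0 : e ≠ 0 := by rintro rfl; exact NeZero.ne (p * 0) (by simp)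
  have : NeZero e := ⟨he0⟩
  have : Fact p.Prime := ⟨hp⟩
  have hpo : Odd p := Nat.Odd.of_mul_left hodd
  have heo : Odd e := Nat.Odd.of_mul_right hodd
  have hc : p.Coprime e := Nat.coprime_of_squarefree_mul hsq
  obtain ⟨h, rfl⟩ := ZMod.intCast_surjective h
  have hlt : e < p * e := by
    have := hp.two_le; have := Nat.pos_of_ne_zero he0; nlinarith
  have hF : ∀ j : ZMod (p * e), Jz (p * e) j = Jz p j.cast * Jz e j.cast := by
    intro j
    obtain ⟨j, rfl⟩ := ZMod.intCast_surjective j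
    rw [ZMod.cast_intCast (dvd_mul_right _ _), ZMod.cast_intCast (dvd_mul_left _ _), Jz_int, Jz_int, Jz_int,
      J_mul_right _ hp.ne_zero he0]
  simp only [hF]
  rw [crt_sum hc]
  simp only [Jz_mul, mul_assoc]
  rw [← Finset.mul_sum, ← Finset.mul_sum, gauss_prime (by rintro rfl; revert hpo; decide), ih e hlt (hsq.squarefree_of_dvd (dvd_mul_left _ _)) heo]
  rw [Jz_nat, Jz_nat, Jz_int, Jz_int, ZMod.cast_intCast (dvd_mul_right _ _), ZMod.cast_intCast (dvd_mul_left _ _), Jz_int, Jz_int,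
    ← gs_mul hpo heo hc]
  push_cast
  rw [Real.sqrt_mul (by positivity)]
  push_cast
  ring

end QT
end PartE

section PartF
namespace QT
open Finset Complex

lemma J_eq_zero {m : ℤ} {d : ℕ} [NeZero d] (h : m.gcd d ≠ 1) : J m d = 0 := by
  unfold J; rw [jacobiSym.eq_zero_iff.2 ⟨NeZero.ne d, h⟩]; simp

lemma J_norm_le (m : ℤ) (d : ℕ) : ‖J m d‖ ≤ 1 := by
  unfold J
  rcases jacobiSym.trichotomy m d with h | h | h <;> rw [h] <;> simp

lemma isUnit_int {d : ℕ} (n : ℤ) : IsUnit (n : ZMod d) ↔ n.gcd d = 1 := by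
  have h1 : IsUnit (n : ZMod d) ↔ IsUnit ((n.natAbs : ℕ) : ZMod d) := by
    rcases Int.natAbs_eq n with h | h
    · conv_lhs => rw [h]
      simp
    · conv_lhs => rw [h]
      simp
  rw [h1, ZMod.isUnit_iff_coprime]
  simp [Int.gcd, Nat.Coprime]

/-- The Jacobi character `m ↦ (m/d)`. -/
noncomputable def jacChar (d : ℕ) [NeZero d] : DirichletCharacter ℂ d where
  toFun := Jz d
  map_one' := by
    have := Jz_nat d 1
    simpa [J] using this
  map_mul' := Jz_mul d
  map_nonunit' := by
    intro a ha
    obtain ⟨a, rfl⟩ := ZMod.intCast_surjective a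
    rw [Jz_int]
    exact J_eq_zero (fun h => ha ((isUnit_int a).2 h))

lemma jacChar_apply (d : ℕ) [NeZero d] (j : ZMod d) : jacChar d j = Jz d j := rfl

lemma jacChar_quadratic (d : ℕ) [NeZero d] : MulChar.IsQuadratic (jacChar d) := by
  intro a
  rw [jacChar_apply]
  unfold Jz J
  rcases jacobiSym.trichotomy (a.val : ℤ) d with h | h | h <;> rw [h] <;> simp

lemma jacChar_primitive {d : ℕ} [NeZero d] (hsq : Squarefree d) (hodd : Odd d) : (jacChar d).IsPrimitive := by
  obtain ⟨k, hk⟩ := conductor_dvd_level (jacChar d)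
  set c := conductor (jacChar d) with hc
  rw [isPrimitive_def]
  by_contra hne
  have hk1 : k ≠ 1 := by rintro rfl; exact hne (by omega)
  obtain ⟨p, hp, k, rfl⟩ := Nat.exists_prime_and_dvd hk1
  have hd : d = p * (c * k) := by rw [hk]; ring
  set e := c * k with he
  have hF : (jacChar d).FactorsThrough c := factorsThrough_conductor _
  have hd0 := NeZero.ne d
  have he0 : e ≠ 0 := by rintro h; rw [h] at hd; simp at hd; exact hd0 hd
  have : Fact p.Prime := ⟨hp⟩
  have hcop : p.Coprime e := Nat.coprime_of_squarefree_mul (hd ▸ hsq)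
  have hpo : Odd p := Nat.Odd.of_mul_left (hd ▸ hodd)
  have hp2 : p ≠ 2 := by rintro rfl; revert hpo; decide
  obtain ⟨a, ha⟩ := quadraticChar_exists_neg_one (F := ZMod p) (by rwa [ZMod.ringChar_zmod_n])
  obtain ⟨u, hu1, hu2⟩ := Nat.chineseRemainder hcop a.val 1
  have hJp : J u p = -1 := by
    rw [← Jz_nat]
    rw [(ZMod.natCast_eq_natCast_iff u a.val p).2 hu1]
    rw [ZMod.natCast_val, ZMod.cast_id]
    unfold Jz J
    rw [← jacobiSym.legendreSym.to_jacobiSym]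
    simp [legendreSym, ha]
  have : NeZero e := ⟨he0⟩
  have hJe : J u e = 1 := by
    rw [← Jz_nat, (ZMod.natCast_eq_natCast_iff u 1 e).2 hu2, Jz_nat]
    simp [J]
  have hJd : J u d = -1 := by rw [hd, J_mul_right _ hp.ne_zero he0, hJp, hJe]; simp
  obtain ⟨hdv, χ₀, h0⟩ := hF
  have hcoprime : IsCoprime (u : ℤ) d := by
    rw [Int.isCoprime_iff_gcd_eq_one]
    by_contra h
    rw [J_eq_zero h] at hJd
    simp at hJd
  have h1 := changeLevel_eq_cast_of_dvd' χ₀ hdv hcoprime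
  rw [← h0, jacChar_apply, Jz_int, hJd] at h1
  have h2 : ((u : ℤ) : ZMod c) = 1 := by
    have : u ≡ 1 [MOD c] := hu2.of_dvd (dvd_mul_right _ _)
    have := (ZMod.natCast_eq_natCast_iff u 1 c).2 this
    simpa using this
  rw [h2, map_one] at h1
  norm_num at h1

/-- central value for the Jacobi character -/
noncomputable def Lc {N : ℕ} (χ : DirichletCharacter ℂ N) (d : ℕ) [NeZero (N * d)] : ℂ :=
  ZMod.LFunction (fun j : ZMod (N * d) => χ j.cast * Jz d j.cast) (1 / 2)

lemma twist_eq {N d : ℕ} [NeZero N] [NeZero d] [NeZero (N * d)] (χ : DirichletCharacter ℂ N) :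
    LFunction ((changeLevel (dvd_mul_right N d) χ) * (changeLevel (dvd_mul_left d N) (jacChar d))) (1 / 2)
      = Lc χ d := by
  unfold Lc LFunction
  congr 1
  ext j
  by_cases hj : IsUnit j
  · obtain ⟨u, rfl⟩ := hj
    rw [MulChar.mul_apply, changeLevel_eq_cast_of_dvd, changeLevel_eq_cast_of_dvd, jacChar_apply]
  · rw [MulChar.map_nonunit _ hj]
    obtain ⟨n, rfl⟩ := ZMod.intCast_surjective j
    rw [ZMod.cast_intCast (dvd_mul_right _ _), ZMod.cast_intCast (dvd_mul_left _ _)]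
    symm
    rw [mul_eq_zero]
    by_contra! h
    have h1 : IsUnit (n : ZMod N) := by by_contra hh; exact h.1 (MulChar.map_nonunit _ hh)
    have h2 : IsUnit (n : ZMod d) := by
      by_contra hh; exact h.2 (by rw [← jacChar_apply]; exact MulChar.map_nonunit _ hh)
    apply hj
    rw [isUnit_int, ← Int.isCoprime_iff_gcd_eq_one] at *
    push_cast
    exact h1.mul_right h2

theorem twisted_afe {N d : ℕ} [NeZero N] [NeZero d] [NeZero (N * d)] {χ : DirichletCharacter ℂ N}
    (hχ : χ.IsPrimitive) (hsq : Squarefree d) (hodd : Odd d) (hc : N.Coprime d)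
    (hpar : χ (-1) * J (-1) d = -1) (hL : Lc χ d = 0) {Y : ℝ} (hY : 0 < Y) :
    ∑' m : ℕ, χ m * J m d * (W Y m : ℂ) =
      (I * gaussSum χ ZMod.stdAddChar / (√(N : ℝ) : ℂ) * gs d) * (χ d * J N d) *
        ∑' m : ℕ, χ⁻¹ m * J m d * (W (N * d / Y) m : ℂ) := by
  have hcast : ∀ (q : ℕ) (_ : q ∣ N * d) (j : ZMod (N * d)), ((-j).cast : ZMod q) = -(j.cast) := by
    intro q hq j
    obtain ⟨n, rfl⟩ := ZMod.intCast_surjective j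
    rw [← Int.cast_neg, ZMod.cast_intCast hq, ZMod.cast_intCast hq]; simp
  have hneg : ∀ x : ZMod d, Jz d (-x) = J (-1) d * Jz d x := by
    intro x
    rw [neg_eq_neg_one_mul, Jz_mul, ← Jz_int]; simp
  have hnegχ : ∀ x : ZMod N, χ (-x) = χ (-1) * χ x := by
    intro x
    rw [neg_eq_neg_one_mul, map_mul]
  have hnegχ' : ∀ x : ZMod N, χ⁻¹ (-x) = χ (-1) * χ⁻¹ x := by
    intro x
    rw [neg_eq_neg_one_mul, map_mul, MulChar.inv_apply]
    congr 2
    rw [show (-1 : ZMod N) = ((-1 : (ZMod N)ˣ) : ZMod N) by simp, Ring.inverse_unit]; simp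
  have h1 : Function.Odd (fun j : ZMod (N * d) => χ j.cast * Jz d j.cast) := by
    intro j
    show χ (-j).cast * Jz d (-j).cast = -(χ j.cast * Jz d j.cast)
    rw [hcast N (dvd_mul_right _ _), hcast d (dvd_mul_left _ _), hneg, hnegχ j.cast]
    linear_combination (χ j.cast * Jz d j.cast) * hpar
  have h2 : Function.Odd (fun j : ZMod (N * d) => χ⁻¹ j.cast * Jz d j.cast) := by
    intro j
    show χ⁻¹ (-j).cast * Jz d (-j).cast = -(χ⁻¹ j.cast * Jz d j.cast)
    rw [hcast N (dvd_mul_right _ _), hcast d (dvd_mul_left _ _), hneg, hnegχ' j.cast]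
    linear_combination (χ⁻¹ j.cast * Jz d j.cast) * hpar
  have key := afe h1 h2 (w := χ d * gaussSum χ ZMod.stdAddChar * (J N d * (gs d * (√(d : ℝ) : ℂ)))) ?_ hL hY
  · have hv : ∀ m : ℕ, χ ((m : ZMod (N * d)).cast) * Jz d ((m : ZMod (N * d)).cast) = χ m * J m d := by
      intro m
      rw [ZMod.cast_natCast (dvd_mul_right _ _), ZMod.cast_natCast (dvd_mul_left _ _), Jz_nat]
    have hv' : ∀ m : ℕ, χ⁻¹ ((m : ZMod (N * d)).cast) * Jz d ((m : ZMod (N * d)).cast) = χ⁻¹ m * J m d := by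
      intro m
      rw [ZMod.cast_natCast (dvd_mul_right _ _), ZMod.cast_natCast (dvd_mul_left _ _), Jz_nat]
    simp only [hv, hv'] at key
    have hN0 : (√(N : ℝ) : ℂ) ≠ 0 := by
      have : (0:ℝ) < N := by exact_mod_cast Nat.pos_of_ne_zero (NeZero.ne N)
      exact_mod_cast (Real.sqrt_pos.2 this).ne'
    have hd0 : (√(d : ℝ) : ℂ) ≠ 0 := by
      have : (0:ℝ) < d := by exact_mod_cast Nat.pos_of_ne_zero (NeZero.ne d)
      exact_mod_cast (Real.sqrt_pos.2 this).ne'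
    push_cast at key
    rw [Real.sqrt_mul (by positivity)] at key
    push_cast at key
    apply mul_left_cancel₀ (mul_ne_zero hN0 hd0)
    rw [key]
    field_simp
  · intro h
    obtain ⟨h, rfl⟩ := ZMod.intCast_surjective h
    rw [crt_sum hc (fun x => χ x) (fun y => Jz d y)]
    simp only [Jz_mul, map_mul, mul_assoc]
    rw [← Finset.mul_sum, ← Finset.mul_sum, gauss_jac d hsq hodd]
    have := gaussSum_mulShift_of_isPrimitive (R := ℂ) (ZMod.stdAddChar) hχ (h : ZMod N)
    simp only [gaussSum, AddChar.mulShift_apply] at this ⊢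
    simp only [mul_comm _ (h : ZMod N)]
    rw [this, ZMod.cast_intCast (dvd_mul_right _ _), ZMod.cast_intCast (dvd_mul_left _ _), Jz_nat]
    ring

end QT
end PartF

section PartG
namespace QT
open Finset Complex

lemma periodic_bound {f : ℕ → ℂ} {Q : ℕ} (hQ0 : 0 < Q) (hper : ∀ n, f (n + Q) = f n)
    (h0 : ∑ n ∈ range Q, f n = 0) (hb : ∀ n, ‖f n‖ ≤ 1) (x : ℕ) : ‖∑ n ∈ range x, f n‖ ≤ Q := by
  induction x using Nat.strong_induction_on with
  | _ x ih =>
  rcases lt_or_ge x Q with h | h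
  · calc ‖∑ n ∈ range x, f n‖ ≤ ∑ n ∈ range x, ‖f n‖ := norm_sum_le _ _
      _ ≤ ∑ n ∈ range x, (1:ℝ) := sum_le_sum fun n _ => hb n
      _ ≤ Q := by simp; exact h.le
  · rcases Nat.eq_zero_or_pos Q with hQ | hQ
    · omega
    · obtain ⟨y, rfl⟩ := Nat.exists_eq_add_of_le h
      rw [Finset.sum_range_add, h0, zero_add]
      have : ∀ n, f (Q + n) = f n := fun n => by rw [add_comm, hper]
      simp only [this]
      exact ih y (by omega)

/-- twisted Jacobi symbol as a function of the lower entry -/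
noncomputable def Xi {N : ℕ} (η : DirichletCharacter ℂ N) (a m n : ℕ) : ℂ :=
  if n % 4 = a then η n * J m n else 0

lemma Xi_norm {N : ℕ} (η : DirichletCharacter ℂ N) (a m n : ℕ) : ‖Xi η a m n‖ ≤ 1 := by
  unfold Xi
  split_ifs
  · rw [norm_mul]
    exact mul_le_one₀ (η.norm_le_one _) (norm_nonneg _) (J_norm_le _ _)
  · simp

lemma Xi_zero {N : ℕ} (η : DirichletCharacter ℂ N) {a : ℕ} (ha : a ≠ 0) (m : ℕ) : Xi η a m 0 = 0 := by
  unfold Xi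
  rw [if_neg (by simpa using ha.symm)]

lemma Xi_congr {N : ℕ} (η : DirichletCharacter ℂ N) {a m : ℕ} (ha : a % 2 = 1) {n n' : ℕ}
    (h : n ≡ n' [MOD (4 * m * N)]) : Xi η a m n = Xi η a m n' := by
  have h4 : n % 4 = n' % 4 := h.of_dvd ⟨m * N, by ring⟩
  have hN : (n : ZMod N) = n' := (ZMod.natCast_eq_natCast_iff _ _ _).2 (h.of_dvd ⟨4 * m, by ring⟩)
  have hm : n % (4 * m) = n' % (4 * m) := h.of_dvd ⟨N, by ring⟩
  unfold Xi
  rw [h4, hN]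
  split_ifs with hh
  · congr 1
    unfold J
    rw [jacobiSym.mod_right _ (b := n) (Nat.odd_iff.2 (by omega)), jacobiSym.mod_right _ (b := n') (Nat.odd_iff.2 (by omega))]
    simp [hm]
  · rfl

lemma Xi_mul {N : ℕ} (η : DirichletCharacter ℂ N) {a m : ℕ} (ha : a % 2 = 1) {u : ℕ} (hu : u % 4 = 1) (n : ℕ) :
    Xi η a m (u * n) = η u * J m u * Xi η a m n := by
  have h4 : (u * n) % 4 = n % 4 := by rw [Nat.mul_mod, hu]; simp
  unfold Xi
  rw [h4]
  split_ifs with hh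
  · rw [J_mul_right _ (by omega) (by omega)]
    push_cast
    rw [map_mul]; ring
  · simp

lemma Xi_period_sum {N : ℕ} [NeZero N] (η : DirichletCharacter ℂ N) {a m : ℕ} (ha : a % 2 = 1) (hm : m ≠ 0)
    {u : ℕ} (hu : u % 4 = 1) (huN : u.Coprime N) (hum : u.Coprime m) (hne : η u * J m u ≠ 1) :
    ∑ n ∈ range (4 * m * N), Xi η a m n = 0 := by
  set Q := 4 * m * N with hQ
  have : NeZero Q := ⟨by simp [hQ, hm, NeZero.ne N]⟩
  have huQ : u.Coprime Q := by
    refine Nat.Coprime.mul_right (Nat.Coprime.mul_right ?_ hum) huN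
    have : Nat.Coprime u (2 ^ 2) := Nat.Coprime.pow_right 2 (Nat.coprime_two_right.2 (Nat.odd_iff.2 (by omega)))
    simpa using this
  have e1 : ∑ n ∈ range Q, Xi η a m n = ∑ x : ZMod Q, Xi η a m x.val := by
    symm
    refine Finset.sum_bij (fun x _ => x.val) ?_ ?_ ?_ ?_
    · intro x _; exact mem_range.2 (ZMod.val_lt x)
    · intro x _ y _ h; exact ZMod.val_injective _ h
    · intro n hn; exact ⟨(n : ZMod Q), mem_univ _, ZMod.val_cast_of_lt (mem_range.1 hn)⟩
    · intro x _; rfl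
  have e2 : ∑ x : ZMod Q, Xi η a m x.val = ∑ x : ZMod Q, η u * J m u * Xi η a m x.val := by
    rw [← Fintype.sum_equiv (Units.mulLeft (ZMod.unitOfCoprime u huQ)) (fun x => η u * J m u * Xi η a m x.val) _]
    intro x
    rw [← Xi_mul η ha hu]
    apply Xi_congr η ha
    rw [← ZMod.natCast_eq_natCast_iff]
    simp
  rw [e1]
  rw [← mul_sum] at e2
  have : (1 - η u * J m u) * ∑ x : ZMod Q, Xi η a m x.val = 0 := by linear_combination e2
  rcases mul_eq_zero.1 this with h | h
  · exact absurd (sub_eq_zero.1 h).symm hne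
  · exact h

lemma Xi_sum_le {N : ℕ} [NeZero N] (η : DirichletCharacter ℂ N) {a m : ℕ} (ha : a % 2 = 1) (hm : m ≠ 0)
    {u : ℕ} (hu : u % 4 = 1) (huN : u.Coprime N) (hum : u.Coprime m) (hne : η u * J m u ≠ 1) (x : ℕ) :
    ‖∑ n ∈ range x, Xi η a m n‖ ≤ 4 * m * N := by
  have := periodic_bound (f := Xi η a m) (Q := 4 * m * N)
    (by have := Nat.pos_of_ne_zero hm; have := Nat.pos_of_ne_zero (NeZero.ne N); positivity) (fun n => Xi_congr η ha (by simp [Nat.ModEq]))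
    (Xi_period_sum η ha hm hu huN hum hne) (Xi_norm η a m) x
  simpa using this

lemma sq_dvd_iff {a : ℕ} (ha : Squarefree a) (l b : ℕ) (hb : b ≠ 0) : l ^ 2 ∣ a * b ^ 2 ↔ l ∣ b := by
  constructor
  · intro h
    obtain ⟨g, l', b', hg, hcop, rfl, rfl⟩ := Nat.exists_coprime' (m := l) (n := b) (Nat.gcd_pos_of_pos_right _ (Nat.pos_of_ne_zero hb))
    have h1 : l' ^ 2 ∣ a * b' ^ 2 := by
      have : g ^ 2 * l' ^ 2 ∣ g ^ 2 * (a * b' ^ 2) := by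
        convert h using 1 <;> ring
      exact Nat.dvd_of_mul_dvd_mul_left (by positivity) this
    have h2 : l' ^ 2 ∣ a := (Nat.Coprime.pow 2 2 hcop).dvd_of_dvd_mul_right h1
    have h3 : l' = 1 := Nat.isUnit_iff.1 (ha l' (by rwa [← sq]))
    rw [h3]; simp
  · intro h
    exact Dvd.dvd.mul_left (pow_dvd_pow_of_dvd h 2) a

lemma sqfree_ind {n : ℕ} (hn : n ≠ 0) {x : ℕ} (hx : n < x) :
    (if Squarefree n then (1:ℂ) else 0) =
      ∑ l ∈ (Ico 1 x).filter (fun l => l ^ 2 ∣ n), ((ArithmeticFunction.moebius l : ℤ) : ℂ) := by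
  obtain ⟨a, b, ha, hb, hab, hsq⟩ := Nat.sq_mul_squarefree_of_pos (Nat.pos_of_ne_zero hn)
  have hn' : n = a * b ^ 2 := by rw [← hab]; ring
  have e : (Ico 1 x).filter (fun l => l ^ 2 ∣ n) = b.divisors := by
    ext l
    simp only [mem_filter, mem_Ico, Nat.mem_divisors]
    rw [hn', sq_dvd_iff hsq l b hb.ne']
    constructor
    · rintro ⟨_, h⟩; exact ⟨h, hb.ne'⟩
    · rintro ⟨h, _⟩
      have := Nat.le_of_dvd hb h
      have : b ≤ n := by rw [hn']; nlinarith [Nat.pos_of_ne_zero (hsq.ne_zero)]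
      exact ⟨⟨Nat.pos_of_dvd_of_pos h hb, by omega⟩, h⟩
  rw [e]
  have h1 : ∑ l ∈ b.divisors, ArithmeticFunction.moebius l = if b = 1 then 1 else 0 := by
    rw [← ArithmeticFunction.coe_mul_zeta_apply, ArithmeticFunction.moebius_mul_coe_zeta, ArithmeticFunction.one_apply]
  rw [← Int.cast_sum, h1]
  have h2 : Squarefree n ↔ b = 1 := by
    constructor
    · intro h
      exact Nat.isUnit_iff.1 (h b ⟨a, by rw [hn']; ring⟩)
    · rintro rfl
      rw [hn']; simpa using hsq
  simp only [h2]
  split_ifs <;> simp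

lemma Xi_sq_mul {N : ℕ} (η : DirichletCharacter ℂ N) {a m : ℕ} (ha : a % 2 = 1) (_ha4 : a < 4) (l : ℕ) :
    ∃ c : ℂ, ‖c‖ ≤ 1 ∧ ∀ n, Xi η a m (l ^ 2 * n) = c * Xi η a m n := by
  rcases Nat.even_or_odd l with h | h
  · refine ⟨0, by simp, fun n => ?_⟩
    obtain ⟨k, rfl⟩ := h
    unfold Xi
    rw [if_neg, zero_mul]
    have : (k + k) ^ 2 * n = 4 * (k ^ 2 * n) := by ring
    omega
  · have h4 : l ^ 2 % 4 = 1 := by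
      obtain ⟨k, rfl⟩ := h
      have : (2 * k + 1) ^ 2 = 4 * (k ^ 2 + k) + 1 := by ring
      omega
    refine ⟨η (l ^ 2 : ℕ) * J m (l ^ 2), ?_, fun n => Xi_mul η ha h4 n⟩
    rw [norm_mul]
    exact mul_le_one₀ (η.norm_le_one _) (norm_nonneg _) (J_norm_le _ _)

lemma min_sum_le {Q x : ℕ} (hQ : 0 < Q) (hx : 0 < x) (M : ℕ) :
    ∑ l ∈ Ico 1 M, min (Q : ℝ) (x / (l : ℝ) ^ 2) ≤ 3 * √(Q * x) := by
  have hQ' : (0:ℝ) < Q := by exact_mod_cast hQ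
  have hx' : (0:ℝ) < x := by exact_mod_cast hx
  set c : ℝ := √(x / Q) with hc
  have hc0 : 0 < c := Real.sqrt_pos.2 (by positivity)
  have hQc : Q * c = √(Q * x) := by
    rw [hc, ← Real.sqrt_sq hQ'.le, ← Real.sqrt_mul (by positivity), Real.sqrt_sq hQ'.le]
    congr 1; field_simp
  have hxc : x / c = √(Q * x) := by
    rw [← hQc, div_eq_iff hc0.ne', mul_assoc, ← sq, hc, Real.sq_sqrt (by positivity)]
    field_simp
  set L := ⌊c⌋₊ with hL
  have hL1 : (L : ℝ) ≤ c := Nat.floor_le hc0.le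
  have hL2 : c < L + 1 := Nat.lt_floor_add_one c
  calc ∑ l ∈ Ico 1 M, min (Q : ℝ) (x / (l : ℝ) ^ 2)
      ≤ ∑ l ∈ Ico 1 (L + 1) ∪ Ioo L M, min (Q : ℝ) (x / (l : ℝ) ^ 2) := by
        apply sum_le_sum_of_subset_of_nonneg
        · intro l hl
          simp only [mem_union, mem_Ico, mem_Ioo] at *
          omega
        · intros; positivity
    _ ≤ ∑ l ∈ Ico 1 (L + 1), min (Q : ℝ) (x / (l : ℝ) ^ 2) + ∑ l ∈ Ioo L M, min (Q : ℝ) (x / (l : ℝ) ^ 2) := by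
        rw [← sum_union_inter]
        have : 0 ≤ ∑ l ∈ Ico 1 (L + 1) ∩ Ioo L M, min (Q : ℝ) (x / (l : ℝ) ^ 2) :=
          sum_nonneg fun _ _ => by positivity
        linarith
    _ ≤ ∑ l ∈ Ico 1 (L + 1), (Q : ℝ) + ∑ l ∈ Ioo L M, x * ((l : ℝ) ^ 2)⁻¹ := by
        gcongr
        · exact min_le_left _ _
        · rw [← div_eq_mul_inv]; exact min_le_right _ _
    _ ≤ Q * c + x * (2 / (L + 1)) := by
        rw [← mul_sum]
        gcongr
        · simp; rw [mul_comm]; gcongr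
        · exact sum_Ioo_inv_sq_le L M
    _ ≤ Q * c + 2 * (x / c) := by
        have : (2 : ℝ) / (L + 1) ≤ 2 / c := by gcongr
        have := mul_le_mul_of_nonneg_left this hx'.le
        rw [show 2 * (x / c) = x * (2 / c) by ring]
        linarith
    _ = 3 * √(Q * x) := by rw [hQc, hxc]; ring

/-- square-free partial sums -/
lemma Xi_sqfree_sum_le {N : ℕ} [NeZero N] (η : DirichletCharacter ℂ N) {a m : ℕ} (ha : a % 2 = 1) (ha4 : a < 4) (hm : m ≠ 0)
    (hu : ∃ u : ℕ, u % 4 = 1 ∧ u.Coprime N ∧ u.Coprime m ∧ η u * J m u ≠ 1) (x : ℕ) :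
    ‖∑ n ∈ range x, if Squarefree n then Xi η a m n else 0‖ ≤ 3 * √(4 * m * N * x) := by
  obtain ⟨u, hu, huN, hum, hne⟩ := hu
  rcases Nat.eq_zero_or_pos x with rfl | hx
  · simp
  have ha0 : a ≠ 0 := by omega
  have e1 : ∑ n ∈ range x, (if Squarefree n then Xi η a m n else 0) =
      ∑ l ∈ Ico 1 x, ((ArithmeticFunction.moebius l : ℤ) : ℂ) *
        ∑ n ∈ (range x).filter (fun n => l ^ 2 ∣ n), Xi η a m n := by
    have : ∀ n ∈ range x, (if Squarefree n then Xi η a m n else 0) =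
        ∑ l ∈ Ico 1 x, if l ^ 2 ∣ n then ((ArithmeticFunction.moebius l : ℤ) : ℂ) * Xi η a m n else 0 := by
      intro n hn
      rcases eq_or_ne n 0 with rfl | hn0
      · simp [Xi_zero η ha0]
      · have := sqfree_ind hn0 (mem_range.1 hn)
        rw [sum_filter] at this
        rw [← one_mul (Xi η a m n)]
        rw [← ite_zero_mul, this, sum_mul]
        simp [ite_mul]
    rw [sum_congr rfl this, sum_comm]
    refine sum_congr rfl fun l _ => ?_
    rw [mul_sum, sum_filter]
  rw [e1]
  refine (norm_sum_le _ _).trans ?_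
  have hQ : 0 < 4 * m * N := by
    have := Nat.pos_of_ne_zero hm; have := Nat.pos_of_ne_zero (NeZero.ne N); positivity
  have := min_sum_le hQ hx x
  push_cast at this
  refine le_trans (sum_le_sum fun l hl => ?_) this
  have hl1 : 1 ≤ l := (mem_Ico.1 hl).1
  rw [norm_mul]
  have hmu : ‖((ArithmeticFunction.moebius l : ℤ) : ℂ)‖ ≤ 1 := by
    have := ArithmeticFunction.abs_moebius_le_one (n := l)
    rw [Complex.norm_intCast]
    exact_mod_cast this
  have e2 : ∑ n ∈ (range x).filter (fun n => l ^ 2 ∣ n), Xi η a m n =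
      ∑ n ∈ range ((x - 1) / l ^ 2 + 1), Xi η a m (l ^ 2 * n) := by
    symm
    refine Finset.sum_bij (fun n _ => l ^ 2 * n) ?_ ?_ ?_ ?_
    · intro n hn
      simp only [mem_range, mem_filter] at *
      refine ⟨?_, dvd_mul_right _ _⟩
      have : n ≤ (x - 1) / l ^ 2 := by omega
      rw [Nat.le_div_iff_mul_le (by positivity)] at this
      rw [mul_comm] at this
      omega
    · intro n _ n' _ h
      exact Nat.eq_of_mul_eq_mul_left (by positivity) h
    · intro n hn
      simp only [mem_range, mem_filter] at hn
      obtain ⟨hn, k, rfl⟩ := hn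
      refine ⟨k, ?_, rfl⟩
      simp only [mem_range]
      have : k ≤ (x - 1) / l ^ 2 := by
        rw [Nat.le_div_iff_mul_le (by positivity), mul_comm]; omega
      omega
    · intro n _; rfl
  obtain ⟨c, hc, hcX⟩ := Xi_sq_mul η (m := m) ha ha4 l
  have b1 : ‖∑ n ∈ (range x).filter (fun n => l ^ 2 ∣ n), Xi η a m n‖ ≤ 4 * m * N := by
    rw [e2]
    simp only [hcX]
    rw [← mul_sum, norm_mul]
    calc _ ≤ 1 * (4 * m * N : ℝ) := by
          gcongr
          exact Xi_sum_le η ha hm hu huN hum hne _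
      _ = _ := one_mul _
  have b2 : ‖∑ n ∈ (range x).filter (fun n => l ^ 2 ∣ n), Xi η a m n‖ ≤ x / (l:ℝ) ^ 2 := by
    rw [e2, sum_range_succ', mul_zero, Xi_zero η ha0, add_zero]
    calc _ ≤ ∑ n ∈ range ((x - 1) / l ^ 2), ‖Xi η a m (l ^ 2 * (n + 1))‖ := norm_sum_le _ _
      _ ≤ ∑ n ∈ range ((x - 1) / l ^ 2), (1:ℝ) := sum_le_sum fun n _ => Xi_norm _ _ _ _
      _ = (((x - 1) / l ^ 2 : ℕ) : ℝ) := by simp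
      _ ≤ ((x - 1 : ℕ) : ℝ) / ((l ^ 2 : ℕ) : ℝ) := Nat.cast_div_le
      _ ≤ x / (l:ℝ) ^ 2 := by
          push_cast
          gcongr
          omega
  calc _ ≤ 1 * ‖∑ n ∈ (range x).filter (fun n => l ^ 2 ∣ n), Xi η a m n‖ := by gcongr
    _ ≤ _ := by rw [one_mul]; exact le_min b1 b2

/-- partial summation -/
lemma abel_bound {c : ℕ → ℂ} {v : ℕ → ℝ} {M K : ℝ} {x : ℕ} (hM : ∀ j ≤ x, ‖∑ n ∈ range j, c n‖ ≤ M)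
    (hmono : Monotone v) (hv : ∀ n, 0 ≤ v n) (hK : ∀ n < x, v n ≤ K) (hK0 : 0 ≤ K) :
    ‖∑ n ∈ range x, c n * (v n : ℂ)‖ ≤ 2 * M * K := by
  have hM0 : 0 ≤ M := (norm_nonneg _).trans (hM 0 (Nat.zero_le _))
  rcases Nat.eq_zero_or_pos x with rfl | hx
  · simp; positivity
  have h := Finset.sum_range_by_parts (fun n => (v n : ℂ)) c x
  simp only [smul_eq_mul] at h
  simp only [mul_comm (c _)]
  rw [h]
  have hvK := hK (x - 1) (by omega)
  calc _ ≤ ‖(v (x-1) : ℂ) * ∑ i ∈ range x, c i‖ + ‖∑ i ∈ range (x - 1), ((v (i+1) : ℂ) - v i) * ∑ i ∈ range (i + 1), c i‖ :=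
        norm_sub_le _ _
    _ ≤ v (x-1) * M + ∑ i ∈ range (x - 1), (v (i+1) - v i) * M := by
        gcongr
        · rw [norm_mul, Complex.norm_of_nonneg (hv _)]
          exact mul_le_mul_of_nonneg_left (hM x le_rfl) (hv _)
        · refine (norm_sum_le _ _).trans (sum_le_sum fun i hi => ?_)
          have hi := mem_range.1 hi
          have h0 : 0 ≤ v (i + 1) - v i := sub_nonneg.2 (hmono (Nat.le_succ i))
          rw [norm_mul, ← Complex.ofReal_sub, Complex.norm_of_nonneg h0]
          exact mul_le_mul_of_nonneg_left (hM _ (by omega)) h0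
    _ = v (x-1) * M + (v (x-1) - v 0) * M := by rw [← sum_mul, sum_range_sub]
    _ ≤ 2 * M * K := by
        have := hv 0
        nlinarith

lemma exists_jacobi_neg_one {m : ℕ} (hm : ¬ IsSquare m) (M : ℕ) (hM : M ≠ 0) :
    ∃ u : ℕ, u % 4 = 1 ∧ u.Coprime M ∧ u.Coprime m ∧ J m u = -1 := by
  have hm0 : m ≠ 0 := by rintro rfl; exact hm (by simp)
  obtain ⟨a, b, ha, hb, hab, hsq⟩ := Nat.sq_mul_squarefree_of_pos (Nat.pos_of_ne_zero hm0)
  have ha1 : a ≠ 1 := by rintro rfl; exact hm ⟨b, by rw [← hab]; ring⟩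
  suffices h : ∃ (q r : ℕ), q ≠ 0 ∧ r.Coprime q ∧ 4 ∣ q ∧ r % 4 = 1 ∧ ∀ u, u.Prime → u ≡ r [MOD q] → J a u = -1 by
    obtain ⟨q, r, hq, hrq, h4, hr4, hJ⟩ := h
    have : NeZero q := ⟨hq⟩
    obtain ⟨u, hu, hup, hur⟩ := Nat.forall_exists_prime_gt_and_eq_mod ((ZMod.isUnit_iff_coprime r q).2 hrq) (M + m)
    have hmod : u ≡ r [MOD q] := (ZMod.natCast_eq_natCast_iff _ _ _).1 hur
    have h4' : u % 4 = 1 := by rw [← hr4]; exact hmod.of_dvd h4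
    have c1 : u.Coprime M := (Nat.coprime_of_lt_prime hM (by omega) hup)
    have c2 : u.Coprime m := (Nat.coprime_of_lt_prime hm0 (by omega) hup)
    refine ⟨u, h4', c1, c2, ?_⟩
    have : J m u = J a u := by
      rw [← hab]
      push_cast
      rw [J_mul_left]
      have hbu : IsCoprime (b : ℤ) u := by
        rw [Nat.isCoprime_iff_coprime]
        exact (Nat.Coprime.coprime_dvd_right (⟨b * a, by rw [← hab]; ring⟩) c2).symm
      unfold J
      rw [jacobiSym.sq_one' (Int.isCoprime_iff_gcd_eq_one.1 hbu)]; simp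
    rw [this]; exact hJ u hup hmod
  by_cases h2 : ∃ p, p.Prime ∧ p ≠ 2 ∧ p ∣ a
  · obtain ⟨p, hp, hp2, r, rfl⟩ := h2
    have : Fact p.Prime := ⟨hp⟩
    have hr0 : r ≠ 0 := by rintro rfl; simp at ha
    have hpo : Odd p := hp.odd_of_ne_two hp2
    have hcop : p.Coprime r := Nat.coprime_of_squarefree_mul hsq
    have hcop' : p.Coprime (4 * r) := by
      refine Nat.Coprime.mul_right ?_ hcop
      have : Nat.Coprime p (2 ^ 2) := Nat.Coprime.pow_right 2 (Nat.coprime_two_right.2 hpo)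
      simpa using this
    obtain ⟨t, ht⟩ := quadraticChar_exists_neg_one (F := ZMod p) (by rwa [ZMod.ringChar_zmod_n])
    obtain ⟨u₀, hu1, hu2⟩ := Nat.chineseRemainder hcop' t.val 1
    have hJp : J u₀ p = -1 := by
      rw [← Jz_nat]
      rw [(ZMod.natCast_eq_natCast_iff u₀ t.val p).2 hu1]
      rw [ZMod.natCast_val, ZMod.cast_id]
      unfold Jz J
      rw [← jacobiSym.legendreSym.to_jacobiSym]
      simp [legendreSym, ht]
    refine ⟨p * (4 * r), u₀, by simp [hp.ne_zero, hr0], ?_, ⟨p * r, by ring⟩, ?_, ?_⟩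
    · refine Nat.Coprime.mul_right ?_ ?_
      · by_contra h
        rw [J_eq_zero (by simpa [Nat.Coprime] using h)] at hJp
        norm_num at hJp
      · have := hu2.gcd_eq
        simpa [Nat.Coprime] using this
    · exact hu2.of_dvd ⟨r, rfl⟩
    · intro u hup hur
      have h4 : u % 4 = 1 := (hur.of_dvd ⟨p * r, by ring⟩).trans (hu2.of_dvd ⟨r, rfl⟩)
      have huo : Odd u := Nat.odd_iff.2 (by omega)
      push_cast
      rw [J_mul_left]
      have j1 : J p u = J u p := by
        unfold J; rw [jacobiSym.quadratic_reciprocity_one_mod_four' hpo h4]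
      have j2 : J u p = -1 := by
        rw [← hJp, ← Jz_nat, ← Jz_nat, (ZMod.natCast_eq_natCast_iff u u₀ p).2 (hur.of_dvd ⟨4 * r, rfl⟩)]
      have j3 : J r u = 1 := by
        unfold J
        rw [jacobiSym.mod_right _ huo]
        have : u % (4 * (r : ℤ).natAbs) = 1 % (4 * r) := by
          simp only [Int.natAbs_natCast]
          exact (hur.of_dvd ⟨p, by ring⟩).trans hu2
        rw [this, Nat.mod_eq_of_lt (by omega)]
        simp
      rw [j1, j2, j3]; simp
  · push Not at h2
    have ha2 : a = 2 := by
      obtain ⟨p, hp, hpa⟩ := Nat.exists_prime_and_dvd ha1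
      have : p = 2 := by by_contra h; exact h2 p hp h hpa
      subst this
      obtain ⟨c, rfl⟩ := hpa
      have hc1 : c = 1 := by
        by_contra hc
        obtain ⟨p', hp', hpc⟩ := Nat.exists_prime_and_dvd hc
        have : p' = 2 := by by_contra h; exact h2 p' hp' h (hpc.mul_left _)
        subst this
        have := hsq 2 (mul_dvd_mul_left 2 hpc)
        simp at this
      rw [hc1]
    subst ha2
    refine ⟨8, 5, by norm_num, by norm_num, by norm_num, by norm_num, ?_⟩
    intro u hup hur
    have h8 : u % 8 = 5 := hur
    have huo : Odd u := Nat.odd_iff.2 (by omega)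
    unfold J
    have := jacobiSym.at_two huo
    push_cast
    rw [this, ZMod.χ₈_nat_eq_if_mod_eight]
    have h2 : u % 2 ≠ 0 := by omega
    simp [h8, h2]

end QT
end PartG

section PartH
namespace QT
open Finset Complex

/-- squarefree, 3 mod 4, below X -/
noncomputable def DD (X : ℕ) : Finset ℕ := by
  classical exact (range X).filter (fun d => Squarefree d ∧ d % 4 = 3)

lemma mem_DD {X d : ℕ} : d ∈ DD X ↔ d < X ∧ Squarefree d ∧ d % 4 = 3 := by
  classical
  unfold DD; simp

lemma card_res (X l : ℕ) (hl : 0 < l) : ((range X).filter (fun n => n % 4 = 3 ∧ l ^ 2 ∣ n)).card ≤ X / (4 * l ^ 2) + 1 := by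
  rw [← card_range (X / (4 * l ^ 2) + 1)]
  apply card_le_card_of_injOn (fun n => n / (4 * l ^ 2))
  · intro n hn
    simp only [coe_filter, mem_range, Set.mem_ofPred_eq] at hn
    simp only [coe_range, Set.mem_Iio]
    exact Nat.lt_succ_of_le (Nat.div_le_div_right hn.1.le)
  · intro n hn n' hn' h
    simp only [coe_filter, mem_range, Set.mem_ofPred_eq] at hn hn' h
    have hodd : Odd l := by
      by_contra he
      rw [Nat.not_odd_iff_even] at he
      obtain ⟨k, rfl⟩ := he
      obtain ⟨t, ht⟩ := hn.2.2
      have : (k + k) ^ 2 * t = 4 * (k ^ 2 * t) := by ring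
      omega
    have hc : Nat.Coprime 4 (l ^ 2) := by
      have : Nat.Coprime (2 ^ 2) (l ^ 2) := Nat.Coprime.pow 2 2 (Nat.coprime_two_left.2 hodd)
      simpa using this
    have hmod : n ≡ n' [MOD (4 * l ^ 2)] := by
      rw [← Nat.modEq_and_modEq_iff_modEq_mul hc]
      refine ⟨hn.2.1.trans hn'.2.1.symm, ?_⟩
      exact ((Nat.modEq_zero_iff_dvd).2 hn.2.2).trans ((Nat.modEq_zero_iff_dvd).2 hn'.2.2).symm
    rw [← Nat.div_add_mod n (4 * l ^ 2), ← Nat.div_add_mod n' (4 * l ^ 2), h, hmod]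

lemma card_DD (X : ℕ) : (X : ℝ) / 12 - √X - 2 ≤ ((DD X).card : ℝ) := by
  classical
  have h1 : ((range X).filter (fun n => n % 4 = 3)).card ≤ (DD X).card +
      ∑ l ∈ Ico 3 (Nat.sqrt X + 1), ((range X).filter (fun n => n % 4 = 3 ∧ l ^ 2 ∣ n)).card := by
    refine (card_le_card ?_).trans ((card_union_le (DD X) ((Ico 3 (Nat.sqrt X + 1)).biUnion fun l => (range X).filter (fun n => n % 4 = 3 ∧ l ^ 2 ∣ n))).trans (Nat.add_le_add_left card_biUnion_le _))
    intro n hn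
    simp only [mem_filter, mem_range] at hn
    rw [mem_union, mem_DD]
    by_cases hs : Squarefree n
    · left; exact ⟨hn.1, hs, hn.2⟩
    · right
      rw [mem_biUnion]
      obtain ⟨b, a, hb, ha, hab, hsq⟩ := Nat.sq_mul_squarefree_of_pos (show 0 < n by omega)
      have ha1 : a ≠ 1 := by rintro rfl; apply hs; rw [← hab]; simpa using hsq
      have ha2 : a ≠ 2 := by rintro rfl; omega
      refine ⟨a, ?_, ?_⟩
      · rw [mem_Ico]
        refine ⟨by omega, Nat.lt_succ_of_le (Nat.le_sqrt.2 ?_)⟩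
        nlinarith
      · simp only [mem_filter, mem_range]
        exact ⟨hn.1, hn.2, ⟨b, hab.symm⟩⟩
  have h2 : (X : ℝ) / 4 - 1 ≤ (((range X).filter (fun n => n % 4 = 3)).card : ℝ) := by
    have : X / 4 ≤ ((range X).filter (fun n => n % 4 = 3)).card := by
      conv_lhs => rw [← card_range (X / 4)]
      apply card_le_card_of_injOn (fun n => 4 * n + 3)
      · intro n hn
        simp only [coe_range, Set.mem_Iio, coe_filter, mem_range, Set.mem_ofPred_eq] at *
        omega
      · intro n _ n' _ h
        simp only at h; omega
    have h3 : (X : ℝ) ≤ 4 * ((X / 4 : ℕ) : ℝ) + 4 := by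
      have : X ≤ 4 * (X / 4) + 4 := by omega
      exact_mod_cast this
    have h4 : ((X / 4 : ℕ) : ℝ) ≤ (((range X).filter (fun n => n % 4 = 3)).card : ℝ) := by exact_mod_cast this
    linarith
  have h3 : ((∑ l ∈ Ico 3 (Nat.sqrt X + 1), ((range X).filter (fun n => n % 4 = 3 ∧ l ^ 2 ∣ n)).card : ℕ) : ℝ) ≤
      X / 4 * (1 / 9 + 1 / 2) + √X := by
    push_cast
    calc _ ≤ ∑ l ∈ Ico 3 (Nat.sqrt X + 1), ((X : ℝ) / 4 * ((l:ℝ) ^ 2)⁻¹ + 1) := by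
          refine sum_le_sum fun l hl => ?_
          have hl3 : 3 ≤ l := (mem_Ico.1 hl).1
          have := card_res X l (by omega)
          calc ((((range X).filter (fun n => n % 4 = 3 ∧ l ^ 2 ∣ n)).card : ℕ) : ℝ) ≤ ((X / (4 * l ^ 2) + 1 : ℕ) : ℝ) := by exact_mod_cast this
            _ ≤ (X : ℝ) / ((4 * l ^ 2 : ℕ) : ℝ) + 1 := by rw [Nat.cast_add, Nat.cast_one]; exact add_le_add_left (Nat.cast_div_le (α := ℝ) (m := X) (n := 4 * l ^ 2)) 1
            _ = _ := by push_cast; field_simp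
      _ ≤ X / 4 * (1 / 9 + 1 / 2) + √X := by
          rw [sum_add_distrib, ← mul_sum]
          gcongr
          · have hsub : Ico 3 (Nat.sqrt X + 1) ⊆ insert 3 (Ioo 3 (Nat.sqrt X + 1)) := by
              intro l hl
              simp only [mem_insert, mem_Ioo, mem_Ico] at *
              omega
            calc _ ≤ ∑ l ∈ insert 3 (Ioo 3 (Nat.sqrt X + 1)), ((l:ℝ) ^ 2)⁻¹ :=
                  sum_le_sum_of_subset_of_nonneg hsub fun _ _ _ => by positivity
              _ ≤ 1 / 9 + 1 / 2 := by
                  rw [sum_insert (by simp)]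
                  have := sum_Ioo_inv_sq_le (α := ℝ) 3 (Nat.sqrt X + 1)
                  norm_num at this ⊢
                  linarith
          · simp only [sum_const, Nat.card_Ico, nsmul_eq_mul, mul_one]
            have : ((Nat.sqrt X + 1 - 3 : ℕ) : ℝ) ≤ (Nat.sqrt X : ℝ) := by exact_mod_cast (by omega)
            exact this.trans Real.nat_sqrt_le_real_sqrt
  have h1' : (((range X).filter (fun n => n % 4 = 3)).card : ℝ) ≤ ((DD X).card : ℝ) +
      ((∑ l ∈ Ico 3 (Nat.sqrt X + 1), ((range X).filter (fun n => n % 4 = 3 ∧ l ^ 2 ∣ n)).card : ℕ) : ℝ) := by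
    exact_mod_cast h1
  have : (0:ℝ) ≤ X := by positivity
  linarith

lemma real_afe {d : ℕ} [NeZero (1 * d)] (hsq : Squarefree d) (h3 : d % 4 = 3)
    (hL : Lc (1 : DirichletCharacter ℂ 1) d = 0) : ∑' m : ℕ, J m d * (W (√d) m : ℂ) = 0 := by
  have hd0 : d ≠ 0 := by omega
  have : NeZero d := ⟨hd0⟩
  have hodd : Odd d := Nat.odd_iff.2 (by omega)
  have hJ1 : J (-1) d = -1 := by
    unfold J
    rw [jacobiSym.at_neg_one hodd, ZMod.χ₄_nat_three_mod_four h3]; simp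
  have hd' : (0:ℝ) < d := by exact_mod_cast Nat.pos_of_ne_zero hd0
  have hone : ∀ x : ZMod 1, (1 : DirichletCharacter ℂ 1) x = 1 := by
    intro x
    rw [Subsingleton.elim x 1]; simp
  have h := twisted_afe (χ := (1 : DirichletCharacter ℂ 1)) (isPrimitive_one_level_one) hsq hodd (by simp)
    (by rw [hJ1, hone]; simp) hL (Real.sqrt_pos.2 hd')
  have hg : gaussSum (1 : DirichletCharacter ℂ 1) ZMod.stdAddChar = 1 := by
    unfold gaussSum
    rw [Fintype.sum_subsingleton _ (0 : ZMod 1), hone]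
    simp
  have hgs : gs d = I := by unfold gs; rw [if_neg (by omega)]
  have hJ1' : J ((1 : ℕ) : ℤ) d = 1 := by simp [J]
  rw [inv_one] at h
  have hdd : ((1 : ℕ) : ℝ) * d / √d = √d := by
    rw [Nat.cast_one, one_mul]; exact Real.div_sqrt
  simp only [hone, hg, hgs, hJ1', hdd, one_mul, mul_one] at h
  simp only [Nat.cast_one, Real.sqrt_one, Complex.ofReal_one, div_one, I_mul_I] at h
  linear_combination h / 2

end QT
end PartH

section PartI
namespace QT
open Finset Complex

/-- inner sum over discriminants -/
noncomputable def Tm (X m : ℕ) : ℂ := ∑ d ∈ DD X, J m d * (W (√d) m : ℂ)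

lemma one_apply' (x : ZMod 1) : (1 : DirichletCharacter ℂ 1) x = 1 := by
  rw [Subsingleton.elim x 1]; simp

/-- monotone weight -/
noncomputable def vw (c : ℝ) (m d : ℕ) : ℝ := if d = 0 then 0 else V (m * c / d)

lemma vw_mono {c : ℝ} (hc : 0 ≤ c) (m : ℕ) : Monotone (vw c m) := by
  intro a b hab
  unfold vw
  by_cases ha : a = 0
  · rw [if_pos ha]; split_ifs
    · exact le_rfl
    · exact V_nonneg _
  · rw [if_neg ha, if_neg (by omega)]
    apply V_anti (by positivity)
    have : (0:ℝ) < a := by exact_mod_cast Nat.pos_of_ne_zero ha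
    gcongr

lemma vw_nonneg (c : ℝ) (m d : ℕ) : 0 ≤ vw c m d := by
  unfold vw; split_ifs
  · exact le_rfl
  · exact V_nonneg _

/-- monotone weight with square root -/
noncomputable def vs (m d : ℕ) : ℝ := if d = 0 then 0 else V (m / √d)

lemma vs_mono (m : ℕ) : Monotone (vs m) := by
  intro a b hab
  unfold vs
  by_cases ha : a = 0
  · rw [if_pos ha]; split_ifs
    · exact le_rfl
    · exact V_nonneg _
  · rw [if_neg ha, if_neg (by omega)]
    apply V_anti (by positivity)
    have : (0:ℝ) < a := by exact_mod_cast Nat.pos_of_ne_zero ha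
    gcongr

lemma vs_nonneg (m d : ℕ) : 0 ≤ vs m d := by
  unfold vs; split_ifs
  · exact le_rfl
  · exact V_nonneg _

lemma Tm_nonsq {X m : ℕ} (hX : 0 < X) (hm : ¬ IsSquare m) : ‖Tm X m‖ ≤ 12 * √X * V (m / √X) := by
  classical
  have hm0 : m ≠ 0 := by rintro rfl; exact hm ⟨0, rfl⟩
  have hm0' : (0:ℝ) < m := by exact_mod_cast Nat.pos_of_ne_zero hm0
  have h1 : Tm X m = ((m:ℝ) ^ (-(1/2) : ℝ) : ℝ) * ∑ d ∈ range X, (if Squarefree d then Xi (1 : DirichletCharacter ℂ 1) 3 m d else 0) * (vs m d : ℂ) := by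
    unfold Tm DD
    rw [sum_filter, mul_sum]
    refine sum_congr rfl fun d hd => ?_
    by_cases hs : Squarefree d
    · by_cases h3 : d % 4 = 3
      · rw [if_pos ⟨hs, h3⟩, if_pos hs, Xi, if_pos h3, one_apply', W, vs, if_neg (by omega)]
        push_cast; ring
      · rw [if_neg (fun h => h3 h.2), if_pos hs, Xi, if_neg h3]; simp
    · rw [if_neg (fun h => hs h.1), if_neg hs]; simp
  obtain ⟨u, hu1, hu2, hu3, hu4⟩ := exists_jacobi_neg_one hm 1 one_ne_zero
  have hX' : (0:ℝ) < X := by exact_mod_cast hX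
  have h2 := abel_bound (c := fun d => if Squarefree d then Xi (1 : DirichletCharacter ℂ 1) 3 m d else 0)
    (v := vs m) (M := 3 * √(4 * m * X)) (K := V (m / √X)) (x := X) (by
      intro j hj
      refine (Xi_sqfree_sum_le (1 : DirichletCharacter ℂ 1) (a := 3) (m := m) (by norm_num) (by norm_num) hm0
        ⟨u, hu1, hu2, hu3, by rw [one_apply', hu4]; norm_num⟩ j).trans ?_
      have : (j:ℝ) ≤ X := by exact_mod_cast hj
      rw [Nat.cast_one, mul_one]
      gcongr) (vs_mono m) (vs_nonneg m) (by
      intro n hn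
      refine (vs_mono m hn.le).trans ?_
      rw [vs, if_neg (by omega)]) (V_nonneg _)
  rw [h1, norm_mul, norm_real, Real.norm_of_nonneg (by positivity)]
  calc _ ≤ (m:ℝ) ^ (-(1/2) : ℝ) * (2 * (3 * √(4 * m * X)) * V (m / √X)) := by gcongr
    _ = 12 * √X * V (m / √X) := by
      have e : √(4 * m * X) = 2 * √m * √X := by
        rw [Real.sqrt_mul (by positivity), Real.sqrt_mul (by positivity)]
        congr 2
        rw [show (4:ℝ) = 2 ^ 2 by norm_num]; exact Real.sqrt_sq (by norm_num)
      have e2 : (m:ℝ) ^ (-(1/2) : ℝ) * √m = 1 := by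
        rw [Real.sqrt_eq_rpow, ← Real.rpow_add hm0']; norm_num
      rw [e]
      linear_combination (12 * √X * V (m / √X)) * e2

lemma J_sq (j : ℤ) (d : ℕ) : J (j ^ 2) d = (((jacobiSym j d) ^ 2 : ℤ) : ℂ) := by
  unfold J; rw [jacobiSym.pow_left]

lemma Tm_sq_re (X : ℕ) (j : ℕ) : (Tm X (j ^ 2)).re = ∑ d ∈ DD X, (jacobiSym j d : ℝ) ^ 2 * W (√d) (j ^ 2) := by
  unfold Tm
  rw [re_sum]
  refine sum_congr rfl fun d _ => ?_
  rw [show (((j ^ 2 : ℕ) : ℤ)) = (j:ℤ) ^ 2 by push_cast; rfl, J_sq]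
  rw [show ((((jacobiSym j d) ^ 2 : ℤ) : ℂ)) = (((jacobiSym j d : ℝ) ^ 2 : ℝ) : ℂ) by push_cast; rfl]
  rw [← ofReal_mul, ofReal_re]

lemma Tm_sq_nonneg (X : ℕ) (j : ℕ) : 0 ≤ (Tm X (j ^ 2)).re := by
  rw [Tm_sq_re]
  exact sum_nonneg fun d _ => mul_nonneg (sq_nonneg _) (W_nonneg _ _)

lemma Tm_prime (X p : ℕ) (hp : p.Prime) :
    1 / (p:ℝ) * V 1 * ((DD X).card - X / p - 1 - p ^ 4) ≤ (Tm X (p ^ 2)).re := by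
  classical
  rw [Tm_sq_re]
  have hp0 : (0:ℝ) < p := by exact_mod_cast hp.pos
  let G := (DD X).filter (fun d => ¬ p ∣ d ∧ p ^ 4 ≤ d)
  have hcard : ((DD X).card : ℝ) ≤ G.card + (X / p + 1) + p ^ 4 := by
    have hsub : DD X ⊆ (G ∪ (range X).filter (fun d => p ∣ d)) ∪ range (p ^ 4) := by
      intro d hd
      simp only [G, mem_union, mem_filter, mem_range]
      have := (mem_DD.1 hd).1
      by_cases h1 : p ∣ d
      · left; right; exact ⟨this, h1⟩
      · by_cases h2 : p ^ 4 ≤ d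
        · left; left; exact ⟨hd, h1, h2⟩
        · right; omega
    have h1 := (card_le_card hsub).trans ((card_union_le _ _).trans (Nat.add_le_add_right (card_union_le _ _) _))
    rw [card_range] at h1
    have h2 : ((range X).filter (fun d => p ∣ d)).card ≤ X / p + 1 := by
      rw [← card_range (X / p + 1)]
      apply card_le_card_of_injOn (fun n => n / p)
      · intro n hn
        simp only [coe_filter, mem_range, Set.mem_ofPred_eq] at hn
        simp only [coe_range, Set.mem_Iio]
        exact Nat.lt_succ_of_le (Nat.div_le_div_right hn.1.le)
      · intro n hn n' hn' h
        simp only [coe_filter, mem_range, Set.mem_ofPred_eq] at hn hn' h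
        rw [← Nat.div_mul_cancel hn.2, h, Nat.div_mul_cancel hn'.2]
    have h3 : ((X / p : ℕ) : ℝ) ≤ X / p := Nat.cast_div_le
    have h4 : ((DD X).card : ℝ) ≤ G.card + ((X / p : ℕ) + 1) + p ^ 4 := by exact_mod_cast h1.trans (by omega)
    linarith
  calc _ ≤ 1 / (p:ℝ) * V 1 * G.card := by
        apply mul_le_mul_of_nonneg_left _ (mul_nonneg (by positivity) (V_nonneg _))
        linarith
    _ = ∑ d ∈ G, 1 / (p:ℝ) * V 1 := by rw [sum_const, nsmul_eq_mul]; ring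
    _ ≤ ∑ d ∈ G, (jacobiSym p d : ℝ) ^ 2 * W (√d) (p ^ 2) := by
        refine sum_le_sum fun d hd => ?_
        simp only [G, mem_filter] at hd
        have hcop : IsCoprime (p:ℤ) d := by
          rw [Nat.isCoprime_iff_coprime]
          exact (Nat.Prime.coprime_iff_not_dvd hp).2 hd.2.1
        have hj : (jacobiSym p d) ^ 2 = 1 := jacobiSym.sq_one (by
          rw [Int.gcd_natCast_natCast]
          exact (Nat.Prime.coprime_iff_not_dvd hp).2 hd.2.1)
        have hj' : (jacobiSym p d : ℝ) ^ 2 = 1 := by exact_mod_cast hj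
        rw [hj', one_mul, W]
        have e : (((p ^ 2 : ℕ)) : ℝ) ^ (-(1/2) : ℝ) = 1 / p := by
          push_cast
          rw [← Real.rpow_natCast, ← Real.rpow_mul hp0.le]
          norm_num
          rw [Real.rpow_neg_one]
        rw [e]
        apply mul_le_mul_of_nonneg_left _ (by positivity)
        apply V_anti (by positivity)
        have : (p:ℝ) ^ 2 ≤ √d := by
          apply Real.le_sqrt_of_sq_le
          rw [← pow_mul]
          exact_mod_cast hd.2.2
        push_cast
        exact div_le_one_of_le₀ this (by positivity)
    _ ≤ _ := sum_le_sum_of_subset_of_nonneg (filter_subset _ _) fun d _ _ => mul_nonneg (sq_nonneg _) (W_nonneg _ _)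

lemma V_min : ∃ K : ℝ, 0 < K ∧ ∀ X : ℕ, 0 < X → ∀ m : ℕ, m ≠ 0 → V (m / √X) ≤ K * min 1 (X / (m:ℝ) ^ 2) := by
  obtain ⟨C, hC, h⟩ := V_decay (A := 2) (by norm_num)
  refine ⟨max C (V 0), lt_max_of_lt_left hC, fun X hX m hm => ?_⟩
  have hX' : (0:ℝ) < X := by exact_mod_cast hX
  have hm' : (0:ℝ) < m := by exact_mod_cast Nat.pos_of_ne_zero hm
  rcases min_choice (1:ℝ) (X / (m:ℝ) ^ 2) with e | e <;> rw [e]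
  · rw [mul_one]
    exact (V_anti le_rfl (by positivity)).trans (le_max_right _ _)
  · refine (h _ (by positivity)).trans ?_
    have : ((m:ℝ) / √X) ^ (-2 : ℝ) = X / m ^ 2 := by
      rw [Real.rpow_neg (by positivity)]
      norm_cast
      rw [div_pow, Real.sq_sqrt hX'.le, inv_div]
      push_cast; rfl
    rw [this]
    gcongr
    exact le_max_left _ _

theorem real_main (B : ℕ) : ∃ d : ℕ, B < d ∧ Squarefree d ∧ d % 4 = 3 ∧
    ∃ _ : NeZero (1 * d), Lc (1 : DirichletCharacter ℂ 1) d ≠ 0 := by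
  classical
  by_contra hcon
  push Not at hcon
  obtain ⟨K, hK, hKV⟩ := V_min
  have hz : ∀ d, B < d → Squarefree d → d % 4 = 3 → ∑' m : ℕ, J m d * (W (√d) m : ℂ) = 0 := by
    intro d h1 h2 h3
    have : NeZero (1 * d) := ⟨by omega⟩
    exact real_afe h2 h3 (hcon d h1 h2 h3 this)
  set KB : ℝ := ∑ d ∈ range (B + 1), ‖∑' m : ℕ, J m d * (W (√d) m : ℂ)‖ with hKB
  have hsumm : ∀ X, ∀ d ∈ DD X, Summable (fun m : ℕ => J m d * (W (√d) m : ℂ)) := by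
    intro X d hd
    have : (0:ℝ) < d := by
      have := (mem_DD.1 hd).2.2
      exact_mod_cast (by omega : 0 < d)
    exact W_summable' (Real.sqrt_pos.2 this) (K := 1) (fun m => J_norm_le _ _)
  have hTs : ∀ X, Summable (Tm X) := fun X => summable_sum (hsumm X)
  have hF : ∀ X, ‖∑' m, Tm X m‖ ≤ KB := by
    intro X
    have : ∑' m, Tm X m = ∑ d ∈ DD X, ∑' m : ℕ, J m d * (W (√d) m : ℂ) := Summable.tsum_finsetSum (hsumm X)
    rw [this]
    refine (norm_sum_le _ _).trans ?_
    calc _ = ∑ d ∈ (DD X).filter (fun d => d < B + 1), ‖∑' m : ℕ, J m d * (W (√d) m : ℂ)‖ := by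
          rw [sum_filter]
          refine sum_congr rfl fun d hd => ?_
          split_ifs with h
          · rfl
          · rw [hz d (by omega) (mem_DD.1 hd).2.1 (mem_DD.1 hd).2.2, norm_zero]
      _ ≤ KB := by
          apply sum_le_sum_of_subset_of_nonneg
          · intro d hd
            rw [mem_filter] at hd
            exact mem_range.2 hd.2
          · intros; positivity
  have hmain : ∀ X : ℕ, 0 < X → ∀ P : Finset ℕ, ∑ p ∈ P, (Tm X (p ^ 2)).re ≤ KB + 36 * K * X := by
    intro X hX P
    have hX' : (0:ℝ) < X := by exact_mod_cast hX
    let b : ℕ → ℝ := fun m => if m = 0 then 0 else 12 * √X * (K * min 1 (X / (m:ℝ) ^ 2))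
    have hb0 : ∀ m, 0 ≤ b m := by intro m; simp only [b]; split_ifs <;> positivity
    have hbs : ∀ M, ∑ m ∈ range M, b m ≤ 36 * K * X := by
      intro M
      calc ∑ m ∈ range M, b m ≤ ∑ m ∈ insert 0 (Ico 1 M), b m := by
            apply sum_le_sum_of_subset_of_nonneg
            · intro m hm
              simp only [mem_insert, mem_Ico, mem_range] at *
              omega
            · intros; apply hb0
        _ = 12 * √X * K * ∑ m ∈ Ico 1 M, min ((1:ℕ):ℝ) (X / (m:ℝ) ^ 2) := by
            rw [sum_insert (by simp), mul_sum]
            simp only [b, if_true, zero_add]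
            refine sum_congr rfl fun m hm => ?_
            rw [if_neg (by have := (mem_Ico.1 hm).1; omega), Nat.cast_one]; ring
        _ ≤ 12 * √X * K * (3 * √((1:ℕ) * X)) := by
            gcongr
            exact min_sum_le one_pos hX M
        _ = 36 * K * X := by
            rw [Nat.cast_one, one_mul]
            linear_combination (36 * K) * Real.mul_self_sqrt hX'.le
    have hbsum : Summable b := summable_of_sum_range_le hb0 hbs
    have hbt : ∑' m, b m ≤ 36 * K * X := Real.tsum_le_of_sum_range_le hb0 hbs
    have hre : Summable (fun m => (Tm X m).re) := (hasSum_re (hTs X).hasSum).summable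
    have hret : ∑' m, (Tm X m).re = (∑' m, Tm X m).re := (hasSum_re (hTs X).hasSum).tsum_eq
    have hg : ∀ m, 0 ≤ (Tm X m).re + b m := by
      intro m
      by_cases hm : IsSquare m
      · obtain ⟨j, rfl⟩ := hm
        rw [← sq]
        exact add_nonneg (Tm_sq_nonneg X j) (hb0 _)
      · have hm0 : m ≠ 0 := by rintro rfl; exact hm ⟨0, rfl⟩
        have h1 := Tm_nonsq hX hm
        have h2 := hKV X hX m hm0
        have h3 : ‖Tm X m‖ ≤ b m := by
          simp only [b, if_neg hm0]
          exact h1.trans (by gcongr)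
        have h4 := (abs_le.1 (abs_re_le_norm (Tm X m))).1
        linarith
    have hinj : Set.InjOn (fun p : ℕ => p ^ 2) (P : Set ℕ) := by
      intro a _ c _ h
      exact Nat.pow_left_injective (by norm_num : (2:ℕ) ≠ 0) h
    calc ∑ p ∈ P, (Tm X (p ^ 2)).re = ∑ m ∈ P.image (fun p => p ^ 2), (Tm X m).re := (sum_image (f := fun m => (Tm X m).re) hinj).symm
      _ ≤ ∑ m ∈ P.image (fun p => p ^ 2), ((Tm X m).re + b m) := sum_le_sum fun m _ => by linarith [hb0 m]
      _ ≤ ∑' m, ((Tm X m).re + b m) := (hre.add hbsum).sum_le_tsum _ (fun m _ => hg m)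
      _ = (∑' m, Tm X m).re + ∑' m, b m := by rw [hre.tsum_add hbsum, hret]
      _ ≤ KB + 36 * K * X := by
          have := (re_le_norm (∑' m, Tm X m)).trans (hF X)
          linarith
  have hV1 : 0 < V 1 := V_pos 1
  have hbd : ∀ P : Finset ℕ, (∀ p ∈ P, p.Prime ∧ 24 ≤ p) → ∑ p ∈ P, 1 / (p:ℝ) ≤ 24 * (36 * K + 1) / V 1 := by
    intro P hP
    by_contra hlt
    push Not at hlt
    set S : ℝ := ∑ p ∈ P, 1 / (p:ℝ) with hS
    have hS0 : 0 ≤ S := sum_nonneg fun p _ => by positivity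
    set E : ℝ := ∑ p ∈ P, 1 / (p:ℝ) * V 1 * (3 + p ^ 4) with hE
    have hE0 : 0 ≤ E := sum_nonneg fun p _ => by positivity
    have hKB0 : 0 ≤ KB := sum_nonneg fun p _ => by positivity
    rw [div_lt_iff₀ hV1] at hlt
    obtain ⟨Z, hZ⟩ := exists_nat_gt (S * V 1 + E + KB + 1)
    have hZ0 : (1:ℝ) < Z := by
      have : 0 ≤ S * V 1 := by positivity
      linarith
    have hZ0' : 0 < Z := by exact_mod_cast (zero_lt_one.trans hZ0)
    have h1 := hmain (Z ^ 2) (by positivity) P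
    have h2 : S * V 1 * ((Z:ℝ) ^ 2 / 24 - Z) - E ≤ ∑ p ∈ P, (Tm (Z ^ 2) (p ^ 2)).re := by
      rw [hS, hE, sum_mul, sum_mul, ← sum_sub_distrib]
      refine sum_le_sum fun p hp => ?_
      refine le_trans ?_ (Tm_prime (Z ^ 2) p (hP p hp).1)
      have hc := card_DD (Z ^ 2)
      have hp24 : (24:ℝ) ≤ p := by exact_mod_cast (hP p hp).2
      push_cast at hc ⊢
      rw [Real.sqrt_sq (by positivity)] at hc
      rw [show 1 / (p:ℝ) * V 1 * ((Z:ℝ) ^ 2 / 24 - Z) - 1 / (p:ℝ) * V 1 * (3 + p ^ 4) = 1 / (p:ℝ) * V 1 * ((Z:ℝ) ^ 2 / 24 - Z - (3 + p ^ 4)) by ring]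
      apply mul_le_mul_of_nonneg_left _ (by positivity)
      have : (Z:ℝ) ^ 2 / p ≤ Z ^ 2 / 24 := by gcongr
      linarith
    push_cast at h1
    have h3 : (36 * K + 1) * (Z:ℝ) ^ 2 ≤ S * V 1 / 24 * Z ^ 2 := by
      gcongr; linarith
    have h4 : (Z:ℝ) * (S * V 1 + E + KB + 1) ≤ Z * Z := by gcongr
    nlinarith [mul_nonneg (sub_nonneg.2 hZ0.le) (add_nonneg hE0 hKB0)]
  apply not_summable_one_div_on_primes
  have hs : Summable (fun n : ℕ => if n.Prime ∧ 24 ≤ n then 1 / (n:ℝ) else 0) := by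
    apply summable_of_sum_le (c := 24 * (36 * K + 1) / V 1)
    · intro n; simp only [Pi.zero_apply]; split_ifs <;> positivity
    · intro u
      rw [← sum_filter]
      exact hbd _ (fun p hp => (mem_filter.1 hp).2)
  rw [← summable_nat_add_iff 24] at hs ⊢
  refine hs.congr fun n => ?_
  simp only [Set.indicator, Set.mem_ofPred_eq]
  by_cases h : (n + 24).Prime <;> simp [h]

end QT
end PartI

section PartJ
namespace QT
open Finset Complex

lemma euler_factor_ne {M : ℕ} (χ : DirichletCharacter ℂ M) {p : ℕ} (hp : p.Prime) :
    1 - χ p * (p:ℂ) ^ (-(1 / 2 : ℂ)) ≠ 0 := by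
  intro h
  have h1 : χ p * (p:ℂ) ^ (-(1 / 2 : ℂ)) = 1 := by linear_combination -h
  have h2 : ‖χ p * (p:ℂ) ^ (-(1 / 2 : ℂ))‖ = 1 := by rw [h1, norm_one]
  have hp1 : (1:ℝ) < p := by exact_mod_cast hp.one_lt
  rw [norm_mul, norm_natCast_cpow_of_pos hp.pos] at h2
  have h3 := χ.norm_le_one p
  have h4 : (p:ℝ) ^ ((-(1 / 2 : ℂ)).re) < 1 := by
    apply Real.rpow_lt_one_of_one_lt_of_neg hp1
    norm_num
  have h5 : 0 < (p:ℝ) ^ ((-(1 / 2 : ℂ)).re) := by positivity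
  nlinarith

lemma L_ne_iff {M K : ℕ} [NeZero M] [NeZero K] (h : M ∣ K) (ψ : DirichletCharacter ℂ M) :
    LFunction (changeLevel h ψ) (1 / 2) ≠ 0 ↔ LFunction ψ (1 / 2) ≠ 0 := by
  rw [LFunction_changeLevel h ψ (Or.inr (by norm_num))]
  have : ∏ p ∈ K.primeFactors, (1 - ψ p * (p:ℂ) ^ (-(1 / 2 : ℂ))) ≠ 0 :=
    prod_ne_zero_iff.2 fun p hp => euler_factor_ne ψ (Nat.prime_of_mem_primeFactors hp)
  rw [mul_ne_zero_iff]
  exact ⟨fun h => h.1, fun h => ⟨h, this⟩⟩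

lemma quadratic_of_sq {M : ℕ} {ψ : DirichletCharacter ℂ M} (h : ψ ^ 2 = 1) : MulChar.IsQuadratic ψ := by
  intro a
  by_cases ha : IsUnit a
  · right
    have h1 : (ψ ^ 2) a = 1 := by rw [h]; exact MulChar.one_apply ha
    rw [MulChar.pow_apply' _ (by norm_num)] at h1
    have h2 : (ψ a - 1) * (ψ a + 1) = 0 := by linear_combination h1
    rcases mul_eq_zero.1 h2 with h | h
    · left; linear_combination h
    · right; linear_combination h
  · left; exact MulChar.map_nonunit _ ha

theorem real_case {N : ℕ} [NeZero N] (χ : DirichletCharacter ℂ N) (hχ : χ ^ 2 = 1) (B : ℕ) :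
    ∃ (q : ℕ) (χ' : DirichletCharacter ℂ q) (_ : NeZero (N * q)), B < q ∧ χ'.IsPrimitive ∧ MulChar.IsQuadratic χ' ∧
      LFunction ((changeLevel (dvd_mul_right N q) χ) * (changeLevel (dvd_mul_left q N) χ')) (1 / 2) ≠ 0 := by
  obtain ⟨d, hBd, hsq, h3, h1d, hL⟩ := real_main (N * B)
  have hd0 : d ≠ 0 := by omega
  have hN0 : N ≠ 0 := NeZero.ne N
  have : NeZero d := ⟨hd0⟩
  have : NeZero (N * d) := ⟨mul_ne_zero hN0 hd0⟩
  have : NeZero (N * (N * d)) := ⟨mul_ne_zero hN0 (mul_ne_zero hN0 hd0)⟩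
  have hodd : _root_.Odd d := Nat.odd_iff.2 (by omega)
  set ψ : DirichletCharacter ℂ (N * d) := (changeLevel (dvd_mul_right N d) χ) * (changeLevel (dvd_mul_left d N) (jacChar d)) with hψ
  have hq0 : ψ.conductor ≠ 0 := conductor_ne_zero ψ
  have hqd : ψ.conductor ∣ N * d := conductor_dvd_level ψ
  have hNq : NeZero (N * ψ.conductor) := ⟨mul_ne_zero hN0 hq0⟩
  have hψ2 : ψ ^ 2 = 1 := by
    rw [hψ, mul_pow, ← map_pow, ← map_pow, hχ, (jacChar_quadratic d).sq_eq_one, map_one, map_one, one_mul]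
  have hK : N * ψ.conductor ∣ N * (N * d) := Nat.mul_dvd_mul_left _ hqd
  have hdK : d ∣ N * (N * d) := (dvd_mul_left _ _).trans (dvd_mul_left _ _)
  have hNK : N ∣ N * (N * d) := dvd_mul_right _ _
  have key : changeLevel hK ((changeLevel (dvd_mul_right N ψ.conductor) χ) * (changeLevel (dvd_mul_left ψ.conductor N) ψ.primitiveCharacter))
      = changeLevel hdK (jacChar d) := by
    rw [map_mul, ← changeLevel_trans, ← changeLevel_trans]
    rw [changeLevel_trans ψ.primitiveCharacter hqd (dvd_mul_left (N * d) N), changeLevel_primitiveCharacter]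
    have e : changeLevel (dvd_mul_left (N * d) N) ψ = changeLevel hNK χ * changeLevel hdK (jacChar d) := by
      rw [hψ, map_mul, ← changeLevel_trans, ← changeLevel_trans]
    rw [e]
    have e2 : changeLevel hNK χ * (changeLevel hNK χ * changeLevel hdK (jacChar d)) = changeLevel hdK (jacChar d) := by
      rw [← mul_assoc (changeLevel hNK χ), ← map_mul (changeLevel hNK), ← sq, hχ, map_one, one_mul]
    exact e2
  refine ⟨ψ.conductor, ψ.primitiveCharacter, hNq, ?_, primitiveCharacter_isPrimitive ψ, ?_, ?_⟩
  · have h1 : (changeLevel hdK (jacChar d)).conductor = d := by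
      rw [conductor_changeLevel]; exact jacChar_primitive hsq hodd
    have h2 : (changeLevel hdK (jacChar d)).conductor ∣ N * ψ.conductor := by
      rw [← key, conductor_changeLevel]; exact conductor_dvd_level _
    rw [h1] at h2
    have h3 := Nat.le_of_dvd (Nat.pos_of_ne_zero hNq.ne) h2
    exact lt_of_mul_lt_mul_left (hBd.trans_le h3) (Nat.zero_le N)
  · apply quadratic_of_sq
    apply changeLevel_injective hqd
    rw [map_pow, changeLevel_primitiveCharacter, hψ2, map_one]
  · rw [← L_ne_iff hK, key, L_ne_iff hdK]
    have h1 : 1 * d ∣ d := by rw [one_mul]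
    rw [← twist_eq, ← L_ne_iff h1, map_mul, ← changeLevel_trans, ← changeLevel_trans, changeLevel_one, one_mul, changeLevel_self] at hL
    exact hL

end QT
end PartJ

section PartK
namespace QT
open Finset Complex Filter Topology

lemma moebius_ind (m k : ℕ) (hk : k ≠ 0) :
    (if m.Coprime k then (1:ℂ) else 0) = ∑ e ∈ k.divisors, if e ∣ m then ((ArithmeticFunction.moebius e : ℤ) : ℂ) else 0 := by
  have h := congrArg (fun f => f (m.gcd k)) (ArithmeticFunction.moebius_mul_coe_zeta)
  simp only [ArithmeticFunction.coe_mul_zeta_apply, ArithmeticFunction.one_apply] at h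
  have h2 : (m.gcd k).divisors = k.divisors.filter (fun e => e ∣ m) := by
    ext e
    simp only [Nat.mem_divisors, mem_filter, Nat.dvd_gcd_iff]
    constructor
    · rintro ⟨⟨h1, h2⟩, _⟩; exact ⟨⟨h2, hk⟩, h1⟩
    · rintro ⟨⟨h1, _⟩, h3⟩; exact ⟨⟨h3, h1⟩, Nat.gcd_ne_zero_right hk⟩
  rw [h2, sum_filter] at h
  have h' := congrArg (fun z : ℤ => (z : ℂ)) h
  simp only [Int.cast_sum, Int.cast_ite, Int.cast_zero, Int.cast_one] at h'
  rw [h']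

lemma tsum_dvd {g : ℕ → ℂ} {e : ℕ} (he : e ≠ 0) : ∑' m, (if e ∣ m then g m else 0) = ∑' m, g (e * m) := by
  have hinj : Function.Injective (fun m : ℕ => e * m) := fun a b h => Nat.eq_of_mul_eq_mul_left (Nat.pos_of_ne_zero he) h
  have := hinj.tsum_eq (f := fun m => if e ∣ m then g m else 0) (by
    intro m hm
    simp only [Function.mem_support, ne_eq, ite_eq_right_iff, not_forall] at hm
    obtain ⟨⟨t, rfl⟩, _⟩ := hm
    exact ⟨t, rfl⟩)
  rw [← this]
  simp

lemma cop_tsum {g : ℕ → ℂ} (hg : Summable g) {k : ℕ} (hk : k ≠ 0) :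
    ∑' m, (if m.Coprime k then g m else 0) = ∑ e ∈ k.divisors, ((ArithmeticFunction.moebius e : ℤ) : ℂ) * ∑' m, g (e * m) := by
  have h1 : ∀ m, (if m.Coprime k then g m else 0) =
      ∑ e ∈ k.divisors, ((ArithmeticFunction.moebius e : ℤ) : ℂ) * (if e ∣ m then g m else 0) := by
    intro m
    have := moebius_ind m k hk
    calc (if m.Coprime k then g m else 0) = (if m.Coprime k then (1:ℂ) else 0) * g m := by split_ifs <;> simp
      _ = _ := by
        rw [this, sum_mul]
        refine sum_congr rfl fun e _ => ?_
        split_ifs <;> simp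
  simp_rw [h1]
  rw [Summable.tsum_finsetSum]
  · refine sum_congr rfl fun e he => ?_
    rw [tsum_mul_left, tsum_dvd (Nat.pos_of_mem_divisors he).ne']
  · intro e _
    apply Summable.mul_left
    have := hg.indicator {m | e ∣ m}
    refine this.congr fun m => ?_
    simp [Set.indicator]

lemma abel_anti {c : ℕ → ℂ} {g : ℕ → ℝ} {P : ℝ} {M : ℕ} (hP : ∀ j, ‖∑ n ∈ range j, c n‖ ≤ P)
    (hanti : ∀ i j, M ≤ i → i ≤ j → g j ≤ g i) (h0 : ∀ i, 0 ≤ g i) (L : ℕ) (hL : M ≤ L) :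
    ‖∑ i ∈ range L, c i * (g i : ℂ) - ∑ i ∈ range M, c i * (g i : ℂ)‖ ≤ 6 * P * g M := by
  have hP0 : 0 ≤ P := (norm_nonneg _).trans (hP 0)
  have hsh : ∀ j, ‖∑ n ∈ range j, c (M + n)‖ ≤ 2 * P := by
    intro j
    have := sum_range_add c M j
    rw [show ∑ n ∈ range j, c (M + n) = ∑ n ∈ range (M + j), c n - ∑ n ∈ range M, c n by rw [this]; ring]
    refine (norm_sub_le _ _).trans ?_
    linarith [hP (M + j), hP M]
  obtain ⟨x, rfl⟩ := Nat.exists_eq_add_of_le hL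
  rw [sum_range_add, add_sub_cancel_left]
  have h1 := abel_bound (c := fun n => c (M + n)) (v := fun n => g M - g (M + n)) (M := 2 * P) (K := g M) (x := x)
    (fun j _ => hsh j) (by
      intro a b hab
      have := hanti (M + a) (M + b) (by omega) (by omega)
      simp only; linarith) (by
      intro n
      have := hanti M (M + n) le_rfl (by omega)
      linarith) (by intro n _; linarith [h0 (M + n)]) (h0 M)
  have h2 : ∑ i ∈ range x, c (M + i) * (g (M + i) : ℂ) = (g M : ℂ) * ∑ i ∈ range x, c (M + i)
      - ∑ n ∈ range x, c (M + n) * ((g M - g (M + n) : ℝ) : ℂ) := by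
    rw [mul_sum, ← sum_sub_distrib]
    refine sum_congr rfl fun i _ => ?_
    push_cast; ring
  rw [h2]
  refine (norm_sub_le _ _).trans ?_
  rw [norm_mul, norm_real, Real.norm_of_nonneg (h0 M)]
  have := mul_le_mul_of_nonneg_left (hsh x) (h0 M)
  linarith

lemma abel_tail {c : ℕ → ℂ} {g : ℕ → ℝ} {P : ℝ} {M : ℕ} (hP : ∀ j, ‖∑ n ∈ range j, c n‖ ≤ P)
    (hanti : ∀ i j, M ≤ i → i ≤ j → g j ≤ g i) (h0 : ∀ i, 0 ≤ g i) (hs : Summable (fun i => c i * (g i : ℂ))) :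
    ‖∑' i, c i * (g i : ℂ) - ∑ i ∈ range M, c i * (g i : ℂ)‖ ≤ 6 * P * g M := by
  have ht := (hs.hasSum.tendsto_sum_nat.sub_const (∑ i ∈ range M, c i * (g i : ℂ))).norm
  refine le_of_tendsto ht ?_
  filter_upwards [eventually_ge_atTop M] with L hL
  exact abel_anti hP hanti h0 L hL

lemma char_sum_le {N : ℕ} [NeZero N] {ψ : DirichletCharacter ℂ N} (hψ : ψ ≠ 1) (j : ℕ) :
    ‖∑ n ∈ range j, ψ n‖ ≤ N := by
  refine periodic_bound (f := fun n : ℕ => ψ n) (Nat.pos_of_ne_zero (NeZero.ne N)) (fun n => by simp) ?_ (fun n => ψ.norm_le_one n) j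
  rw [← MulChar.sum_eq_zero_of_ne_one hψ]
  apply sum_bij (fun (n : ℕ) _ => (n : ZMod N))
  · intros; simp
  · intro a ha b hb h
    rw [ZMod.natCast_eq_natCast_iff'] at h
    rwa [Nat.mod_eq_of_lt (mem_range.1 ha), Nat.mod_eq_of_lt (mem_range.1 hb)] at h
  · intro b _
    exact ⟨b.val, mem_range.2 (ZMod.val_lt b), by simp⟩
  · intros; rfl

lemma L1_tail {N : ℕ} [NeZero N] {ψ : DirichletCharacter ℂ N} (hψ : ψ ≠ 1) {M : ℕ} (hM : 1 ≤ M) :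
    ‖LFunction ψ 1 - ∑ i ∈ range M, ψ i * (((i:ℝ)⁻¹ : ℝ) : ℂ)‖ ≤ 6 * N * (M:ℝ)⁻¹ := by
  have hM0 : (0:ℝ) < M := by exact_mod_cast hM
  have hs : ∀ s : ℝ, 1 < s → ‖LFunction ψ s - ∑ i ∈ range M, ψ i * (((i:ℝ) ^ (-s) : ℝ) : ℂ)‖ ≤ 6 * N * (M:ℝ) ^ (-s) := by
    intro s hs
    have hsum : Summable (fun i : ℕ => ψ i * (((i:ℝ) ^ (-s) : ℝ) : ℂ)) := by
      refine Summable.of_norm_bounded (Real.summable_nat_rpow.2 (by linarith : -s < -1)) fun i => ?_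
      rw [norm_mul, norm_real, Real.norm_of_nonneg (by positivity)]
      exact mul_le_of_le_one_left (by positivity) (ψ.norm_le_one i)
    have e : LFunction ψ s = ∑' i : ℕ, ψ i * (((i:ℝ) ^ (-s) : ℝ) : ℂ) := by
      rw [LFunction_eq_LSeries ψ (by simpa using hs), LSeries]
      refine tsum_congr fun i => ?_
      rw [LSeries.term_def]
      split_ifs with h
      · subst h; rw [show ((0:ℕ):ℝ) ^ (-s) = 0 by rw [Nat.cast_zero]; exact Real.zero_rpow (by linarith)]; simp
      · rw [Complex.ofReal_cpow (by positivity), Complex.ofReal_neg, Complex.cpow_neg]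
        push_cast; rw [div_eq_mul_inv]
    rw [e]
    refine abel_tail (P := N) (char_sum_le hψ) ?_ (fun i => by positivity) hsum
    intro i j hi hij
    have : (0:ℝ) < i := by exact_mod_cast (by omega : 0 < i)
    apply Real.rpow_le_rpow_of_nonpos this (by exact_mod_cast hij) (by linarith)
  have hc : Continuous fun s : ℝ => LFunction ψ (s : ℂ) := (differentiable_LFunction hψ).continuous.comp continuous_ofReal
  have h1 : Tendsto (fun s : ℝ => ‖LFunction ψ s - ∑ i ∈ range M, ψ i * (((i:ℝ) ^ (-s) : ℝ) : ℂ)‖) (𝓝[>] 1)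
      (𝓝 ‖LFunction ψ (1:ℝ) - ∑ i ∈ range M, ψ i * (((i:ℝ)⁻¹ : ℝ) : ℂ)‖) := by
    apply Tendsto.norm
    apply Tendsto.sub ((hc.tendsto 1).mono_left nhdsWithin_le_nhds)
    apply tendsto_finsetSum
    intro i _
    apply Tendsto.const_mul
    apply (continuous_ofReal.tendsto _).comp
    by_cases hi : i = 0
    · subst hi
      simp only [Nat.cast_zero, inv_zero]
      refine tendsto_const_nhds.congr' ?_
      filter_upwards [self_mem_nhdsWithin] with s hs
      rw [Real.zero_rpow]
      have : (1:ℝ) < s := hs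
      linarith
    · have hi0 : (0:ℝ) < i := by exact_mod_cast Nat.pos_of_ne_zero hi
      rw [← Real.rpow_neg_one]
      apply Tendsto.mono_left _ nhdsWithin_le_nhds
      apply Tendsto.rpow tendsto_const_nhds (tendsto_id.neg) (Or.inl hi0.ne')
  have h2 : Tendsto (fun s : ℝ => 6 * N * (M:ℝ) ^ (-s)) (𝓝[>] 1) (𝓝 (6 * N * (M:ℝ)⁻¹)) := by
    apply Tendsto.const_mul
    rw [← Real.rpow_neg_one]
    apply Tendsto.mono_left _ nhdsWithin_le_nhds
    apply Tendsto.rpow tendsto_const_nhds (tendsto_id.neg) (Or.inl hM0.ne')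
  have := le_of_tendsto_of_tendsto h1 h2 (by
    filter_upwards [self_mem_nhdsWithin] with s hs' using hs s hs')
  simpa using this

/-- weights -/
noncomputable def gB (y : ℝ) (i : ℕ) : ℝ := (i:ℝ)⁻¹ * V ((i:ℝ) ^ 2 / y)

lemma gB_nonneg (y : ℝ) (i : ℕ) : 0 ≤ gB y i := mul_nonneg (by positivity) (V_nonneg _)

lemma gB_le {y : ℝ} (hy : 0 < y) (i : ℕ) : gB y i ≤ V 0 * (i:ℝ)⁻¹ := by
  unfold gB
  rw [mul_comm]
  gcongr
  exact V_anti le_rfl (by positivity)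

lemma gB_anti {y : ℝ} (hy : 0 < y) {M : ℕ} (hM : 1 ≤ M) : ∀ i j, M ≤ i → i ≤ j → gB y j ≤ gB y i := by
  intro i j hi hij
  have : (0:ℝ) < i := by exact_mod_cast (by omega : 0 < i)
  have hij' : (i:ℝ) ≤ j := by exact_mod_cast hij
  unfold gB
  have h := V_anti (x := (i:ℝ) ^ 2 / y) (y := (j:ℝ) ^ 2 / y) (by positivity) (by gcongr)
  have := V_nonneg ((j:ℝ) ^ 2 / y)
  gcongr

lemma gB_summable {y : ℝ} (hy : 0 < y) : Summable (gB y) := by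
  obtain ⟨C, hC, h⟩ := V_decay (A := 1) (by norm_num)
  have : Summable (fun i : ℕ => C * y * ((i:ℝ) ^ 3)⁻¹) :=
    (Real.summable_nat_pow_inv.2 (by norm_num)).mul_left _
  refine Summable.of_nonneg_of_le (gB_nonneg y) (fun i => ?_) this
  by_cases hi : i = 0
  · subst hi; simp [gB]
  · have hi0 : (0:ℝ) < i := by exact_mod_cast Nat.pos_of_ne_zero hi
    unfold gB
    calc _ ≤ (i:ℝ)⁻¹ * (C * ((i:ℝ) ^ 2 / y) ^ (-1:ℝ)) := by
          gcongr; exact h _ (by positivity)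
      _ = _ := by rw [Real.rpow_neg_one]; field_simp

noncomputable def Bf {N : ℕ} (ψ : DirichletCharacter ℂ N) (y : ℝ) : ℂ := ∑' i : ℕ, ψ i * (gB y i : ℂ)

lemma Bf_summable {N : ℕ} (ψ : DirichletCharacter ℂ N) {y : ℝ} (hy : 0 < y) : Summable (fun i : ℕ => ψ i * (gB y i : ℂ)) := by
  refine Summable.of_norm_bounded (gB_summable hy) fun i => ?_
  rw [norm_mul, norm_real, Real.norm_of_nonneg (gB_nonneg y i)]
  exact mul_le_of_le_one_left (gB_nonneg y i) (ψ.norm_le_one i)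

lemma Bf_tail {N : ℕ} [NeZero N] {ψ : DirichletCharacter ℂ N} (hψ : ψ ≠ 1) {y : ℝ} (hy : 0 < y) {M : ℕ} (hM : 1 ≤ M) :
    ‖Bf ψ y - ∑ i ∈ range M, ψ i * (gB y i : ℂ)‖ ≤ 6 * N * (V 0 * (M:ℝ)⁻¹) := by
  refine (abel_tail (P := N) (char_sum_le hψ) (gB_anti hy hM) (gB_nonneg y) (Bf_summable ψ hy)).trans ?_
  gcongr
  exact gB_le hy M

lemma Bf_bounded {N : ℕ} [NeZero N] {ψ : DirichletCharacter ℂ N} (hψ : ψ ≠ 1) {y : ℝ} (hy : 0 < y) :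
    ‖Bf ψ y‖ ≤ 6 * N * V 0 := by
  have := Bf_tail hψ hy le_rfl
  simpa [gB] using this

lemma Bf_tendsto {N : ℕ} [NeZero N] {ψ : DirichletCharacter ℂ N} (hψ : ψ ≠ 1) :
    Tendsto (Bf ψ) atTop (𝓝 (V 0 * LFunction ψ 1)) := by
  rw [Metric.tendsto_nhds]
  intro ε hε
  have hV0 : 0 ≤ V 0 := V_nonneg 0
  obtain ⟨M, hM⟩ := exists_nat_gt (12 * N * V 0 * 2 / ε + 1)
  have hdiv : 0 ≤ 12 * N * V 0 * 2 / ε := by positivity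
  have hM1' : (1:ℝ) < M := by linarith
  have hM1 : 1 ≤ M := by exact_mod_cast hM1'.le
  have hMε : 12 * N * V 0 * (M:ℝ)⁻¹ < ε / 2 := by
    have : 12 * N * V 0 * 2 / ε < M := by linarith
    rw [div_lt_iff₀ hε] at this
    rw [← div_eq_mul_inv, div_lt_iff₀ (by linarith)]
    linarith
  have hfin : Tendsto (fun y : ℝ => ∑ i ∈ range M, ψ i * (gB y i : ℂ)) atTop
      (𝓝 (∑ i ∈ range M, ψ i * ((V 0 * (i:ℝ)⁻¹ : ℝ) : ℂ))) := by
    apply tendsto_finsetSum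
    intro i _
    apply Tendsto.const_mul
    apply (continuous_ofReal.tendsto _).comp
    unfold gB
    rw [mul_comm (V 0)]
    apply Tendsto.const_mul
    apply V_tendsto.comp
    rw [tendsto_nhdsWithin_iff]
    refine ⟨tendsto_const_nhds.div_atTop tendsto_id, ?_⟩
    filter_upwards [eventually_gt_atTop 0] with y hy
    simp only [Set.mem_Ici]; positivity
  have h2 := Metric.tendsto_nhds.1 hfin (ε / 2) (by linarith)
  filter_upwards [h2, eventually_gt_atTop 0] with y h hy
  rw [dist_eq_norm] at h ⊢
  have h3 := Bf_tail hψ hy hM1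
  have h4 := L1_tail hψ hM1
  have h5 : ‖(V 0 : ℂ) * LFunction ψ 1 - ∑ i ∈ range M, ψ i * ((V 0 * (i:ℝ)⁻¹ : ℝ) : ℂ)‖ ≤ V 0 * (6 * N * (M:ℝ)⁻¹) := by
    have : ∑ i ∈ range M, ψ i * ((V 0 * (i:ℝ)⁻¹ : ℝ) : ℂ) = (V 0 : ℂ) * ∑ i ∈ range M, ψ i * (((i:ℝ)⁻¹ : ℝ) : ℂ) := by
      rw [mul_sum]; refine sum_congr rfl fun i _ => ?_
      push_cast; ring
    rw [this, ← mul_sub, norm_mul, norm_real, Real.norm_of_nonneg hV0]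
    gcongr
  set a := Bf ψ y
  set b := ∑ i ∈ range M, ψ i * (gB y i : ℂ)
  set c := ∑ i ∈ range M, ψ i * ((V 0 * (i:ℝ)⁻¹ : ℝ) : ℂ)
  set l := (V 0 : ℂ) * LFunction ψ 1
  have e : a - l = (a - b) + (b - c) - (l - c) := by ring
  rw [e]
  refine (norm_sub_le _ _).trans_lt ?_
  have := norm_add_le (a - b) (b - c)
  linarith

end QT
end PartK

section PartL
namespace QT
open Finset Complex Filter Topology

/-- index set -/
def NN (a N X : ℕ) : Finset ℕ := (range X).filter (fun n => n % 4 = a ∧ n.Coprime N)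

/-- count of multiples -/
def Cf (a N f X : ℕ) : ℕ := ((range X).filter (fun n => (n % 4 = a ∧ n.Coprime N) ∧ f ∣ n)).card

/-- density -/
noncomputable def rho (a N : ℕ) : ℝ := ((NN a N (4 * N)).card : ℝ) / (4 * N)

lemma rho_pos {a N : ℕ} [NeZero N] (ha : a = 1 ∨ a = 3) : 0 < rho a N := by
  have hN : 0 < N := Nat.pos_of_ne_zero (NeZero.ne N)
  have hN' : (0:ℝ) < N := by exact_mod_cast hN
  have : 0 < (NN a N (4 * N)).card := by
    rw [card_pos]
    unfold NN
    rcases ha with rfl | rfl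
    · exact ⟨1, by simp; omega⟩
    · refine ⟨4 * N - 1, ?_⟩
      simp only [mem_filter, mem_range]
      refine ⟨by omega, by omega, ?_⟩
      rw [Nat.Coprime, ← Nat.dvd_one]
      have h1 := Nat.gcd_dvd_left (4 * N - 1) N
      have h2 : (4 * N - 1).gcd N ∣ 4 * N := (Nat.gcd_dvd_right (4 * N - 1) N).mul_left 4
      have h3 := Nat.dvd_sub h2 h1
      rwa [show 4 * N - (4 * N - 1) = 1 by omega] at h3
  have h' : (0:ℝ) < (NN a N (4 * N)).card := by exact_mod_cast this
  unfold rho; positivity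

lemma Cf_period {a N f : ℕ} [NeZero N] (hf : _root_.Odd f) (hfN : f.Coprime N) :
    Cf a N f (4 * N * f) = (NN a N (4 * N)).card := by
  have hN : 0 < N := Nat.pos_of_ne_zero (NeZero.ne N)
  have hf0 : 0 < f := hf.pos
  have h4 : Nat.Coprime 4 f := by
    have : Nat.Coprime (2 ^ 2) f := Nat.Coprime.pow_left 2 (Nat.coprime_two_left.2 hf)
    simpa using this
  have hc : Nat.Coprime (4 * N) f := Nat.Coprime.mul_left h4 hfN.symm
  have hmod4 : ∀ n, n % (4 * N) % 4 = n % 4 := fun n => Nat.mod_mod_of_dvd n (dvd_mul_right 4 N)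
  have hmodN : ∀ n, (n % (4 * N)).Coprime N ↔ n.Coprime N := by
    intro n
    have : (n % (4 * N)).gcd N = n.gcd N := by
      rw [Nat.gcd_comm, Nat.gcd_rec, Nat.mod_mod_of_dvd n (dvd_mul_left N 4), ← Nat.gcd_rec, Nat.gcd_comm]
    simp only [Nat.Coprime, this]
  unfold Cf NN
  apply card_bij (fun n _ => n % (4 * N))
  · intro n hn
    simp only [mem_filter, mem_range] at hn ⊢
    refine ⟨Nat.mod_lt _ (by omega), ?_, ?_⟩
    · rw [hmod4]; exact hn.2.1.1
    · rw [hmodN]; exact hn.2.1.2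
  · intro n hn n' hn' h
    simp only [mem_filter, mem_range] at hn hn'
    have : n ≡ n' [MOD (4 * N * f)] := by
      rw [← Nat.modEq_and_modEq_iff_modEq_mul hc]
      exact ⟨h, ((Nat.modEq_zero_iff_dvd).2 hn.2.2).trans ((Nat.modEq_zero_iff_dvd).2 hn'.2.2).symm⟩
    exact this.eq_of_lt_of_lt hn.1 hn'.1
  · intro b hb
    simp only [mem_filter, mem_range] at hb
    obtain ⟨n, h1, h2⟩ := Nat.chineseRemainder hc b 0
    have hlt : 0 < 4 * N * f := by positivity
    have h1' : n % (4 * N * f) % (4 * N) = b := by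
      rw [Nat.mod_mod_of_dvd _ (dvd_mul_right _ _)]
      rw [h1]; exact Nat.mod_eq_of_lt hb.1
    have h2' : f ∣ n % (4 * N * f) := by
      rw [Nat.dvd_mod_iff (dvd_mul_left _ _)]
      exact (Nat.modEq_zero_iff_dvd).1 h2
    refine ⟨n % (4 * N * f), ?_, h1'⟩
    simp only [mem_filter, mem_range]
    refine ⟨Nat.mod_lt _ hlt, ⟨?_, ?_⟩, h2'⟩
    · rw [← hmod4, h1']; exact hb.2.1
    · rw [← hmodN, h1']; exact hb.2.2

lemma Cf_approx {a N f : ℕ} [NeZero N] (hf : _root_.Odd f) (hfN : f.Coprime N) (X : ℕ) :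
    |(Cf a N f X : ℝ) - rho a N / f * X| ≤ 4 * N * f := by
  classical
  have hN : 0 < N := Nat.pos_of_ne_zero (NeZero.ne N)
  have hf0 : 0 < f := hf.pos
  have hN' : (0:ℝ) < N := by exact_mod_cast hN
  have hf0' : (0:ℝ) < f := by exact_mod_cast hf0
  have hr0 : 0 ≤ rho a N / f := by unfold rho; positivity
  have hsum : ∀ x, ∑ n ∈ range x, ((if ((n % 4 = a ∧ n.Coprime N) ∧ f ∣ n) then (1:ℂ) else 0) - ((rho a N / f : ℝ) : ℂ)) = (((Cf a N f x : ℝ) - rho a N / f * x : ℝ) : ℂ) := by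
    intro x
    rw [sum_sub_distrib, sum_const, card_range, ← sum_filter, sum_const, Cf]
    push_cast; simp; ring
  have hr1 : rho a N / f ≤ 1 := by
    have : rho a N ≤ 1 := by
      unfold rho
      apply div_le_one_of_le₀ _ (by positivity)
      have : (NN a N (4 * N)).card ≤ 4 * N := by
        refine (card_filter_le _ _).trans ?_
        rw [card_range]
      exact_mod_cast this
    have h1 : (1:ℝ) ≤ f := by exact_mod_cast hf0
    exact (div_le_self (by unfold rho; positivity) h1).trans this
  have := periodic_bound (f := fun n => ((if ((n % 4 = a ∧ n.Coprime N) ∧ f ∣ n) then (1:ℂ) else 0) - ((rho a N / f : ℝ) : ℂ)))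
    (Q := 4 * N * f) (by positivity) (by
      intro n
      have e1 : (n + 4 * N * f) % 4 = n % 4 := by
        rw [show 4 * N * f = 4 * (N * f) by ring]; omega
      have e2 : (n + 4 * N * f).Coprime N ↔ n.Coprime N := by
        rw [show 4 * N * f = N * (4 * f) by ring]; simp
      have e3 : f ∣ n + 4 * N * f ↔ f ∣ n := (Nat.dvd_add_left (dvd_mul_left _ _))
      simp only [e1, e2, e3]) (by
      rw [hsum, Cf_period hf hfN]
      rw [ofReal_eq_zero, rho]
      push_cast
      field_simp; ring) (by
      intro n
      split_ifs
      · rw [← ofReal_one, ← ofReal_sub, norm_real, Real.norm_eq_abs, abs_le]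
        constructor <;> linarith
      · rw [zero_sub, norm_neg, norm_real, Real.norm_of_nonneg hr0]; exact hr1) X
  rw [hsum, norm_real, Real.norm_eq_abs] at this
  push_cast at this
  exact this

lemma Cf_even {a N f : ℕ} (ha : a % 2 = 1) (hf : ¬ _root_.Odd f) (X : ℕ) : Cf a N f X = 0 := by
  unfold Cf
  rw [card_eq_zero, filter_eq_empty_iff]
  rintro n _ ⟨⟨h1, _⟩, h2⟩
  rw [Nat.not_odd_iff_even] at hf
  have := hf.two_dvd.trans h2
  omega

lemma Cf_le {a N f : ℕ} (ha : a % 2 = 1) (X : ℕ) : Cf a N f X ≤ X / f := by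
  unfold Cf
  conv_rhs => rw [← card_range (X / f)]
  by_cases hf : f = 0
  · subst hf
    rw [card_eq_zero.2]
    · exact Nat.zero_le _
    · rw [filter_eq_empty_iff]
      rintro n _ ⟨⟨h1, _⟩, h2⟩
      rw [Nat.zero_dvd] at h2; omega
  have hf0 : 0 < f := Nat.pos_of_ne_zero hf
  apply card_le_card_of_injOn (fun n => n / f - 1)
  · intro n hn
    simp only [coe_filter, mem_range, Set.mem_ofPred_eq] at hn
    simp only [coe_range, Set.mem_Iio]
    have h1 : n / f ≤ X / f := Nat.div_le_div_right hn.1.le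
    have h2 : 0 < n / f := Nat.div_pos (Nat.le_of_dvd (by omega) hn.2.2) hf0
    omega
  · intro n hn n' hn' h
    simp only [coe_filter, mem_range, Set.mem_ofPred_eq] at hn hn' h
    have h2 : 0 < n / f := Nat.div_pos (Nat.le_of_dvd (by omega) hn.2.2) hf0
    have h2' : 0 < n' / f := Nat.div_pos (Nat.le_of_dvd (by omega) hn'.2.2) hf0
    have h3 : n / f = n' / f := by omega
    rw [← Nat.div_mul_cancel hn.2.2, h3, Nat.div_mul_cancel hn'.2.2]

lemma Cf_le' {a N f : ℕ} (ha : a % 2 = 1) (X : ℕ) : (Cf a N f X : ℝ) ≤ X / f :=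
  (by exact_mod_cast Cf_le ha X : (Cf a N f X : ℝ) ≤ ((X / f : ℕ) : ℝ)).trans Nat.cast_div_le

open Classical in
lemma Cf_tendsto {a N f : ℕ} [NeZero N] (ha : a % 2 = 1) (hfN : f.Coprime N) :
    Tendsto (fun X : ℕ => (Cf a N f X : ℝ) / X) atTop (𝓝 (if _root_.Odd f then rho a N / f else 0)) := by
  split_ifs with hf
  · rw [tendsto_iff_norm_sub_tendsto_zero]
    have h1 : Tendsto (fun X : ℕ => (4 * N * f : ℝ) / X) atTop (𝓝 0) := tendsto_const_div_atTop_nhds_zero_nat _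
    refine squeeze_zero' (Eventually.of_forall fun _ => norm_nonneg _) ?_ h1
    filter_upwards [eventually_gt_atTop 0] with X hX
    have hX' : (0:ℝ) < X := by exact_mod_cast hX
    have e : (Cf a N f X : ℝ) / X - rho a N / f = ((Cf a N f X : ℝ) - rho a N / f * X) / X := by field_simp
    rw [e, norm_div, Real.norm_eq_abs, Real.norm_of_nonneg hX'.le]
    gcongr
    exact Cf_approx hf hfN X
  · simp [Cf_even ha hf]

lemma gB_mul {Y : ℝ} {f : ℕ} (hf : f ≠ 0) (i : ℕ) : gB Y (f * i) = (f:ℝ)⁻¹ * gB (Y / f ^ 2) i := by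
  unfold gB
  have hf0 : (f:ℝ) ≠ 0 := by exact_mod_cast hf
  push_cast
  rw [mul_inv]
  have : ((f:ℝ) * i) ^ 2 / Y = (i:ℝ) ^ 2 / (Y / f ^ 2) := by
    rw [div_div_eq_mul_div]; ring
  rw [this]; ring

/-- diagonal contribution -/
noncomputable def Dg {N : ℕ} (ψ : DirichletCharacter ℂ N) (a X : ℕ) (Y : ℝ) : ℂ :=
  ∑ n ∈ NN a N X, ∑' j : ℕ, if j.Coprime n then ψ j * (gB Y j : ℂ) else 0

lemma Dg_eq {N : ℕ} (ψ : DirichletCharacter ℂ N) {a : ℕ} (ha : a % 2 = 1) (X : ℕ) {Y : ℝ} (hY : 0 < Y) :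
    Dg ψ a X Y = ∑' f : ℕ, (Cf a N f X : ℂ) * (((ArithmeticFunction.moebius f : ℤ) : ℂ) * ψ f * ((f:ℝ)⁻¹ : ℝ) * Bf ψ (Y / f ^ 2)) := by
  unfold Dg
  set F : ℕ → ℂ := fun f => ((ArithmeticFunction.moebius f : ℤ) : ℂ) * ψ f * ((f:ℝ)⁻¹ : ℝ) * Bf ψ (Y / f ^ 2) with hF
  have h1 : ∀ n ∈ NN a N X, (∑' j : ℕ, if j.Coprime n then ψ j * (gB Y j : ℂ) else 0) = ∑ f ∈ range X, if f ∣ n then F f else 0 := by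
    intro n hn
    simp only [NN, mem_filter, mem_range] at hn
    have hn0 : n ≠ 0 := by rintro rfl; omega
    rw [cop_tsum (Bf_summable ψ hY) hn0]
    have hdiv : n.divisors = (range X).filter (fun f => f ∣ n) := by
      ext f
      simp only [Nat.mem_divisors, mem_filter, mem_range]
      exact ⟨fun h => ⟨(Nat.le_of_dvd (by omega) h.1).trans_lt hn.1, h.1⟩, fun h => ⟨h.2, hn0⟩⟩
    rw [hdiv, sum_filter]
    refine sum_congr rfl fun f _ => ?_
    split_ifs with hfn
    · have hf0 : f ≠ 0 := by rintro rfl; rw [Nat.zero_dvd] at hfn; exact hn0 hfn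
      rw [hF]
      simp only [Bf, mul_assoc]
      congr 1
      rw [← tsum_mul_left, ← tsum_mul_left]
      refine tsum_congr fun i => ?_
      rw [gB_mul hf0]
      push_cast
      rw [map_mul]; ring
    · rfl
  rw [sum_congr rfl h1, sum_comm]
  rw [tsum_eq_sum (s := range X)]
  · refine sum_congr rfl fun f _ => ?_
    rw [← sum_filter, sum_const, NN, filter_filter, nsmul_eq_mul, Cf]
  · intro f hf
    rw [mem_range, not_lt] at hf
    have : Cf a N f X = 0 := by
      unfold Cf
      rw [card_eq_zero, filter_eq_empty_iff]
      rintro n hn ⟨⟨h1, _⟩, h2⟩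
      rw [mem_range] at hn
      have := Nat.le_of_dvd (by omega) h2
      omega
    rw [this]; simp

open Classical in
lemma Dg_tendsto {N : ℕ} [NeZero N] {ψ : DirichletCharacter ℂ N} (hψ : ψ ≠ 1) {a : ℕ} (ha : a = 1 ∨ a = 3) :
    ∃ c : ℂ, c ≠ 0 ∧ Tendsto (fun T : ℕ => Dg ψ a (T ^ 7) ((T:ℝ) ^ 4) / ((T:ℂ) ^ 7)) atTop (𝓝 c) := by
  have ha2 : a % 2 = 1 := by rcases ha with rfl | rfl <;> rfl
  set b : ℕ → ℂ := fun f => if _root_.Odd f then ((ArithmeticFunction.moebius f : ℤ) : ℂ) * ψ f * ((((f:ℝ) ^ 2)⁻¹ : ℝ) : ℂ) else 0 with hb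
  have hmu : ∀ f, ‖((ArithmeticFunction.moebius f : ℤ) : ℂ)‖ ≤ 1 := by
    intro f
    rw [norm_intCast]
    exact_mod_cast ArithmeticFunction.abs_moebius_le_one
  have hmp : ∀ f : ℕ, ‖((ArithmeticFunction.moebius f : ℤ) : ℂ) * ψ f‖ ≤ 1 := by
    intro f
    rw [norm_mul]
    exact mul_le_one₀ (hmu f) (norm_nonneg _) (ψ.norm_le_one f)
  have hbn : ∀ f, ‖b f‖ ≤ 1 / (f:ℝ) ^ 2 := by
    intro f
    simp only [hb]
    split_ifs
    · rw [norm_mul, norm_real, Real.norm_of_nonneg (by positivity), one_div]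
      exact mul_le_of_le_one_left (by positivity) (hmp f)
    · rw [norm_zero]; positivity
  have hbs : Summable b := Summable.of_norm_bounded hasSum_zeta_two.summable hbn
  have hbne : ∑' f, b f ≠ 0 := by
    intro h0
    have h1 := hbs.tsum_eq_add_tsum_ite 1
    have hb1 : b 1 = 1 := by simp [hb]
    rw [h0, hb1] at h1
    have h2 := hasSum_zeta_two.summable.tsum_eq_add_tsum_ite 1
    rw [hasSum_zeta_two.tsum_eq] at h2
    have hs2 : Summable (fun n : ℕ => if n = 1 then 0 else 1 / (n:ℝ) ^ 2) := by
      refine Summable.of_nonneg_of_le (fun n => by split_ifs <;> positivity) (fun n => ?_) hasSum_zeta_two.summable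
      split_ifs
      · positivity
      · exact le_rfl
    have h3 : ‖∑' n, (if n = 1 then 0 else b n)‖ ≤ ∑' n : ℕ, (if n = 1 then 0 else 1 / (n:ℝ) ^ 2) := by
      apply tsum_of_norm_bounded hs2.hasSum
      intro n
      split_ifs
      · simp
      · exact hbn n
    have h4 : ∑' n, (if n = 1 then 0 else b n) = -1 := by linear_combination -h1
    rw [h4, norm_neg, norm_one] at h3
    have hpi := Real.pi_lt_d2
    have hpi0 := Real.pi_pos
    norm_num at h2
    norm_num at h3
    nlinarith
  refine ⟨∑' f, (V 0 * LFunction ψ 1) * (rho a N : ℂ) * b f, ?_, ?_⟩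
  · rw [tsum_mul_left]
    refine mul_ne_zero (mul_ne_zero (mul_ne_zero ?_ ?_) ?_) hbne
    · exact_mod_cast (V_pos 0).ne'
    · exact LFunction_apply_one_ne_zero hψ
    · exact_mod_cast (rho_pos ha).ne'
  · have hev : ∀ᶠ T : ℕ in atTop, (∑' f : ℕ, (((Cf a N f (T ^ 7) : ℝ) / (T ^ 7 : ℕ) : ℝ) : ℂ) * (((ArithmeticFunction.moebius f : ℤ) : ℂ) * ψ f * ((f:ℝ)⁻¹ : ℝ) * Bf ψ ((T:ℝ) ^ 4 / f ^ 2))) = Dg ψ a (T ^ 7) ((T:ℝ) ^ 4) / ((T:ℂ) ^ 7) := by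
      filter_upwards [eventually_gt_atTop 0] with T hT
      have hT' : (0:ℝ) < T := by exact_mod_cast hT
      rw [Dg_eq ψ ha2 _ (by positivity), ← tsum_div_const]
      refine tsum_congr fun f => ?_
      push_cast; ring
    refine Tendsto.congr' hev ?_
    have hV0 := V_nonneg 0
    apply tendsto_tsum_of_dominated_convergence (bound := fun f : ℕ => 6 * N * V 0 * (1 / (f:ℝ) ^ 2))
    · exact hasSum_zeta_two.summable.mul_left _
    · intro f
      by_cases hf0 : f = 0
      · subst hf0; simp [hb]
      by_cases hfN : f.Coprime N
      · have h7 : Tendsto (fun T : ℕ => T ^ 7) atTop atTop := tendsto_pow_atTop (by norm_num)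
        have h1 := (Cf_tendsto ha2 hfN).comp h7
        have h1' := (continuous_ofReal.tendsto _).comp h1
        have h2 : Tendsto (fun T : ℕ => (T:ℝ) ^ 4 / f ^ 2) atTop atTop := by
          apply Tendsto.atTop_div_const (by positivity)
          exact (tendsto_pow_atTop (by norm_num)).comp tendsto_natCast_atTop_atTop
        have h3 := (Bf_tendsto hψ).comp h2
        have h4 := h1'.mul (h3.const_mul (((ArithmeticFunction.moebius f : ℤ) : ℂ) * ψ f * ((f:ℝ)⁻¹ : ℝ)))
        convert h4 using 2
        · rfl
        · simp only [hb]
          split_ifs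
          · push_cast; ring
          · simp
      · have hz : ψ f = 0 := by
          apply MulChar.map_nonunit
          rwa [ZMod.isUnit_iff_coprime]
        simp [hb, hz]
    · filter_upwards [eventually_gt_atTop 0] with T hT f
      by_cases hf0 : f = 0
      · subst hf0; simp
      have hT' : (0:ℝ) < T := by exact_mod_cast hT
      have hf' : (0:ℝ) < f := by exact_mod_cast Nat.pos_of_ne_zero hf0
      rw [norm_mul, norm_mul, norm_mul, norm_real, norm_real, Real.norm_of_nonneg (by positivity), Real.norm_of_nonneg (by positivity)]
      have hc : (Cf a N f (T ^ 7) : ℝ) / (T ^ 7 : ℕ) ≤ 1 / f := by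
        rw [div_le_iff₀ (by positivity)]
        refine (Cf_le' ha2 _).trans (le_of_eq (by ring))
      calc _ ≤ (1 / (f:ℝ)) * (1 * (f:ℝ)⁻¹ * (6 * N * V 0)) := by
            gcongr
            · exact hmp f
            · exact Bf_bounded hψ (by positivity)
        _ = _ := by field_simp

end QT
end PartL

section PartM
namespace QT
open Finset Complex Filter Topology

/-- smoothed twisted sum -/
noncomputable def Sf {N : ℕ} (χ : DirichletCharacter ℂ N) (n : ℕ) (Y : ℝ) : ℂ :=
  ∑' m : ℕ, χ m * J m n * (W Y m : ℂ)

lemma chiJ_norm {N : ℕ} (χ : DirichletCharacter ℂ N) (n m : ℕ) : ‖χ m * J m n‖ ≤ 1 := by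
  rw [norm_mul]
  exact mul_le_one₀ (χ.norm_le_one _) (norm_nonneg _) (J_norm_le _ _)

lemma Sf_summable {N : ℕ} (χ : DirichletCharacter ℂ N) (n : ℕ) {Y : ℝ} (hY : 0 < Y) :
    Summable (fun m : ℕ => χ m * J m n * (W Y m : ℂ)) := W_summable' hY (chiJ_norm χ n)

lemma W_sq (Y : ℝ) (j : ℕ) : W Y (j ^ 2) = gB Y j := by
  unfold W gB
  have : (((j ^ 2 : ℕ)) : ℝ) ^ (-(1 / 2) : ℝ) = (j:ℝ)⁻¹ := by
    push_cast
    rw [Real.rpow_neg (by positivity), ← Real.sqrt_eq_rpow, Real.sqrt_sq (by positivity)]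
  rw [this]; push_cast; rfl

lemma J_sq_cop {n : ℕ} (hn : n ≠ 0) (j : ℕ) : J ((j ^ 2 : ℕ) : ℤ) n = if j.Coprime n then 1 else 0 := by
  have hz : NeZero n := ⟨hn⟩
  push_cast
  split_ifs with h
  · rw [J_sq, jacobiSym.sq_one]
    · simp
    · simpa [Int.gcd_natCast_natCast] using h
  · rw [J_sq]
    have : jacobiSym j n = 0 := by
      rw [jacobiSym.eq_zero_iff_not_coprime]
      simpa [Int.gcd_natCast_natCast] using h
    rw [this]; simp

lemma diag_eq {N : ℕ} (χ : DirichletCharacter ℂ N) {n : ℕ} (hn : n ≠ 0) (Y : ℝ) :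
    ∑' j : ℕ, (if j.Coprime n then (χ ^ 2) j * (gB Y j : ℂ) else 0) =
      ∑' m : ℕ, (if IsSquare m then χ m * J m n * (W Y m : ℂ) else 0) := by
  have hinj : Function.Injective (fun m : ℕ => m ^ 2) := Nat.pow_left_injective (by norm_num)
  have := hinj.tsum_eq (f := fun m : ℕ => if IsSquare m then χ m * J m n * (W Y m : ℂ) else 0) (by
    intro m hm
    simp only [Function.mem_support, ne_eq, ite_eq_right_iff, not_forall] at hm
    obtain ⟨⟨t, rfl⟩, _⟩ := hm
    exact ⟨t, by ring⟩)
  rw [← this]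
  refine tsum_congr fun j => ?_
  have h1 : IsSquare (j ^ 2) := ⟨j, by ring⟩
  rw [if_pos h1, J_sq_cop hn, W_sq, MulChar.pow_apply' _ (by norm_num)]
  push_cast
  rw [map_pow]
  split_ifs <;> simp

lemma Qm_le {N : ℕ} [NeZero N] {a : ℕ} (ha : a % 2 = 1) {m : ℕ} (hm : ¬ IsSquare m) (X : ℕ) :
    ‖∑ n ∈ NN a N X, J m n‖ ≤ 4 * m * N := by
  have hm0 : m ≠ 0 := by rintro rfl; exact hm ⟨0, rfl⟩
  obtain ⟨u, hu4, huN, hum, hJ⟩ := exists_jacobi_neg_one hm N (NeZero.ne N)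
  have hone : ∀ n : ℕ, (1 : DirichletCharacter ℂ N) n = if n.Coprime N then 1 else 0 := by
    intro n
    split_ifs with h
    · exact MulChar.one_apply ((ZMod.isUnit_iff_coprime _ _).2 h)
    · apply MulChar.map_nonunit
      rwa [ZMod.isUnit_iff_coprime]
  have := Xi_sum_le (1 : DirichletCharacter ℂ N) ha hm0 hu4 huN hum (by
    rw [hone, if_pos huN, hJ]; norm_num) X
  convert this using 2
  unfold NN
  rw [sum_filter]
  refine sum_congr rfl fun n _ => ?_
  unfold Xi
  rw [hone]
  by_cases h1 : n % 4 = a <;> by_cases h2 : n.Coprime N <;> simp [h1, h2]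

lemma off_le {N : ℕ} [NeZero N] (χ : DirichletCharacter ℂ N) {a : ℕ} (ha : a % 2 = 1) : ∃ C : ℝ, ∀ X : ℕ, ∀ Y : ℝ, 0 < Y →
    ‖∑ n ∈ NN a N X, Sf χ n Y - Dg (χ ^ 2) a X Y‖ ≤ C * Y ^ (8 / 5 : ℝ) := by
  obtain ⟨C, hC, h⟩ := W_le (A := 8 / 5) (by norm_num)
  have hs : Summable (fun m : ℕ => (m:ℝ) ^ (-(11 / 10) : ℝ)) := Real.summable_nat_rpow.2 (by norm_num)
  refine ⟨4 * N * C * ∑' m : ℕ, (m:ℝ) ^ (-(11 / 10) : ℝ), fun X Y hY => ?_⟩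
  have hsum : ∀ n, Summable (fun m : ℕ => if IsSquare m then 0 else χ m * J m n * (W Y m : ℂ)) := by
    intro n
    have := (Sf_summable χ n hY).indicator {m | ¬ IsSquare m}
    refine this.congr fun m => ?_
    by_cases hm : IsSquare m <;> simp [Set.indicator, hm]
  have hsum' : ∀ n, Summable (fun m : ℕ => if IsSquare m then χ m * J m n * (W Y m : ℂ) else 0) := by
    intro n
    have := (Sf_summable χ n hY).indicator {m | IsSquare m}
    refine this.congr fun m => ?_
    by_cases hm : IsSquare m <;> simp [Set.indicator, hm]
  have heq : ∑ n ∈ NN a N X, Sf χ n Y - Dg (χ ^ 2) a X Y =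
      ∑' m : ℕ, (if IsSquare m then 0 else χ m * (W Y m : ℂ) * ∑ n ∈ NN a N X, J m n) := by
    unfold Dg
    rw [← sum_sub_distrib]
    have : ∀ n ∈ NN a N X, Sf χ n Y - ∑' j : ℕ, (if j.Coprime n then (χ ^ 2) j * (gB Y j : ℂ) else 0) =
        ∑' m : ℕ, (if IsSquare m then 0 else χ m * J m n * (W Y m : ℂ)) := by
      intro n hn
      have hn0 : n ≠ 0 := by
        rintro rfl
        simp only [NN, mem_filter] at hn
        omega
      rw [diag_eq χ hn0, Sf, ← (Sf_summable χ n hY).tsum_sub (hsum' n)]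
      refine tsum_congr fun m => ?_
      split_ifs <;> simp
    rw [sum_congr rfl this, ← Summable.tsum_finsetSum (fun n _ => hsum n)]
    refine tsum_congr fun m => ?_
    split_ifs
    · simp
    · rw [mul_sum]
      exact sum_congr rfl fun n _ => by ring
  rw [heq]
  have hb : ∀ m : ℕ, ‖(if IsSquare m then 0 else χ m * (W Y m : ℂ) * ∑ n ∈ NN a N X, J m n)‖ ≤
      (4 * N * C * Y ^ (8 / 5 : ℝ)) * (m:ℝ) ^ (-(11 / 10) : ℝ) := by
    intro m
    split_ifs with hm
    · rw [norm_zero]; positivity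
    · have hm0 : m ≠ 0 := by rintro rfl; exact hm ⟨0, rfl⟩
      have hm' : (0:ℝ) < m := by exact_mod_cast Nat.pos_of_ne_zero hm0
      rw [norm_mul, norm_mul, norm_real, Real.norm_of_nonneg (W_nonneg _ _)]
      calc _ ≤ 1 * (C * Y ^ (8 / 5 : ℝ) * (m : ℝ) ^ (-(1 / 2) - 8 / 5 : ℝ)) * (4 * m * N) := by
            gcongr
            · exact W_nonneg _ _
            · exact χ.norm_le_one _
            · exact h Y hY m
            · exact Qm_le ha hm X
        _ = (4 * N * C * Y ^ (8 / 5 : ℝ)) * ((m : ℝ) ^ (-(1 / 2) - 8 / 5 : ℝ) * (m:ℝ) ^ (1:ℝ)) := by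
            rw [Real.rpow_one]; ring
        _ = _ := by
            rw [← Real.rpow_add hm']; norm_num
  refine (tsum_of_norm_bounded (hs.mul_left _).hasSum hb).trans (le_of_eq ?_)
  rw [tsum_mul_left]; ring

end QT
end PartM

section PartN
namespace QT
open Finset Complex Filter Topology

lemma W_scale {Y : ℝ} (e m : ℕ) : W Y (e * m) = (e:ℝ) ^ (-(1 / 2) : ℝ) * W (Y / e) m := by
  unfold W
  push_cast
  rw [Real.mul_rpow (by positivity) (by positivity)]
  have : (e:ℝ) * m / Y = m / (Y / e) := by rw [div_div_eq_mul_div]; ring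
  rw [this]; ring

lemma Sf_mul_sq {N : ℕ} (χ : DirichletCharacter ℂ N) {d k : ℕ} (hd : d ≠ 0) (hk : k ≠ 0) {Y : ℝ} (hY : 0 < Y) :
    Sf χ (d * k ^ 2) Y = ∑ e ∈ k.divisors, ((ArithmeticFunction.moebius e : ℤ) : ℂ) *
      (χ e * J e d * (((e:ℝ) ^ (-(1 / 2) : ℝ) : ℝ) : ℂ) * Sf χ d (Y / e)) := by
  have h1 : Sf χ (d * k ^ 2) Y = ∑' m : ℕ, (if m.Coprime k then χ m * J m d * (W Y m : ℂ) else 0) := by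
    unfold Sf
    refine tsum_congr fun m => ?_
    have h2 : J m (k ^ 2) = if m.Coprime k then 1 else 0 := by
      rw [← J_sq_cop hk]
      unfold J
      push_cast
      rw [jacobiSym.pow_right, jacobiSym.pow_left]
    rw [J_mul_right _ hd (pow_ne_zero 2 hk), h2]
    split_ifs <;> simp
  rw [h1, cop_tsum (Sf_summable χ d hY) hk]
  refine sum_congr rfl fun e _ => ?_
  congr 1
  unfold Sf
  rw [← tsum_mul_left]
  refine tsum_congr fun m => ?_
  rw [W_scale]
  push_cast
  rw [map_mul, J_mul_left]
  ring

lemma exists_u {N : ℕ} [NeZero N] {χ : DirichletCharacter ℂ N} (hχ : χ ^ 2 ≠ 1) (m : ℕ) (hm : m ≠ 0) :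
    ∃ u : ℕ, u % 4 = 1 ∧ u.Coprime N ∧ u.Coprime m ∧ χ u * J m u ≠ 1 := by
  obtain ⟨w, hw⟩ : ∃ w : (ZMod N)ˣ, (χ ^ 2) w ≠ 1 := by
    by_contra hcon
    push Not at hcon
    apply hχ
    ext w
    rw [hcon w, MulChar.one_apply_coe]
  obtain ⟨v, hv, hvp, hvw⟩ := Nat.forall_exists_prime_gt_and_eq_mod w.isUnit (m + N + 2)
  have hvm : v.Coprime m := (Nat.Prime.coprime_iff_not_dvd hvp).2 fun h => by
    have := Nat.le_of_dvd (Nat.pos_of_ne_zero hm) h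
    omega
  have hvN : v.Coprime N := (Nat.Prime.coprime_iff_not_dvd hvp).2 fun h => by
    have := Nat.le_of_dvd (Nat.pos_of_ne_zero (NeZero.ne N)) h
    omega
  refine ⟨v ^ 2, ?_, hvN.pow_left 2, hvm.pow_left 2, ?_⟩
  · have hodd := hvp.odd_of_ne_two (by omega)
    obtain ⟨t, ht⟩ := hodd
    rw [ht, show (2 * t + 1) ^ 2 = 4 * (t * t + t) + 1 by ring]
    omega
  · have h2 : J m (v ^ 2) = 1 := by
      have := J_sq_cop hvp.ne_zero m
      rw [if_pos hvm.symm] at this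
      rw [← this]
      unfold J
      push_cast
      rw [jacobiSym.pow_right, jacobiSym.pow_left]
    rw [h2, mul_one]
    push_cast
    rw [map_pow, hvw]
    rwa [MulChar.pow_apply' _ (by norm_num)] at hw

end QT
end PartN

section PartO
namespace QT
open Finset Complex Filter Topology

lemma rpow_alg {N e h D Y C : ℝ} (hN : 0 < N) (he : 0 < e) (hh : 0 < h) (hD : 0 < D) (hY : 0 < Y) :
    h ^ (-(1 / 2) : ℝ) * (2 * (6 * √(4 * (N * e * h) * N * D)) * (C * (h * (Y / (N * e)) / D) ^ (-(11 / 10) : ℝ))) =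
      (24 * N * C * N ^ (11 / 10 : ℝ)) * e ^ (8 / 5 : ℝ) * D ^ (8 / 5 : ℝ) * Y ^ (-(11 / 10) : ℝ) * h ^ (-(11 / 10) : ℝ) := by
  have h1 : √(4 * (N * e * h) * N * D) = 2 * N * (e ^ (1 / 2 : ℝ) * h ^ (1 / 2 : ℝ) * D ^ (1 / 2 : ℝ)) := by
    rw [← Real.mul_rpow he.le hh.le, ← Real.mul_rpow (by positivity) hD.le, ← Real.sqrt_eq_rpow,
      show 4 * (N * e * h) * N * D = (2 * N) ^ 2 * (e * h * D) by ring,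
      Real.sqrt_mul (by positivity), Real.sqrt_sq (by positivity)]
  have h2 : (h * (Y / (N * e)) / D) ^ (-(11 / 10) : ℝ) = h ^ (-(11 / 10) : ℝ) * Y ^ (-(11 / 10) : ℝ) * N ^ (11 / 10 : ℝ) * e ^ (11 / 10 : ℝ) * D ^ (11 / 10 : ℝ) := by
    rw [Real.div_rpow (by positivity) hD.le, Real.mul_rpow hh.le (by positivity), Real.div_rpow hY.le (by positivity),
      Real.mul_rpow hN.le he.le, Real.rpow_neg hN.le, Real.rpow_neg he.le, Real.rpow_neg hD.le]
    field_simp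
  have h3 : h ^ (-(1 / 2) : ℝ) * h ^ (1 / 2 : ℝ) = 1 := by
    rw [← Real.rpow_add hh]; norm_num
  have h4 : e ^ (8 / 5 : ℝ) = e ^ (1 / 2 : ℝ) * e ^ (11 / 10 : ℝ) := by rw [← Real.rpow_add he]; norm_num
  have h5 : D ^ (8 / 5 : ℝ) = D ^ (1 / 2 : ℝ) * D ^ (11 / 10 : ℝ) := by rw [← Real.rpow_add hD]; norm_num
  rw [h1, h2, h4, h5]
  linear_combination (24 * N * C * N ^ (11 / 10 : ℝ) * e ^ (1 / 2 : ℝ) * e ^ (11 / 10 : ℝ) * D ^ (1 / 2 : ℝ) * D ^ (11 / 10 : ℝ) * Y ^ (-(11 / 10) : ℝ) * h ^ (-(11 / 10) : ℝ)) * h3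

/-- cut coefficient -/
noncomputable def cc {N : ℕ} (χ : DirichletCharacter ℂ N) (a B m d : ℕ) : ℂ :=
  if B < d then (if Squarefree d then Xi χ a m d else 0) else 0

lemma cc_sum_le {N : ℕ} [NeZero N] {χ : DirichletCharacter ℂ N} (hχ : χ ^ 2 ≠ 1) {a m : ℕ} (ha : a % 2 = 1) (ha4 : a < 4)
    (hm : m ≠ 0) (B D j : ℕ) (hj : j ≤ D) : ‖∑ d ∈ range j, cc χ a B m d‖ ≤ 6 * √(4 * m * N * D) := by
  have hx := Xi_sqfree_sum_le χ ha ha4 hm (exists_u hχ m hm)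
  have hmono : ∀ i ≤ D, ‖∑ n ∈ range i, if Squarefree n then Xi χ a m n else 0‖ ≤ 3 * √(4 * m * N * D) := by
    intro i hi
    refine (hx i).trans ?_
    have : (i:ℝ) ≤ D := by exact_mod_cast hi
    gcongr
  have heq : ∑ d ∈ range j, cc χ a B m d = (∑ n ∈ range j, if Squarefree n then Xi χ a m n else 0) -
      ∑ n ∈ range (min j (B + 1)), if Squarefree n then Xi χ a m n else 0 := by
    rw [eq_sub_iff_add_eq]
    have : range (min j (B + 1)) = (range j).filter (fun d => ¬ B < d) := by
      ext d; simp
    rw [this, sum_filter, ← sum_add_distrib]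
    refine sum_congr rfl fun d _ => ?_
    unfold cc
    by_cases h : B < d <;> simp [h]
  rw [heq]
  refine (norm_sub_le _ _).trans ?_
  have h1 := hmono j hj
  have h2 := hmono (min j (B + 1)) ((min_le_left _ _).trans hj)
  linarith

lemma R_le {N : ℕ} [NeZero N] {χ : DirichletCharacter ℂ N} (hχ : χ ^ 2 ≠ 1) {a : ℕ} (ha : a % 2 = 1) (ha4 : a < 4) :
    ∃ C : ℝ, 0 < C ∧ ∀ B e h D : ℕ, ∀ Y : ℝ, 0 < e → 0 < h → 0 < D → 0 < Y →
      (h:ℝ) ^ (-(1 / 2) : ℝ) * ‖∑ d ∈ range D, cc χ a B (N * e * h) d * (vw (Y / (N * e)) h d : ℂ)‖ ≤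
        C * (e:ℝ) ^ (8 / 5 : ℝ) * (D:ℝ) ^ (8 / 5 : ℝ) * Y ^ (-(11 / 10) : ℝ) * (h:ℝ) ^ (-(11 / 10) : ℝ) := by
  obtain ⟨C, hC, hV⟩ := V_decay (A := 11 / 10) (by norm_num)
  have hN : (0:ℝ) < N := by exact_mod_cast Nat.pos_of_ne_zero (NeZero.ne N)
  refine ⟨24 * N * C * (N:ℝ) ^ (11 / 10 : ℝ), by positivity, ?_⟩
  intro B e h D Y he hh hD hY
  have he' : (0:ℝ) < e := by exact_mod_cast he
  have hh' : (0:ℝ) < h := by exact_mod_cast hh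
  have hD' : (0:ℝ) < D := by exact_mod_cast hD
  rw [← rpow_alg hN he' hh' hD' hY]
  have hm : N * e * h ≠ 0 := mul_ne_zero (mul_ne_zero (NeZero.ne N) he.ne') hh.ne'
  have := abel_bound (c := cc χ a B (N * e * h)) (v := vw (Y / (N * e)) h) (x := D)
    (fun j hj => cc_sum_le hχ ha ha4 hm B D j hj) (vw_mono (by positivity) h) (vw_nonneg _ h)
    (fun n hn => vw_mono (by positivity) h hn.le) (vw_nonneg _ h D)
  push_cast at this
  gcongr
  refine this.trans ?_
  gcongr
  rw [vw, if_neg hD.ne']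
  exact hV _ (by positivity)

lemma good_inner {N : ℕ} [NeZero N] {χ : DirichletCharacter ℂ N} (hχ : χ ^ 2 ≠ 1) {a : ℕ} (ha : a % 2 = 1) (ha4 : a < 4) :
    ∃ C : ℝ, 0 < C ∧ ∀ B e D : ℕ, ∀ Y : ℝ, 0 < e → 0 < D → 0 < Y →
      ‖∑ d ∈ range D, (if B < d ∧ Squarefree d ∧ d % 4 = a then
        J e d * (χ d * J N d) * Sf χ⁻¹ d (N * d / (Y / e)) else 0)‖ ≤
        C * (e:ℝ) ^ (8 / 5 : ℝ) * (D:ℝ) ^ (8 / 5 : ℝ) * Y ^ (-(11 / 10) : ℝ) := by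
  obtain ⟨C, hC, hR⟩ := R_le hχ ha ha4
  have hs : Summable (fun m : ℕ => (m:ℝ) ^ (-(11 / 10) : ℝ)) := Real.summable_nat_rpow.2 (by norm_num)
  have hN : (0:ℝ) < N := by exact_mod_cast Nat.pos_of_ne_zero (NeZero.ne N)
  have hs1 : 0 < ∑' m : ℕ, (m:ℝ) ^ (-(11 / 10) : ℝ) :=
    hs.tsum_pos (fun m => by positivity) 1 (by simp)
  refine ⟨C * ∑' m : ℕ, (m:ℝ) ^ (-(11 / 10) : ℝ), by positivity, ?_⟩
  intro B e D Y he hD hY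
  have he' : (0:ℝ) < e := by exact_mod_cast he
  set g : ℕ → ℕ → ℂ := fun d h => χ⁻¹ h * (((h:ℝ) ^ (-(1 / 2) : ℝ) : ℝ) : ℂ) * (cc χ a B (N * e * h) d * (vw (Y / (N * e)) h d : ℂ)) with hg
  have hterm : ∀ d h : ℕ, g d h = (if B < d ∧ Squarefree d ∧ d % 4 = a then
      J e d * (χ d * J N d) * (χ⁻¹ h * J h d * (W (N * d / (Y / e)) h : ℂ)) else 0) := by
    intro d h
    simp only [hg, cc, Xi]
    by_cases h1 : B < d
    · by_cases h2 : Squarefree d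
      · by_cases h3 : d % 4 = a
        · have hd0 : d ≠ 0 := by omega
          have hd' : (0:ℝ) < d := by exact_mod_cast Nat.pos_of_ne_zero hd0
          simp only [h1, h2, h3, if_true, and_self]
          rw [vw, if_neg hd0, W]
          have : (h:ℝ) * (Y / (N * e)) / d = h / (N * d / (Y / e)) := by field_simp
          rw [this]
          push_cast
          rw [J_mul_left, J_mul_left]
          ring
        · simp [h3]
      · simp [h2]
    · simp [h1]
  have hsum : ∀ d, Summable (g d) := by
    intro d
    by_cases h1 : B < d ∧ Squarefree d ∧ d % 4 = a
    · have hd0 : d ≠ 0 := by omega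
      have hd' : (0:ℝ) < d := by exact_mod_cast Nat.pos_of_ne_zero hd0
      refine ((Sf_summable χ⁻¹ d (Y := N * d / (Y / e)) (by positivity)).mul_left (J e d * (χ d * J N d))).congr fun h => ?_
      rw [hterm, if_pos h1]
    · refine summable_zero.congr fun h => ?_
      rw [hterm, if_neg h1]
  have heq : ∑ d ∈ range D, (if B < d ∧ Squarefree d ∧ d % 4 = a then
        J e d * (χ d * J N d) * Sf χ⁻¹ d (N * d / (Y / e)) else 0) = ∑' h, ∑ d ∈ range D, g d h := by
    rw [Summable.tsum_finsetSum (fun d _ => hsum d)]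
    refine sum_congr rfl fun d _ => ?_
    simp only [hterm]
    split_ifs
    · rw [tsum_mul_left, Sf]
    · simp
  rw [heq]
  have hb : ∀ h : ℕ, ‖∑ d ∈ range D, g d h‖ ≤ (C * (e:ℝ) ^ (8 / 5 : ℝ) * (D:ℝ) ^ (8 / 5 : ℝ) * Y ^ (-(11 / 10) : ℝ)) * (h:ℝ) ^ (-(11 / 10) : ℝ) := by
    intro h
    rcases Nat.eq_zero_or_pos h with rfl | hh
    · have : ∀ d, g d 0 = 0 := by
        intro d
        simp only [hg]
        rw [Nat.cast_zero (R := ℝ), Real.zero_rpow (by norm_num)]; simp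
      simp only [this, sum_const_zero, norm_zero]
      positivity
    · simp only [hg]
      rw [← mul_sum, norm_mul, norm_mul, norm_real, Real.norm_of_nonneg (by positivity), mul_assoc]
      exact (mul_le_of_le_one_left (by positivity) (χ⁻¹.norm_le_one _)).trans (hR B e h D Y he hh hD hY)
  refine (tsum_of_norm_bounded (hs.mul_left _).hasSum hb).trans (le_of_eq ?_)
  rw [tsum_mul_left]; ring

end QT
end PartO

section PartP
namespace QT
open Finset Complex Filter Topology

lemma sq_mod4 {k : ℕ} (hk : k % 2 = 1) (d : ℕ) : d * k ^ 2 % 4 = d % 4 := by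
  have h : k ^ 2 % 4 = 1 := by
    obtain ⟨t, ht⟩ : ∃ t, k = 2 * t + 1 := ⟨k / 2, by omega⟩
    rw [ht, show (2 * t + 1) ^ 2 = 4 * (t * t + t) + 1 by ring]
    omega
  rw [Nat.mul_mod, h]; simp

lemma mem_NN_sq {a N X d k : ℕ} (ha : a % 2 = 1) : d * k ^ 2 ∈ NN a N X ↔
    k % 2 = 1 ∧ k.Coprime N ∧ d * k ^ 2 < X ∧ d % 4 = a ∧ d.Coprime N := by
  unfold NN
  simp only [mem_filter, mem_range]
  constructor
  · rintro ⟨h1, h2, h3⟩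
    have hk : k % 2 = 1 := by
      by_contra hk
      obtain ⟨t, ht⟩ : ∃ t, k = 2 * t := ⟨k / 2, by omega⟩
      rw [ht, show d * (2 * t) ^ 2 = 4 * (d * t * t) by ring] at h2
      omega
    rw [sq_mod4 hk] at h2
    exact ⟨hk, (h3.coprime_dvd_left (dvd_mul_of_dvd_right (dvd_pow_self k two_ne_zero) d)), h1, h2, h3.coprime_dvd_left (dvd_mul_right d _)⟩
  · rintro ⟨h1, h2, h3, h4, h5⟩
    rw [sq_mod4 h1]
    exact ⟨h3, h4, h5.mul_left (h2.pow_left 2)⟩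

lemma good_k {N : ℕ} [NeZero N] {χ : DirichletCharacter ℂ N} (hχ : χ ^ 2 ≠ 1) {a : ℕ} (ha : a % 2 = 1) (ha4 : a < 4)
    {B : ℕ} {κ : ℂ} (hafe : ∀ d, B < d → Squarefree d → d % 4 = a → d.Coprime N → ∀ Y : ℝ, 0 < Y →
      Sf χ d Y = κ * (χ d * J N d) * Sf χ⁻¹ d (N * d / Y)) :
    ∃ C : ℝ, 0 ≤ C ∧ ∀ k X : ℕ, ∀ Y : ℝ, 0 < Y →
      ‖∑ d ∈ range X, (if B < d ∧ Squarefree d ∧ d * k ^ 2 ∈ NN a N X then Sf χ (d * k ^ 2) Y else 0)‖ ≤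
        C * (k:ℝ) ^ (-(11 / 10) : ℝ) * (X:ℝ) ^ (8 / 5 : ℝ) * Y ^ (-(11 / 10) : ℝ) := by
  obtain ⟨C, hC, hG⟩ := good_inner hχ ha ha4
  refine ⟨‖κ‖ * C * (2:ℝ) ^ (8 / 5 : ℝ), by positivity, ?_⟩
  intro k X Y hY
  by_cases hk : k % 2 = 1 ∧ k.Coprime N ∧ k ^ 2 < X
  swap
  · rw [sum_eq_zero, norm_zero]
    · positivity
    · intro d _
      rw [if_neg]
      rintro ⟨h1, h2, h3⟩
      rw [mem_NN_sq ha] at h3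
      apply hk
      refine ⟨h3.1, h3.2.1, lt_of_le_of_lt ?_ h3.2.2.1⟩
      exact Nat.le_mul_of_pos_left _ (by omega)
  obtain ⟨hk2, hkN, hkX⟩ := hk
  have hk0 : k ≠ 0 := by omega
  have hkpos : 0 < k ^ 2 := by positivity
  have hk' : (0:ℝ) < k := by exact_mod_cast Nat.pos_of_ne_zero hk0
  have hX' : (0:ℝ) < X := by exact_mod_cast (by omega : 0 < X)
  set D := (X - 1) / k ^ 2 + 1 with hD
  have hDlt : ∀ d, d < D ↔ d * k ^ 2 < X := by
    intro d
    rw [hD, Nat.lt_succ_iff, Nat.le_div_iff_mul_le hkpos]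
    omega
  have hDX : (D:ℝ) ≤ 2 * X / (k:ℝ) ^ 2 := by
    rw [le_div_iff₀ (by positivity)]
    have : D * k ^ 2 ≤ 2 * X := by
      rw [hD, add_mul, one_mul]
      have := Nat.div_mul_le_self (X - 1) (k ^ 2)
      omega
    exact_mod_cast this
  have heq : ∑ d ∈ range X, (if B < d ∧ Squarefree d ∧ d * k ^ 2 ∈ NN a N X then Sf χ (d * k ^ 2) Y else 0) =
      ∑ e ∈ k.divisors, ((ArithmeticFunction.moebius e : ℤ) : ℂ) * (χ e * (((e:ℝ) ^ (-(1 / 2) : ℝ) : ℝ) : ℂ) * κ) *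
        ∑ d ∈ range D, (if B < d ∧ Squarefree d ∧ d % 4 = a then
        J e d * (χ d * J N d) * Sf χ⁻¹ d (N * d / (Y / e)) else 0) := by
    have h1 : ∑ d ∈ range X, (if B < d ∧ Squarefree d ∧ d * k ^ 2 ∈ NN a N X then Sf χ (d * k ^ 2) Y else 0) =
        ∑ d ∈ range D, (if B < d ∧ Squarefree d ∧ d % 4 = a ∧ d.Coprime N then Sf χ (d * k ^ 2) Y else 0) := by
      rw [← sum_filter, ← sum_filter]
      refine sum_congr ?_ fun _ _ => rfl
      ext d
      simp only [mem_filter, mem_range, mem_NN_sq ha, hDlt]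
      constructor
      · rintro ⟨_, h1, h2, _, _, h3, h4, h5⟩
        exact ⟨h3, h1, h2, h4, h5⟩
      · rintro ⟨h3, h1, h2, h4, h5⟩
        exact ⟨lt_of_le_of_lt (Nat.le_mul_of_pos_right _ hkpos) h3, h1, h2, hk2, hkN, h3, h4, h5⟩
    rw [h1]
    simp_rw [mul_sum]
    rw [sum_comm]
    refine sum_congr rfl fun d _ => ?_
    by_cases hc : B < d ∧ Squarefree d ∧ d % 4 = a
    · by_cases hcop : d.Coprime N
      · rw [if_pos ⟨hc.1, hc.2.1, hc.2.2, hcop⟩, Sf_mul_sq χ (by omega) hk0 hY]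
        refine sum_congr rfl fun e he => ?_
        have he0 : 0 < e := Nat.pos_of_mem_divisors he
        rw [if_pos hc, hafe d hc.1 hc.2.1 hc.2.2 hcop (Y / e) (by positivity)]
        ring
      · have hz : χ d = 0 := by
          apply MulChar.map_nonunit
          rwa [ZMod.isUnit_iff_coprime]
        rw [if_neg (by tauto)]
        symm
        apply sum_eq_zero
        intro e _
        rw [hz]; simp
    · rw [if_neg (by tauto)]
      symm
      apply sum_eq_zero
      intro e _
      rw [if_neg hc, mul_zero]
  rw [heq]
  have hmu : ∀ f, ‖((ArithmeticFunction.moebius f : ℤ) : ℂ)‖ ≤ 1 := by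
    intro f
    rw [norm_intCast]
    exact_mod_cast ArithmeticFunction.abs_moebius_le_one
  have hD0 : 0 < D := Nat.succ_pos _
  have hterm : ∀ e ∈ k.divisors, ‖((ArithmeticFunction.moebius e : ℤ) : ℂ) * (χ e * (((e:ℝ) ^ (-(1 / 2) : ℝ) : ℝ) : ℂ) * κ) *
        ∑ d ∈ range D, (if B < d ∧ Squarefree d ∧ d % 4 = a then
        J e d * (χ d * J N d) * Sf χ⁻¹ d (N * d / (Y / e)) else 0)‖ ≤
      ‖κ‖ * C * (D:ℝ) ^ (8 / 5 : ℝ) * Y ^ (-(11 / 10) : ℝ) * (k:ℝ) ^ (11 / 10 : ℝ) := by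
    intro e he
    have he0 : 0 < e := Nat.pos_of_mem_divisors he
    have he' : (0:ℝ) < e := by exact_mod_cast he0
    have hek : (e:ℝ) ≤ k := by exact_mod_cast Nat.divisor_le he
    rw [norm_mul, norm_mul, norm_mul, norm_mul, norm_real, Real.norm_of_nonneg (by positivity)]
    calc _ ≤ 1 * (1 * (e:ℝ) ^ (-(1 / 2) : ℝ) * ‖κ‖) * (C * (e:ℝ) ^ (8 / 5 : ℝ) * (D:ℝ) ^ (8 / 5 : ℝ) * Y ^ (-(11 / 10) : ℝ)) := by
          gcongr
          · exact hmu e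
          · exact χ.norm_le_one _
          · exact hG B e D Y he0 hD0 hY
      _ = ‖κ‖ * C * (D:ℝ) ^ (8 / 5 : ℝ) * Y ^ (-(11 / 10) : ℝ) * ((e:ℝ) ^ (-(1 / 2) : ℝ) * (e:ℝ) ^ (8 / 5 : ℝ)) := by ring
      _ = ‖κ‖ * C * (D:ℝ) ^ (8 / 5 : ℝ) * Y ^ (-(11 / 10) : ℝ) * (e:ℝ) ^ (11 / 10 : ℝ) := by
          rw [← Real.rpow_add he']; norm_num
      _ ≤ _ := by gcongr
  refine (norm_sum_le_of_le _ hterm).trans ?_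
  rw [sum_const, nsmul_eq_mul]
  have hcard : (k.divisors.card : ℝ) ≤ k := by exact_mod_cast Nat.card_divisors_le_self k
  have hDp : (D:ℝ) ^ (8 / 5 : ℝ) ≤ (2:ℝ) ^ (8 / 5 : ℝ) * (X:ℝ) ^ (8 / 5 : ℝ) * (k:ℝ) ^ (-(16 / 5) : ℝ) := by
    calc (D:ℝ) ^ (8 / 5 : ℝ) ≤ (2 * X / (k:ℝ) ^ 2) ^ (8 / 5 : ℝ) := by gcongr
      _ = _ := by
        rw [Real.div_rpow (by positivity) (by positivity), Real.mul_rpow (by positivity) (by positivity),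
          ← Real.rpow_natCast, ← Real.rpow_mul hk'.le, Real.rpow_neg hk'.le, div_eq_mul_inv]
        norm_num
  calc _ ≤ (k:ℝ) * (‖κ‖ * C * ((2:ℝ) ^ (8 / 5 : ℝ) * (X:ℝ) ^ (8 / 5 : ℝ) * (k:ℝ) ^ (-(16 / 5) : ℝ)) * Y ^ (-(11 / 10) : ℝ) * (k:ℝ) ^ (11 / 10 : ℝ)) := by
        gcongr
    _ = ‖κ‖ * C * (2:ℝ) ^ (8 / 5 : ℝ) * ((k:ℝ) ^ (1:ℝ) * (k:ℝ) ^ (-(16 / 5) : ℝ) * (k:ℝ) ^ (11 / 10 : ℝ)) * (X:ℝ) ^ (8 / 5 : ℝ) * Y ^ (-(11 / 10) : ℝ) := by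
        rw [Real.rpow_one]; ring
    _ = _ := by
        rw [← Real.rpow_add hk', ← Real.rpow_add hk']; norm_num

end QT
end PartP

section PartQ
namespace QT
open Finset Complex Filter Topology

lemma Sf_le {N : ℕ} (χ : DirichletCharacter ℂ N) : ∃ C : ℝ, 0 ≤ C ∧ ∀ n : ℕ, ∀ Y : ℝ, 0 < Y →
    ‖Sf χ n Y‖ ≤ C * Y ^ (3 / 4 : ℝ) := by
  obtain ⟨C, hC, h⟩ := W_le (A := 3 / 4) (by norm_num)
  have hs : Summable (fun m : ℕ => (m:ℝ) ^ (-(1 / 2) - 3 / 4 : ℝ)) := Real.summable_nat_rpow.2 (by norm_num)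
  have hs0 : 0 ≤ ∑' m : ℕ, (m:ℝ) ^ (-(1 / 2) - 3 / 4 : ℝ) := tsum_nonneg fun m => by positivity
  refine ⟨C * ∑' m : ℕ, (m:ℝ) ^ (-(1 / 2) - 3 / 4 : ℝ), by positivity, fun n Y hY => ?_⟩
  unfold Sf
  refine (tsum_of_norm_bounded (hs.mul_left (C * Y ^ (3 / 4 : ℝ))).hasSum fun m => ?_).trans (le_of_eq ?_)
  · rw [norm_mul, norm_real, Real.norm_of_nonneg (W_nonneg _ _)]
    exact (mul_le_of_le_one_left (W_nonneg _ _) (chiJ_norm χ n m)).trans (h Y hY m)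
  · rw [tsum_mul_left]; ring

lemma NN_decomp {a N X : ℕ} (ha : a % 2 = 1) (F : ℕ → ℂ) :
    ∑ n ∈ NN a N X, F n = ∑ k ∈ range X, ∑ d ∈ range X,
      (if Squarefree d ∧ d * k ^ 2 ∈ NN a N X then F (d * k ^ 2) else 0) := by
  rw [← sum_product', ← sum_filter]
  symm
  have hpos : ∀ d k, d * k ^ 2 ∈ NN a N X → d ≠ 0 ∧ k ≠ 0 := by
    intro d k h
    rw [mem_NN_sq ha] at h
    omega
  apply sum_nbij (fun p => p.2 * p.1 ^ 2)
  · intro p hp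
    simp only [mem_filter] at hp
    exact hp.2.2
  · rintro ⟨k, d⟩ hp ⟨k', d'⟩ hp' heq
    simp only [coe_filter, Set.mem_ofPred_eq] at hp hp' heq
    obtain ⟨hd0, hk0⟩ := hpos _ _ hp.2.2
    obtain ⟨hd0', hk0'⟩ := hpos _ _ hp'.2.2
    have h1 : k ∣ k' := by
      rw [← sq_dvd_iff hp'.2.1 k k' hk0', ← heq]
      exact dvd_mul_left _ _
    have h2 : k' ∣ k := by
      rw [← sq_dvd_iff hp.2.1 k' k hk0, heq]
      exact dvd_mul_left _ _
    have h3 : k = k' := Nat.dvd_antisymm h1 h2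
    subst h3
    have := Nat.eq_of_mul_eq_mul_right (by positivity) heq
    rw [this]
  · intro n hn
    have hn' : n ∈ NN a N X := hn
    have hn0 : 0 < n := by
      simp only [NN, mem_filter] at hn'
      omega
    obtain ⟨d, k, hd, hk, heq, hsq⟩ := Nat.sq_mul_squarefree_of_pos hn0
    have hnX : n < X := by
      simp only [NN, mem_filter, mem_range] at hn'
      exact hn'.1
    have heq' : d * k ^ 2 = n := by rw [← heq, mul_comm]
    refine ⟨(k, d), ?_, heq'⟩
    simp only [coe_filter, Set.mem_ofPred_eq, mem_product, mem_range]
    have hk2 : k ≤ k ^ 2 := Nat.le_self_pow two_ne_zero k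
    have : k ^ 2 ≤ n := by rw [← heq']; exact Nat.le_mul_of_pos_left _ hd
    have : d ≤ n := by rw [← heq']; exact Nat.le_mul_of_pos_right _ (by positivity)
    exact ⟨⟨by omega, by omega⟩, hsq, by rw [heq']; exact hn'⟩
  · intro p _; rfl

lemma E_le {N : ℕ} [NeZero N] {χ : DirichletCharacter ℂ N} (hχ : χ ^ 2 ≠ 1) {a : ℕ} (ha : a % 2 = 1) (ha4 : a < 4)
    {B : ℕ} {κ : ℂ} (hafe : ∀ d, B < d → Squarefree d → d % 4 = a → d.Coprime N → ∀ Y : ℝ, 0 < Y →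
      Sf χ d Y = κ * (χ d * J N d) * Sf χ⁻¹ d (N * d / Y)) :
    ∃ C₁ C₂ : ℝ, ∀ X : ℕ, ∀ Y : ℝ, 0 < X → 0 < Y →
      ‖∑ n ∈ NN a N X, Sf χ n Y‖ ≤ C₁ * ((X:ℝ) ^ (8 / 5 : ℝ) * Y ^ (-(11 / 10) : ℝ)) + C₂ * (√X * Y ^ (3 / 4 : ℝ)) := by
  obtain ⟨C, hC, hg⟩ := good_k hχ ha ha4 hafe
  obtain ⟨C', hC', hb⟩ := Sf_le χ
  have hs : Summable (fun m : ℕ => (m:ℝ) ^ (-(11 / 10) : ℝ)) := Real.summable_nat_rpow.2 (by norm_num)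
  refine ⟨C * ∑' m : ℕ, (m:ℝ) ^ (-(11 / 10) : ℝ), 2 * (B + 1) * C', fun X Y hX hY => ?_⟩
  have hX1 : (1:ℝ) ≤ X := by exact_mod_cast hX
  have hsplit : ∑ n ∈ NN a N X, Sf χ n Y =
      (∑ k ∈ range X, ∑ d ∈ range X, (if B < d ∧ Squarefree d ∧ d * k ^ 2 ∈ NN a N X then Sf χ (d * k ^ 2) Y else 0)) +
      ∑ k ∈ range X, ∑ d ∈ range X, (if ¬ B < d ∧ Squarefree d ∧ d * k ^ 2 ∈ NN a N X then Sf χ (d * k ^ 2) Y else 0) := by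
    rw [NN_decomp ha, ← sum_add_distrib]
    refine sum_congr rfl fun k _ => ?_
    rw [← sum_add_distrib]
    refine sum_congr rfl fun d _ => ?_
    by_cases h : B < d <;> simp [h]
  rw [hsplit]
  refine (norm_add_le _ _).trans (add_le_add ?_ ?_)
  · refine (norm_sum_le_of_le _ (fun k _ => hg k X Y hY)).trans ?_
    rw [← sum_mul, ← sum_mul, ← mul_sum]
    have := hs.sum_le_tsum (range X) (fun m _ => by positivity)
    calc _ ≤ C * (∑' m : ℕ, (m:ℝ) ^ (-(11 / 10) : ℝ)) * (X:ℝ) ^ (8 / 5 : ℝ) * Y ^ (-(11 / 10) : ℝ) := by gcongr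
      _ = _ := by ring
  · have hk : ∀ k ∈ range X, ‖∑ d ∈ range X, (if ¬ B < d ∧ Squarefree d ∧ d * k ^ 2 ∈ NN a N X then Sf χ (d * k ^ 2) Y else 0)‖ ≤
        if k < Nat.sqrt X + 1 then (B + 1) * (C' * Y ^ (3 / 4 : ℝ)) else 0 := by
      intro k _
      split_ifs with hk
      · rw [← sum_filter]
        refine (norm_sum_le_of_le _ (fun d _ => hb (d * k ^ 2) Y hY)).trans ?_
        rw [sum_const, nsmul_eq_mul]
        gcongr
        have : ((range X).filter (fun d => ¬ B < d ∧ Squarefree d ∧ d * k ^ 2 ∈ NN a N X)).card ≤ (range (B + 1)).card := by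
          apply card_le_card
          intro d hd
          simp only [mem_filter, mem_range] at hd ⊢
          omega
        rw [card_range] at this
        exact_mod_cast this
      · rw [sum_eq_zero, norm_zero]
        intro d _
        rw [if_neg]
        rintro ⟨_, _, h3⟩
        rw [mem_NN_sq ha] at h3
        have hd0 : 0 < d := by omega
        have h4 : k ^ 2 < X := lt_of_le_of_lt (Nat.le_mul_of_pos_left _ hd0) h3.2.2.1
        apply hk
        have : k ≤ Nat.sqrt X := Nat.le_sqrt'.2 h4.le
        omega
    refine (norm_sum_le_of_le _ hk).trans ?_
    rw [← sum_filter, sum_const, nsmul_eq_mul]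
    have h1 : ((range X).filter (fun k => k < Nat.sqrt X + 1)).card ≤ (range (Nat.sqrt X + 1)).card := by
      apply card_le_card
      intro d hd
      simp only [mem_filter, mem_range] at hd ⊢
      omega
    rw [card_range] at h1
    have h2 : (((range X).filter (fun k => k < Nat.sqrt X + 1)).card : ℝ) ≤ 2 * √X := by
      calc _ ≤ ((Nat.sqrt X + 1 : ℕ) : ℝ) := by exact_mod_cast h1
        _ ≤ √X + 1 := by push_cast; gcongr; exact Real.nat_sqrt_le_real_sqrt
        _ ≤ 2 * √X := by
          have : 1 ≤ √(X:ℝ) := Real.one_le_sqrt.2 hX1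
          linarith
    calc _ ≤ 2 * √X * ((B + 1) * (C' * Y ^ (3 / 4 : ℝ))) := by gcongr
      _ = _ := by ring

end QT
end PartQ

section PartR
namespace QT
open Finset Complex Filter Topology

theorem complex_case {N : ℕ} [NeZero N] {χ : DirichletCharacter ℂ N} (hprim : χ.IsPrimitive) (hχ : χ ^ 2 ≠ 1) (B : ℕ) :
    ∃ (d : ℕ) (_ : NeZero (N * d)), B < d ∧ Squarefree d ∧ _root_.Odd d ∧ Lc χ d ≠ 0 := by
  by_contra hcon
  push Not at hcon
  obtain ⟨a, ha, hpar⟩ : ∃ a : ℕ, (a = 1 ∨ a = 3) ∧ ∀ d, d % 4 = a → χ (-1) * J (-1) d = -1 := by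
    have hJ : ∀ d, _root_.Odd d → J (-1) d = ((ZMod.χ₄ d : ℤ) : ℂ) := by
      intro d hd
      unfold J
      rw [jacobiSym.at_neg_one hd]
    rcases χ.even_or_odd with h | h
    · refine ⟨3, Or.inr rfl, fun d hd => ?_⟩
      rw [hJ d (Nat.odd_iff.2 (by omega)), ZMod.χ₄_nat_three_mod_four hd, h]
      simp
    · refine ⟨1, Or.inl rfl, fun d hd => ?_⟩
      rw [hJ d (Nat.odd_iff.2 (by omega)), ZMod.χ₄_nat_one_mod_four hd, h]
      simp
  have ha2 : a % 2 = 1 := by omega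
  have ha4 : a < 4 := by omega
  have hafe : ∀ d, B < d → Squarefree d → d % 4 = a → d.Coprime N → ∀ Y : ℝ, 0 < Y →
      Sf χ d Y = (I * gaussSum χ ZMod.stdAddChar / (√(N : ℝ) : ℂ) * gs a) * (χ d * J N d) * Sf χ⁻¹ d (N * d / Y) := by
    intro d hB hsq hd4 hcop Y hY
    have hd0 : NeZero d := ⟨by omega⟩
    have hNd : NeZero (N * d) := ⟨mul_ne_zero (NeZero.ne N) hd0.out⟩
    have hodd : _root_.Odd d := Nat.odd_iff.2 (by omega)
    have hgs : gs a = gs d := by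
      unfold gs
      rw [hd4, Nat.mod_eq_of_lt ha4]
    rw [hgs]
    exact twisted_afe hprim hsq hodd hcop.symm (hpar d hd4) (hcon d hNd hB hsq hodd) hY
  obtain ⟨C₁, C₂, hE⟩ := E_le hχ ha2 ha4 hafe
  obtain ⟨C₃, hO⟩ := off_le χ ha2
  obtain ⟨c, hc0, hc⟩ := Dg_tendsto hχ ha
  have hz : Tendsto (fun T : ℕ => Dg (χ ^ 2) a (T ^ 7) ((T:ℝ) ^ 4) / ((T:ℂ) ^ 7)) atTop (𝓝 0) := by
    have hlim : Tendsto (fun T : ℕ => (|C₁| + |C₂| + |C₃|) * (T:ℝ) ^ (-(1 / 5) : ℝ)) atTop (𝓝 0) := by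
      rw [← mul_zero (|C₁| + |C₂| + |C₃|)]
      exact ((tendsto_rpow_neg_atTop (by norm_num)).comp tendsto_natCast_atTop_atTop).const_mul _
    refine squeeze_zero_norm' ?_ hlim
    filter_upwards [eventually_gt_atTop 0] with T hT
    have hT' : (0:ℝ) < T := by exact_mod_cast hT
    have hT1 : (1:ℝ) ≤ T := by exact_mod_cast hT
    have h1 := hE (T ^ 7) ((T:ℝ) ^ 4) (by positivity) (by positivity)
    have h2 := hO (T ^ 7) ((T:ℝ) ^ 4) (by positivity)
    have e1 : (((T ^ 7 : ℕ) : ℝ)) ^ (8 / 5 : ℝ) * ((T:ℝ) ^ 4) ^ (-(11 / 10) : ℝ) = (T:ℝ) ^ (34 / 5 : ℝ) := by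
      push_cast
      rw [← Real.rpow_natCast, ← Real.rpow_natCast, ← Real.rpow_mul hT'.le, ← Real.rpow_mul hT'.le, ← Real.rpow_add hT']
      norm_num
    have e2 : √(((T ^ 7 : ℕ) : ℝ)) * ((T:ℝ) ^ 4) ^ (3 / 4 : ℝ) ≤ (T:ℝ) ^ (34 / 5 : ℝ) := by
      push_cast
      rw [Real.sqrt_eq_rpow, ← Real.rpow_natCast, ← Real.rpow_natCast, ← Real.rpow_mul hT'.le, ← Real.rpow_mul hT'.le, ← Real.rpow_add hT']
      exact Real.rpow_le_rpow_of_exponent_le hT1 (by norm_num)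
    have e3 : ((T:ℝ) ^ 4) ^ (8 / 5 : ℝ) ≤ (T:ℝ) ^ (34 / 5 : ℝ) := by
      rw [← Real.rpow_natCast, ← Real.rpow_mul hT'.le]
      exact Real.rpow_le_rpow_of_exponent_le hT1 (by norm_num)
    have e4 : (T:ℝ) ^ (34 / 5 : ℝ) = (T:ℝ) ^ (-(1 / 5) : ℝ) * (T:ℝ) ^ 7 := by
      rw [← Real.rpow_natCast, ← Real.rpow_add hT']; norm_num
    rw [norm_div, norm_pow, norm_natCast, div_le_iff₀ (by positivity), mul_assoc, ← e4]
    have h3 : ‖Dg (χ ^ 2) a (T ^ 7) ((T:ℝ) ^ 4)‖ ≤ ‖∑ n ∈ NN a N (T ^ 7), Sf χ n ((T:ℝ) ^ 4)‖ +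
        ‖∑ n ∈ NN a N (T ^ 7), Sf χ n ((T:ℝ) ^ 4) - Dg (χ ^ 2) a (T ^ 7) ((T:ℝ) ^ 4)‖ := by
      have := norm_sub_le (∑ n ∈ NN a N (T ^ 7), Sf χ n ((T:ℝ) ^ 4)) (∑ n ∈ NN a N (T ^ 7), Sf χ n ((T:ℝ) ^ 4) - Dg (χ ^ 2) a (T ^ 7) ((T:ℝ) ^ 4))
      rwa [sub_sub_cancel] at this
    rw [e1] at h1
    have b1 : C₁ * (T:ℝ) ^ (34 / 5 : ℝ) ≤ |C₁| * (T:ℝ) ^ (34 / 5 : ℝ) := by gcongr; exact le_abs_self _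
    have b2 : C₂ * (√(((T ^ 7 : ℕ) : ℝ)) * ((T:ℝ) ^ 4) ^ (3 / 4 : ℝ)) ≤ |C₂| * (T:ℝ) ^ (34 / 5 : ℝ) := by
      gcongr; exact le_abs_self _
    have b3 : C₃ * ((T:ℝ) ^ 4) ^ (8 / 5 : ℝ) ≤ |C₃| * (T:ℝ) ^ (34 / 5 : ℝ) := by
      gcongr; exact le_abs_self _
    linarith
  exact hc0 (tendsto_nhds_unique hc hz)

end QT
end PartR

/-- GL(1) instance of the non-vanishing principle of §3.4: if `χ` is a primitive Dirichlet
character of conductor `N ≥ 1` whose root number `ε_χ = τ(χ)/(i^δ N^{1/2})` is not `-1`, then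
there are infinitely many real (quadratic) primitive Dirichlet characters `χ'` (i.e. real
primitive characters of arbitrarily large conductor `q`) with `L(1/2, χ·χ') ≠ 0`. -/
theorem infinitely_many_nonvanishing_quadratic_twists_GL1
    (N : ℕ) [NeZero N] (hN : 1 ≤ N) (χ : DirichletCharacter ℂ N) (hχ : χ.IsPrimitive)
    (hroot : DirichletCharacter.rootNumber χ ≠ -1) :
    ∀ B : ℕ, ∃ (q : ℕ) (χ' : DirichletCharacter ℂ q), B < q ∧ χ'.IsPrimitive ∧
      MulChar.IsQuadratic χ' ∧ twistedCentralValue χ χ' ≠ 0 := by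
  intro B
  by_cases h2 : χ ^ 2 = 1
  · obtain ⟨q, χ', hq, h1, h3, h4, h5⟩ := QT.real_case χ h2 B
    refine ⟨q, χ', h1, h3, h4, ?_⟩
    unfold twistedCentralValue
    rw [dif_pos hq.out]
    exact h5
  · obtain ⟨d, hd, h1, h3, h4, h5⟩ := QT.complex_case hχ h2 B
    haveI : NeZero d := ⟨by omega⟩
    refine ⟨d, QT.jacChar d, h1, QT.jacChar_primitive h3 h4, QT.jacChar_quadratic d, ?_⟩
    unfold twistedCentralValue
    rw [dif_pos hd.out, QT.twist_eq]
    exact h5
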